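/- arXiv:2511.23234 — 3 statements merged into one kernel-verified Lean document; each statement's English description precedes it below -/
import Mathlib

section
/- Interior derivative estimates (flat-background case of Theorem 3.2(i) of the paper): There exists ε₀(n) > 0 such that for every integer j ≥ 1 and every r > 0 there is a constant c_j(n,r) > 0 with the following property. For every x₀ ∈ ℝⁿ, every T ∈ (0,1], and every Ricci–DeTurck flow g on B(x₀,4r) over the time interval (0,T) satisfying |g(t,x) − δ| ≤ ε₀(n) for all (t,x) ∈ (0,T) × B(x₀,4r), one has |∂^j g(t,x)|² ≤ c_j(n,r) / t^j for all t ∈ (0,T) and all x ∈ B(x₀,r). -/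
open MeasureTheory Metric Set Filter Topology

noncomputable section

/-- Euclidean space `ℝⁿ`. -/
abbrev Eucl (n : ℕ) : Type := EuclideanSpace ℝ (Fin n)

/-- The partial derivative `∂_a f` of a scalar function in the `a`-th coordinate direction. -/
noncomputable def pd {n : ℕ} (a : Fin n) (f : Eucl n → ℝ) (x : Eucl n) : ℝ :=
  fderiv ℝ f x (EuclideanSpace.single a 1)

/-- Squared Frobenius distance between two `n × n` matrices. -/
def matDistSq {n : ℕ} (A B : Matrix (Fin n) (Fin n) ℝ) : ℝ :=
  ∑ i, ∑ j, (A i j - B i j) ^ 2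

/-- `|∂g|²` for a time-dependent matrix field (flat background). -/
noncomputable def gradSq {n : ℕ} (g : ℝ → Eucl n → Matrix (Fin n) (Fin n) ℝ)
    (t : ℝ) (x : Eucl n) : ℝ :=
  ∑ a, ∑ i, ∑ j, (pd a (fun y => g t y i j) x) ^ 2

/-- `|∂²g|²` for a time-dependent matrix field (flat background). -/
noncomputable def hessSq {n : ℕ} (g : ℝ → Eucl n → Matrix (Fin n) (Fin n) ℝ)
    (t : ℝ) (x : Eucl n) : ℝ :=
  ∑ a, ∑ b, ∑ i, ∑ j, (pd a (fun y => pd b (fun z => g t z i j) y) x) ^ 2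

/-- `|∂k|²` for a static matrix field. -/
noncomputable def gradSqS {n : ℕ} (k : Eucl n → Matrix (Fin n) (Fin n) ℝ) (x : Eucl n) : ℝ :=
  ∑ a, ∑ i, ∑ j, (pd a (fun y => k y i j) x) ^ 2

/-- `|∂²k|²` for a static matrix field. -/
noncomputable def hessSqS {n : ℕ} (k : Eucl n → Matrix (Fin n) (Fin n) ℝ) (x : Eucl n) : ℝ :=
  ∑ a, ∑ b, ∑ i, ∑ j, (pd a (fun y => pd b (fun z => k z i j) y) x) ^ 2

/-- A Ricci–DeTurck flow with flat Euclidean background metric on the spatial set `U`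
over the time set `I`: a jointly smooth family of symmetric positive-definite matrix
fields satisfying the flat-background Ricci–DeTurck equation. -/
def IsRicciDeTurckFlow {n : ℕ} (g : ℝ → Eucl n → Matrix (Fin n) (Fin n) ℝ)
    (I : Set ℝ) (U : Set (Eucl n)) : Prop :=
  (∀ i j : Fin n, ContDiffOn ℝ (⊤ : ℕ∞) (fun p : ℝ × Eucl n => g p.1 p.2 i j) (I ×ˢ U)) ∧
  (∀ t ∈ I, ∀ x ∈ U, (g t x).IsSymm ∧ (g t x).PosDef) ∧
  (∀ t ∈ I, ∀ x ∈ U, ∀ i j : Fin n,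
    deriv (fun s => g s x i j) t =
      (∑ a, ∑ b, (g t x)⁻¹ a b * pd a (fun y => pd b (fun z => g t z i j) y) x)
      + (1/2) * ∑ a, ∑ b, ∑ p, ∑ q, (g t x)⁻¹ a b * (g t x)⁻¹ p q *
        ( pd i (fun y => g t y p a) x * pd j (fun y => g t y q b) x
          + 2 * pd a (fun y => g t y j p) x * pd q (fun y => g t y i b) x
          - 2 * pd a (fun y => g t y j p) x * pd b (fun y => g t y i q) x
          - 2 * pd j (fun y => g t y p a) x * pd b (fun y => g t y i q) x
          - 2 * pd i (fun y => g t y p a) x * pd b (fun y => g t y j q) x ))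

/-- Iterated partial derivative along a list of coordinate directions. -/
noncomputable def pdIter {n : ℕ} : List (Fin n) → (Eucl n → ℝ) → Eucl n → ℝ
  | [], f => f
  | a :: l, f => pd a (pdIter l f)

/-- `|∂^j g|²`: the sum of the squares of all `j`-th order partial derivatives of all
entries of the time-dependent matrix field `g` at time `t` and point `x`. -/
noncomputable def djSq {n : ℕ} (j : ℕ) (g : ℝ → Eucl n → Matrix (Fin n) (Fin n) ℝ)
    (t : ℝ) (x : Eucl n) : ℝ :=
  ∑ a : Fin j → Fin n, ∑ i, ∑ k, (pdIter (List.ofFn a) (fun y => g t y i k) x) ^ 2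

open scoped ContDiff

/-- The directional derivative of `F` in the direction `v`. -/
def dirDeriv {E : Type*} [NormedAddCommGroup E] [NormedSpace ℝ E] (v : E) (F : E → ℝ) (z : E) : ℝ :=
  fderiv ℝ F z v

section DirDeriv

variable {E : Type*} [NormedAddCommGroup E] [NormedSpace ℝ E] {Ω : Set E}

lemma ContDiffOn.differentiableAt_of_isOpen {E' : Type*} [NormedAddCommGroup E'] [NormedSpace ℝ E']
    {F : E → E'} (hF : ContDiffOn ℝ ∞ F Ω) (hΩ : IsOpen Ω) {z : E} (hz : z ∈ Ω) :
    DifferentiableAt ℝ F z :=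
  (hF.contDiffAt (hΩ.mem_nhds hz)).differentiableAt (by simp)

lemma ContDiffOn.dirDeriv {F : E → ℝ} (hF : ContDiffOn ℝ ∞ F Ω) (hΩ : IsOpen Ω) (v : E) :
    ContDiffOn ℝ ∞ (dirDeriv v F) Ω :=
  (hF.fderiv_of_isOpen hΩ (m := ∞) (by simp)).clm_apply contDiffOn_const

lemma dirDeriv_congr {F G : E → ℝ} (hΩ : IsOpen Ω) (h : EqOn F G Ω) (v : E) :
    EqOn (dirDeriv v F) (dirDeriv v G) Ω := fun z hz => by
  have : F =ᶠ[𝓝 z] G := h.eventuallyEq_of_mem (hΩ.mem_nhds hz)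
  simp only [dirDeriv, this.fderiv_eq]

lemma dirDeriv_comm {F : E → ℝ} (hF : ContDiffOn ℝ ∞ F Ω) (hΩ : IsOpen Ω) (v w : E) :
    EqOn (dirDeriv v (dirDeriv w F)) (dirDeriv w (dirDeriv v F)) Ω := fun z hz => by
  have h1 : DifferentiableAt ℝ (fderiv ℝ F) z :=
    (hF.fderiv_of_isOpen hΩ (m := ∞) (by simp)).differentiableAt_of_isOpen hΩ hz
  have key : ∀ v w : E, dirDeriv v (dirDeriv w F) z = fderiv ℝ (fderiv ℝ F) z v w := by
    intro v w
    have : dirDeriv w F = fun y => fderiv ℝ F y w := rfl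
    rw [dirDeriv, this, fderiv_clm_apply h1 (differentiableAt_const w)]
    simp
  rw [key, key]
  exact (hF.contDiffAt (hΩ.mem_nhds hz)).isSymmSndFDerivAt
    (by simpa using WithTop.coe_le_coe.2 (le_top : (2 : ℕ∞) ≤ ⊤)) v w

lemma dirDeriv_mul {F G : E → ℝ} {z : E} (hF : DifferentiableAt ℝ F z)
    (hG : DifferentiableAt ℝ G z) (v : E) :
    dirDeriv v (fun y => F y * G y) z = F z * dirDeriv v G z + G z * dirDeriv v F z := by
  simp [dirDeriv, fderiv_fun_mul hF hG]

lemma dirDeriv_add {F G : E → ℝ} {z : E} (hF : DifferentiableAt ℝ F z)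
    (hG : DifferentiableAt ℝ G z) (v : E) :
    dirDeriv v (fun y => F y + G y) z = dirDeriv v F z + dirDeriv v G z := by
  simp [dirDeriv, fderiv_fun_add hF hG]

lemma dirDeriv_sum {κ : Type*} (s : Finset κ) {F : κ → E → ℝ} {z : E}
    (hF : ∀ k ∈ s, DifferentiableAt ℝ (F k) z) (v : E) :
    dirDeriv v (fun y => ∑ k ∈ s, F k y) z = ∑ k ∈ s, dirDeriv v (F k) z := by
  simp [dirDeriv, fderiv_fun_sum hF]

lemma dirDeriv_const (c : ℝ) (v : E) : dirDeriv v (fun _ => c) = 0 := by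
  ext; simp [dirDeriv]

lemma dirDeriv_sub_const (F : E → ℝ) (c : ℝ) (v : E) :
    dirDeriv v (fun y => F y - c) = dirDeriv v F := by
  ext z; simp [dirDeriv, fderiv_sub_const]

lemma dirDeriv_comp_pi {κ : Type*} [Fintype κ] {Φ : (κ → ℝ) → ℝ} (hΦ : ContDiff ℝ ∞ Φ)
    {w : κ → E → ℝ} {z : E} (hw : ∀ k, DifferentiableAt ℝ (w k) z) (v : E) :
    dirDeriv v (fun y => Φ (fun k => w k y)) z =
      fderiv ℝ Φ (fun k => w k z) (fun k => dirDeriv v (w k) z) := by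
  have h1 : DifferentiableAt ℝ (fun y => fun k => w k y) z := differentiableAt_pi.2 hw
  have h2 : DifferentiableAt ℝ Φ (fun k => w k z) := hΦ.differentiable (by simp) _
  have := fderiv_comp z h2 h1
  simp only [dirDeriv]
  rw [show (fun y => Φ (fun k => w k y)) = Φ ∘ (fun y => fun k => w k y) from rfl, this]
  rw [ContinuousLinearMap.comp_apply, fderiv_pi hw]
  rfl

lemma ContDiffOn.comp_pi {κ : Type*} [Fintype κ] {Φ : (κ → ℝ) → ℝ} (hΦ : ContDiff ℝ ∞ Φ)
    {w : κ → E → ℝ} (hw : ∀ k, ContDiffOn ℝ ∞ (w k) Ω) :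
    ContDiffOn ℝ ∞ (fun y => Φ (fun k => w k y)) Ω :=
  hΦ.comp_contDiffOn (contDiffOn_pi.2 hw)

lemma dirDeriv_sum_smul {κ : Type*} [Fintype κ] (F : E → ℝ) (c : κ → ℝ) (e : κ → E) (z : E) :
    dirDeriv (∑ k, c k • e k) F z = ∑ k, c k * dirDeriv (e k) F z := by
  simp [dirDeriv]

lemma dirDeriv_smul (F : E → ℝ) (c : ℝ) (e : E) :
    dirDeriv (c • e) F = fun z => c * dirDeriv e F z := by
  ext z; simp [dirDeriv]

/-- A local maximum along a segment has nonpositive second derivative. -/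
lemma deriv_deriv_nonpos_of_isLocalMax {f : ℝ → ℝ} {x : ℝ} (h : IsLocalMax f x)
    (hc : ContinuousAt f x) : deriv (deriv f) x ≤ 0 := by
  by_contra! hpos
  have hd : deriv f x = 0 := h.deriv_eq_zero
  have hmin := isLocalMin_of_deriv_deriv_pos hpos hd hc
  have hconst : f =ᶠ[𝓝 x] fun _ => f x := by
    filter_upwards [h, hmin] with y h1 h2 using le_antisymm h1 h2
  have : deriv (deriv f) x = 0 := by
    rw [hconst.deriv.deriv_eq]; simp
  linarith

lemma dirDeriv_dirDeriv_nonpos {F : E → ℝ} (hF : ContDiffOn ℝ ∞ F Ω) (hΩ : IsOpen Ω) {z : E}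
    (hz : z ∈ Ω) (v : E) (hmax : IsLocalMax (fun s : ℝ => F (z + s • v)) 0) :
    dirDeriv v F z = 0 ∧ dirDeriv v (dirDeriv v F) z ≤ 0 := by
  have hline : ∀ s : ℝ, HasDerivAt (fun s : ℝ => z + s • v) v s := fun s => by
    simpa using ((hasDerivAt_id s).smul_const v).const_add z
  have hcont : Continuous (fun s : ℝ => z + s • v) := by fun_prop
  have hnear : ∀ᶠ s : ℝ in 𝓝 0, z + s • v ∈ Ω :=
    hcont.continuousAt.eventually_mem (hΩ.mem_nhds (by simpa using hz))
  have hder : ∀ G : E → ℝ, ContDiffOn ℝ ∞ G Ω → ∀ s : ℝ, z + s • v ∈ Ω →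
      HasDerivAt (fun s : ℝ => G (z + s • v)) (dirDeriv v G (z + s • v)) s := by
    intro G hG s hs
    exact (hG.differentiableAt_of_isOpen hΩ hs).hasFDerivAt.comp_hasDerivAt s (hline s)
  have h0 : z + (0 : ℝ) • v ∈ Ω := by simpa using hz
  have e1 := hder F hF 0 h0
  have e2 := hder _ (hF.dirDeriv hΩ v) 0 h0
  have e3 : deriv (fun s : ℝ => F (z + s • v)) =ᶠ[𝓝 0] fun s => dirDeriv v F (z + s • v) := by
    filter_upwards [hnear] with s hs using (hder F hF s hs).deriv
  have e4 := deriv_deriv_nonpos_of_isLocalMax hmax e1.continuousAt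
  rw [e3.deriv_eq, e2.deriv] at e4
  have e5 := hmax.deriv_eq_zero
  rw [e1.deriv] at e5
  simp only [zero_smul, add_zero] at e4 e5
  exact ⟨e5, e4⟩

end DirDeriv

/-- Flat spacetime `ℝ × ℝⁿ`. -/
abbrev Spacetime (n : ℕ) : Type := ℝ × Eucl n

section Parabolic

variable {n : ℕ} {Ω : Set (Spacetime n)}

/-- The coordinate direction `∂_a` in spacetime. -/
def spaceDir (a : Fin n) : Spacetime n := (0, EuclideanSpace.single a 1)

/-- The time direction `∂_t` in spacetime. -/
def timeDir (n : ℕ) : Spacetime n := (1, 0)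

/-- The parabolic operator `∂_t - ∑ A_{ab} ∂_a ∂_b`. -/
def heatOp (A : Fin n → Fin n → Spacetime n → ℝ) (F : Spacetime n → ℝ) (z : Spacetime n) : ℝ :=
  dirDeriv (timeDir n) F z -
    ∑ a, ∑ b, A a b z * dirDeriv (spaceDir a) (dirDeriv (spaceDir b) F) z

/-- Smooth symmetric coefficients with eigenvalues at least `1/2` and entries bounded by `2`. -/
structure EllipticOn (Ω : Set (Spacetime n)) (A : Fin n → Fin n → Spacetime n → ℝ) : Prop where
  smooth : ∀ a b, ContDiffOn ℝ ∞ (A a b) Ω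
  symm : ∀ z ∈ Ω, ∀ a b, A a b z = A b a z
  lower : ∀ z ∈ Ω, ∀ ξ : Fin n → ℝ, 1 / 2 * ∑ a, ξ a ^ 2 ≤ ∑ a, ∑ b, A a b z * (ξ a * ξ b)
  upper : ∀ z ∈ Ω, ∀ a b, |A a b z| ≤ 2

lemma EllipticOn.mono {A : Fin n → Fin n → Spacetime n → ℝ} {Ω' : Set (Spacetime n)}
    (h : EllipticOn Ω A) (hs : Ω' ⊆ Ω) : EllipticOn Ω' A :=
  ⟨fun a b => (h.smooth a b).mono hs, fun z hz => h.symm z (hs hz), fun z hz => h.lower z (hs hz),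
    fun z hz => h.upper z (hs hz)⟩

lemma dirDeriv_dirDeriv_mul {F G : Spacetime n → ℝ} (hΩ : IsOpen Ω) (hF : ContDiffOn ℝ ∞ F Ω)
    (hG : ContDiffOn ℝ ∞ G Ω) {z : Spacetime n} (hz : z ∈ Ω) (v w : Spacetime n) :
    dirDeriv v (dirDeriv w (fun y => F y * G y)) z =
      F z * dirDeriv v (dirDeriv w G) z + G z * dirDeriv v (dirDeriv w F) z +
        (dirDeriv v F z * dirDeriv w G z + dirDeriv w F z * dirDeriv v G z) := by
  have h1 : EqOn (dirDeriv w (fun y => F y * G y))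
      (fun y => F y * dirDeriv w G y + G y * dirDeriv w F y) Ω := fun y hy =>
    dirDeriv_mul (hF.differentiableAt_of_isOpen hΩ hy) (hG.differentiableAt_of_isOpen hΩ hy) w
  rw [dirDeriv_congr hΩ h1 v hz]
  have dF := hF.differentiableAt_of_isOpen hΩ hz
  have dG := hG.differentiableAt_of_isOpen hΩ hz
  have dwF := (hF.dirDeriv hΩ w).differentiableAt_of_isOpen hΩ hz
  have dwG := (hG.dirDeriv hΩ w).differentiableAt_of_isOpen hΩ hz
  rw [dirDeriv_add (dF.fun_mul dwG) (dG.fun_mul dwF), dirDeriv_mul dF dwG, dirDeriv_mul dG dwF]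
  ring

lemma heatOp_mul {A : Fin n → Fin n → Spacetime n → ℝ} {F G : Spacetime n → ℝ} (hΩ : IsOpen Ω)
    (hF : ContDiffOn ℝ ∞ F Ω) (hG : ContDiffOn ℝ ∞ G Ω) {z : Spacetime n} (hz : z ∈ Ω)
    (hA : ∀ a b, A a b z = A b a z) :
    heatOp A (fun y => F y * G y) z = F z * heatOp A G z + G z * heatOp A F z -
      2 * ∑ a, ∑ b, A a b z * (dirDeriv (spaceDir a) F z * dirDeriv (spaceDir b) G z) := by
  have dF := hF.differentiableAt_of_isOpen hΩ hz
  have dG := hG.differentiableAt_of_isOpen hΩ hz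
  have hsw : ∑ a, ∑ b, A a b z * (dirDeriv (spaceDir b) F z * dirDeriv (spaceDir a) G z) =
      ∑ a, ∑ b, A a b z * (dirDeriv (spaceDir a) F z * dirDeriv (spaceDir b) G z) := by
    rw [Finset.sum_comm]
    refine Finset.sum_congr rfl fun a _ => Finset.sum_congr rfl fun b _ => ?_
    rw [hA b a]
  simp only [heatOp, dirDeriv_mul dF dG, dirDeriv_dirDeriv_mul hΩ hF hG hz, mul_add,
    Finset.sum_add_distrib, hsw]
  have e1 : ∑ a, ∑ b, A a b z * (F z * dirDeriv (spaceDir a) (dirDeriv (spaceDir b) G) z) =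
      F z * ∑ a, ∑ b, A a b z * dirDeriv (spaceDir a) (dirDeriv (spaceDir b) G) z := by
    simp only [Finset.mul_sum]
    exact Finset.sum_congr rfl fun a _ => Finset.sum_congr rfl fun b _ => by ring
  have e2 : ∑ a, ∑ b, A a b z * (G z * dirDeriv (spaceDir a) (dirDeriv (spaceDir b) F) z) =
      G z * ∑ a, ∑ b, A a b z * dirDeriv (spaceDir a) (dirDeriv (spaceDir b) F) z := by
    simp only [Finset.mul_sum]
    exact Finset.sum_congr rfl fun a _ => Finset.sum_congr rfl fun b _ => by ring
  rw [e1, e2]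
  ring

lemma heatOp_sum {κ : Type*} (s : Finset κ) {A : Fin n → Fin n → Spacetime n → ℝ}
    {F : κ → Spacetime n → ℝ} (hΩ : IsOpen Ω) (hF : ∀ k, ContDiffOn ℝ ∞ (F k) Ω)
    {z : Spacetime n} (hz : z ∈ Ω) :
    heatOp A (fun y => ∑ k ∈ s, F k y) z = ∑ k ∈ s, heatOp A (F k) z := by
  have h1 : ∀ b, EqOn (dirDeriv (spaceDir b) (fun y => ∑ k ∈ s, F k y))
      (fun y => ∑ k ∈ s, dirDeriv (spaceDir b) (F k) y) Ω := fun b y hy =>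
    dirDeriv_sum s (fun k _ => (hF k).differentiableAt_of_isOpen hΩ hy) _
  have h2 : ∀ a b, dirDeriv (spaceDir a) (dirDeriv (spaceDir b) (fun y => ∑ k ∈ s, F k y)) z =
      ∑ k ∈ s, dirDeriv (spaceDir a) (dirDeriv (spaceDir b) (F k)) z := fun a b => by
    rw [dirDeriv_congr hΩ (h1 b) _ hz]
    exact dirDeriv_sum s
      (fun k _ => ((hF k).dirDeriv hΩ _).differentiableAt_of_isOpen hΩ hz) _
  simp only [heatOp, h2, dirDeriv_sum s (fun k _ => (hF k).differentiableAt_of_isOpen hΩ hz),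
    Finset.sum_sub_distrib, Finset.mul_sum]
  congr 1
  rw [Finset.sum_comm]
  rw [Finset.sum_comm]
  conv_rhs => rw [Finset.sum_comm]
  refine Finset.sum_congr rfl fun a _ => ?_
  rw [Finset.sum_comm]

lemma heatOp_const_add {A : Fin n → Fin n → Spacetime n → ℝ} (F : Spacetime n → ℝ) (c : ℝ)
    (z : Spacetime n) : heatOp A (fun y => c + F y) z = heatOp A F z := by
  have : ∀ v : Spacetime n, dirDeriv v (fun y => c + F y) = dirDeriv v F := fun v => by
    ext y; simp [dirDeriv, fderiv_const_add]
  simp only [heatOp, this]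

section Factorization

open scoped MatrixOrder Matrix.Norms.L2Operator

lemma exists_factorization_of_nonneg {a : Fin n → Fin n → ℝ} (hs : ∀ i j, a i j = a j i)
    (hp : ∀ ξ : Fin n → ℝ, 0 ≤ ∑ i, ∑ j, a i j * (ξ i * ξ j)) :
    ∃ s : Fin n → Fin n → ℝ, ∀ i j, a i j = ∑ k, s k i * s k j := by
  have hpsd : (Matrix.of a).PosSemidef := by
    refine .of_dotProduct_mulVec_nonneg ?_ fun x => ?_
    · ext i j; simp [hs j i]
    · refine (hp x).trans_eq ?_
      simp only [dotProduct, Matrix.mulVec, Matrix.of_apply, Finset.mul_sum]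
      exact Finset.sum_congr rfl fun i _ => Finset.sum_congr rfl fun j _ => by simp; ring
  obtain ⟨B, hB⟩ := CStarAlgebra.nonneg_iff_eq_star_mul_self.mp hpsd.nonneg
  refine ⟨B, fun i j => ?_⟩
  have := congrFun (congrFun hB i) j
  simpa [Matrix.mul_apply, Matrix.star_apply] using this

end Factorization

lemma sum_mul_dirDeriv_eq {s : Fin n → ℝ} {F : Spacetime n → ℝ} (hΩ : IsOpen Ω)
    (hF : ContDiffOn ℝ ∞ F Ω) {z : Spacetime n} (hz : z ∈ Ω) :
    dirDeriv (∑ a, s a • spaceDir a) (dirDeriv (∑ b, s b • spaceDir b) F) z =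
      ∑ a, ∑ b, s a * s b * dirDeriv (spaceDir a) (dirDeriv (spaceDir b) F) z := by
  have h1 : dirDeriv (∑ b, s b • spaceDir b) F =
      fun y => ∑ b, s b * dirDeriv (spaceDir b) F y := by
    ext y; rw [dirDeriv_sum_smul]
  have hd : ∀ b, DifferentiableAt ℝ (dirDeriv (spaceDir b) F) z := fun b =>
    (hF.dirDeriv hΩ _).differentiableAt_of_isOpen hΩ hz
  rw [dirDeriv_sum_smul, h1]
  refine Finset.sum_congr rfl fun a _ => ?_
  rw [dirDeriv_sum _ (fun b _ => (hd b).const_mul _), Finset.mul_sum]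
  refine Finset.sum_congr rfl fun b _ => ?_
  rw [dirDeriv_mul (differentiableAt_const _) (hd b), dirDeriv_const]
  simp [mul_assoc]

/-- First and second order conditions at a spatial maximum which is not decreasing in time. -/
lemma heatOp_nonneg_of_isLocalMax {A : Fin n → Fin n → Spacetime n → ℝ} {F : Spacetime n → ℝ}
    (hΩ : IsOpen Ω) (hF : ContDiffOn ℝ ∞ F Ω) {z : Spacetime n} (hz : z ∈ Ω)
    (hs : ∀ a b, A a b z = A b a z)
    (hp : ∀ ξ : Fin n → ℝ, 0 ≤ ∑ a, ∑ b, A a b z * (ξ a * ξ b))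
    (hmax : IsLocalMax (fun x => F (z.1, x)) z.2) (ht : 0 ≤ dirDeriv (timeDir n) F z) :
    (∀ a, dirDeriv (spaceDir a) F z = 0) ∧ 0 ≤ heatOp A F z := by
  have hline : ∀ y : Eucl n, IsLocalMax (fun s : ℝ => F (z + s • ((0, y) : Spacetime n))) 0 := by
    intro y
    have hc : ContinuousAt (fun s : ℝ => z.2 + s • y) 0 := by fun_prop
    have hmax' : IsLocalMax (fun x => F (z.1, x)) (z.2 + (0 : ℝ) • y) := by simpa using hmax
    have := hmax'.comp_continuous (g := fun s : ℝ => z.2 + s • y) hc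
    refine this.congr (Eventually.of_forall fun s => ?_)
    simp only [Function.comp]
    congr 1
    ext <;> simp
  refine ⟨fun a => (dirDeriv_dirDeriv_nonpos hF hΩ hz _ (hline _)).1, ?_⟩
  obtain ⟨S, hS⟩ := exists_factorization_of_nonneg hs hp
  have key : ∑ a, ∑ b, A a b z * dirDeriv (spaceDir a) (dirDeriv (spaceDir b) F) z =
      ∑ k, dirDeriv (∑ a, S k a • spaceDir a) (dirDeriv (∑ b, S k b • spaceDir b) F) z := by
    simp only [sum_mul_dirDeriv_eq hΩ hF hz, hS, Finset.sum_mul]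
    conv_rhs => rw [Finset.sum_comm]
    refine Finset.sum_congr rfl fun a _ => ?_
    rw [Finset.sum_comm]
  have hle : ∑ k, dirDeriv (∑ a, S k a • spaceDir a)
      (dirDeriv (∑ b, S k b • spaceDir b) F) z ≤ 0 := by
    refine Finset.sum_nonpos fun k _ => ?_
    have : (∑ a, S k a • spaceDir a : Spacetime n) =
        ((0, ∑ a, S k a • EuclideanSpace.single a (1 : ℝ)) : Spacetime n) := by
      ext <;> simp [spaceDir, Prod.fst_sum, Prod.snd_sum]
    rw [this]
    exact (dirDeriv_dirDeriv_nonpos hF hΩ hz _ (hline _)).2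
  rw [heatOp, key]
  linarith

end Parabolic

section MaximumPrinciple

variable {n : ℕ}

/-- The backward parabolic cylinder `(-ρ², 0) × B(0, ρ)`. -/
def parabolicCylinder (n : ℕ) (ρ : ℝ) : Set (Spacetime n) := Ioo (-ρ ^ 2) 0 ×ˢ ball 0 ρ

lemma isOpen_parabolicCylinder (ρ : ℝ) : IsOpen (parabolicCylinder n ρ) :=
  isOpen_Ioo.prod isOpen_ball

lemma parabolicCylinder_mono {ρ ρ' : ℝ} (h0 : 0 ≤ ρ) (h : ρ ≤ ρ') :
    parabolicCylinder n ρ ⊆ parabolicCylinder n ρ' :=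
  prod_mono (Ioo_subset_Ioo_left (by nlinarith)) (ball_subset_ball h)

/-- The spatial cutoff `R² - |x|²`. -/
def ballCutoff (R : ℝ) (z : Spacetime n) : ℝ := R ^ 2 - ∑ a, z.2 a ^ 2

/-- The parabolic cutoff `(t + R²) (R² - |x|²)²`. -/
def parabolicCutoff (R : ℝ) (z : Spacetime n) : ℝ :=
  (z.1 + R ^ 2) * (ballCutoff R z * ballCutoff R z)

lemma contDiff_ballCutoff (R : ℝ) : ContDiff ℝ ∞ (ballCutoff (n := n) R) := by
  unfold ballCutoff; fun_prop

lemma contDiff_parabolicCutoff (R : ℝ) : ContDiff ℝ ∞ (parabolicCutoff (n := n) R) := by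
  have := contDiff_ballCutoff (n := n) R
  unfold parabolicCutoff; fun_prop

lemma dirDeriv_ballCutoff (R : ℝ) (v z : Spacetime n) :
    dirDeriv v (ballCutoff R) z = -2 * ∑ a, z.2 a * v.2 a := by
  have hc : ∀ a : Fin n, HasFDerivAt (fun z : Spacetime n => z.2 a ^ 2)
      ((2 * z.2 a) • ((EuclideanSpace.proj a : Eucl n →L[ℝ] ℝ).comp
        (ContinuousLinearMap.snd ℝ ℝ (Eucl n)))) z := fun a => by
    have h := ((EuclideanSpace.proj a : Eucl n →L[ℝ] ℝ).comp
        (ContinuousLinearMap.snd ℝ ℝ (Eucl n))).hasFDerivAt (x := z)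
    simpa using h.pow 2
  have := (HasFDerivAt.fun_sum (u := Finset.univ) fun a _ => hc a).const_sub (R ^ 2)
  rw [dirDeriv, show ballCutoff R = fun z : Spacetime n => R ^ 2 - ∑ a, z.2 a ^ 2 from rfl,
    this.fderiv]
  simp [Finset.mul_sum, mul_assoc]

lemma dirDeriv_timeDir_ballCutoff (R : ℝ) (z : Spacetime n) :
    dirDeriv (timeDir n) (ballCutoff R) z = 0 := by
  simp [dirDeriv_ballCutoff, timeDir]

lemma dirDeriv_spaceDir_ballCutoff (R : ℝ) (a : Fin n) :
    dirDeriv (spaceDir a) (ballCutoff R) = fun z : Spacetime n => -2 * z.2 a := by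
  ext z
  simp [dirDeriv_ballCutoff, spaceDir]

lemma dirDeriv_spaceDir_coord (a b : Fin n) (z : Spacetime n) :
    dirDeriv (spaceDir a) (fun z : Spacetime n => -2 * z.2 b) z = if b = a then -2 else 0 := by
  have h : HasFDerivAt (fun z : Spacetime n => -2 * z.2 b)
      ((-2 : ℝ) • ((EuclideanSpace.proj b : Eucl n →L[ℝ] ℝ).comp
        (ContinuousLinearMap.snd ℝ ℝ (Eucl n)))) z := by
    have h := ((EuclideanSpace.proj b : Eucl n →L[ℝ] ℝ).comp
        (ContinuousLinearMap.snd ℝ ℝ (Eucl n))).hasFDerivAt (x := z)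
    exact h.const_mul (-2)
  rw [dirDeriv, h.fderiv]
  simp [spaceDir]

lemma heatOp_ballCutoff (A : Fin n → Fin n → Spacetime n → ℝ) (R : ℝ) (z : Spacetime n) :
    heatOp A (ballCutoff R) z = 2 * ∑ a, A a a z := by
  simp only [heatOp, dirDeriv_timeDir_ballCutoff, dirDeriv_spaceDir_ballCutoff,
    dirDeriv_spaceDir_coord]
  simp [Finset.mul_sum, mul_comm]

lemma dirDeriv_timeShift (c : ℝ) (v : Spacetime n) :
    dirDeriv v (fun z : Spacetime n => z.1 + c) = fun _ => v.1 := by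
  ext z
  have h := (ContinuousLinearMap.fst ℝ ℝ (Eucl n)).hasFDerivAt (x := z) |>.add_const c
  have : fderiv ℝ (fun z : Spacetime n => z.1 + c) z = ContinuousLinearMap.fst ℝ ℝ (Eucl n) :=
    h.fderiv
  simp [dirDeriv, this]

lemma heatOp_timeShift (A : Fin n → Fin n → Spacetime n → ℝ) (c : ℝ) (z : Spacetime n) :
    heatOp A (fun z : Spacetime n => z.1 + c) z = 1 := by
  simp [heatOp, dirDeriv_timeShift, dirDeriv_const, timeDir]

lemma dirDeriv_spaceDir_parabolicCutoff (R : ℝ) (a : Fin n) (z : Spacetime n) :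
    dirDeriv (spaceDir a) (parabolicCutoff R) z =
      -4 * (z.1 + R ^ 2) * ballCutoff R z * z.2 a := by
  have hd : DifferentiableAt ℝ (ballCutoff (n := n) R) z :=
    (contDiff_ballCutoff R).differentiable (by simp) z
  have ht : DifferentiableAt ℝ (fun z : Spacetime n => z.1 + R ^ 2) z := by fun_prop
  rw [show parabolicCutoff R = fun z : Spacetime n =>
    (z.1 + R ^ 2) * (ballCutoff R z * ballCutoff R z) from rfl,
    dirDeriv_mul ht (hd.fun_mul hd), dirDeriv_mul hd hd, dirDeriv_timeShift,
    dirDeriv_spaceDir_ballCutoff]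
  simp [spaceDir]
  ring

lemma heatOp_parabolicCutoff {A : Fin n → Fin n → Spacetime n → ℝ} (R : ℝ) {z : Spacetime n}
    (hA : ∀ a b, A a b z = A b a z) :
    heatOp A (parabolicCutoff R) z = ballCutoff R z ^ 2 + (z.1 + R ^ 2) *
      (4 * ballCutoff R z * ∑ a, A a a z - 8 * ∑ a, ∑ b, A a b z * (z.2 a * z.2 b)) := by
  have hd : ContDiffOn ℝ ∞ (ballCutoff (n := n) R) univ := (contDiff_ballCutoff R).contDiffOn
  have ht : ContDiffOn ℝ ∞ (fun z : Spacetime n => z.1 + R ^ 2) univ := by fun_prop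
  rw [show parabolicCutoff R = fun z : Spacetime n =>
    (z.1 + R ^ 2) * (ballCutoff R z * ballCutoff R z) from rfl,
    heatOp_mul isOpen_univ ht (hd.mul hd) (mem_univ z) hA,
    heatOp_mul isOpen_univ hd hd (mem_univ z) hA, heatOp_timeShift, heatOp_ballCutoff]
  simp only [dirDeriv_timeShift, dirDeriv_spaceDir_ballCutoff]
  have : ∑ a, ∑ b, A a b z * (-2 * z.2 a * (-2 * z.2 b)) =
      4 * ∑ a, ∑ b, A a b z * (z.2 a * z.2 b) := by
    simp only [Finset.mul_sum]
    exact Finset.sum_congr rfl fun a _ => Finset.sum_congr rfl fun b _ => by ring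
  rw [this]
  simp [spaceDir]
  ring

lemma norm_sq_eq_sum (x : Eucl n) : ‖x‖ ^ 2 = ∑ a, x a ^ 2 := EuclideanSpace.real_norm_sq_eq x

lemma abs_sum_sum_le {A : Fin n → Fin n → ℝ} {X Y : Fin n → ℝ} {α p q : ℝ}
    (hα : 0 ≤ α) (hp : 0 ≤ p) (hA : ∀ a b, |A a b| ≤ α) (hX : ∀ a, |X a| ≤ p)
    (hY : ∀ a, |Y a| ≤ q) :
    |∑ a, ∑ b, A a b * (X a * Y b)| ≤ n ^ 2 * (α * (p * q)) := by
  have h : ∀ a b, |A a b * (X a * Y b)| ≤ α * (p * q) := fun a b => by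
    rw [abs_mul, abs_mul]
    exact mul_le_mul (hA a b) (mul_le_mul (hX a) (hY b) (abs_nonneg _) hp) (by positivity) hα
  calc |∑ a, ∑ b, A a b * (X a * Y b)| ≤ ∑ a : Fin n, ∑ b : Fin n, α * (p * q) :=
        (Finset.abs_sum_le_sum_abs _ _).trans (Finset.sum_le_sum fun a _ =>
          (Finset.abs_sum_le_sum_abs _ _).trans (Finset.sum_le_sum fun b _ => h a b))
    _ = n ^ 2 * (α * (p * q)) := by simp; ring

lemma le_of_riccati {n : ℕ} {R c C χ T f ψ P tr X : ℝ} (hc : 0 < c) (hC : 0 ≤ C) (hpos : 0 < f)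
    (hT0 : 0 < T) (hT1 : T ≤ R ^ 2) (hχ0 : 0 < χ) (hχ1 : χ ≤ R ^ 2) (hX0 : 0 ≤ X)
    (hX1 : X ≤ n ^ 2 * (2 * (R * R))) (htr : tr ≤ 2 * n) (hR : 0 < R) (hψ : ψ = T * (χ * χ))
    (hP : P ≤ C - c * f ^ 2)
    (hheat : 0 ≤ ψ * P + f * (χ ^ 2 + T * (4 * χ * tr - 8 * X)) - 2 * (-16 * T * f * X)) :
    ψ * f ≤ 1 + (R ^ 12 * C + (R ^ 4 + 8 * n * R ^ 4 + 48 * n ^ 2 * R ^ 4)) / c := by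
  have hψpos : 0 < ψ := by rw [hψ]; positivity
  have hψle : ψ ≤ R ^ 6 := by
    rw [hψ]
    calc T * (χ * χ) ≤ R ^ 2 * (R ^ 2 * R ^ 2) := by gcongr
      _ = R ^ 6 := by ring
  have hB : χ ^ 2 + T * (4 * χ * tr - 8 * X) + 32 * T * X ≤
      R ^ 4 + 8 * n * R ^ 4 + 48 * n ^ 2 * R ^ 4 := by
    have e1 : χ ^ 2 ≤ R ^ 4 := by
      calc χ ^ 2 ≤ (R ^ 2) ^ 2 := by gcongr
        _ = R ^ 4 := by ring
    have e2 : T * (χ * tr) ≤ R ^ 2 * (R ^ 2 * (2 * n)) := by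
      calc T * (χ * tr) ≤ T * (χ * (2 * n)) := by gcongr
        _ ≤ _ := by gcongr
    have e3 : T * X ≤ R ^ 2 * (n ^ 2 * (2 * (R * R))) := by gcongr
    linarith
  set B := R ^ 4 + 8 * n * R ^ 4 + 48 * n ^ 2 * R ^ 4 with hBdef
  have hB0 : 0 ≤ B := by positivity
  have h1 : 0 ≤ ψ * (C - c * f ^ 2) + f * B := by
    have e1 : ψ * P ≤ ψ * (C - c * f ^ 2) := by gcongr
    have e2 := mul_le_mul_of_nonneg_left hB hpos.le
    linarith
  have h2 : c * (ψ * f) ^ 2 ≤ R ^ 12 * C + (ψ * f) * B := by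
    have e1 := mul_nonneg hψpos.le h1
    have e2 : ψ ^ 2 * C ≤ R ^ 12 * C := by
      have : ψ ^ 2 ≤ (R ^ 6) ^ 2 := by gcongr
      calc ψ ^ 2 * C ≤ (R ^ 6) ^ 2 * C := by gcongr
        _ = R ^ 12 * C := by ring
    linarith
  have hD : 0 ≤ R ^ 12 * C := by positivity
  by_contra! hcon
  have hg1 : 1 ≤ ψ * f := le_trans (by
    have : 0 ≤ (R ^ 12 * C + B) / c := by positivity
    linarith) hcon.le
  have hg2 : (R ^ 12 * C + B) / c < ψ * f := by linarith
  rw [div_lt_iff₀ hc] at hg2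
  generalize ψ * f = g at *
  have e1 := mul_lt_mul_of_pos_left hg2 (by linarith : 0 < g)
  have e2 := mul_le_mul_of_nonneg_right hg1 hD
  linarith

/-- The differential inequality at a maximum point of the localized function. -/
lemma localized_le_of_isMax {A : Fin n → Fin n → Spacetime n → ℝ} {F : Spacetime n → ℝ}
    {Ω : Set (Spacetime n)} {R c C : ℝ} (hΩ : IsOpen Ω) (hA : EllipticOn Ω A)
    (hF : ContDiffOn ℝ ∞ F Ω) (hc : 0 < c) (hC : 0 ≤ C)
    {z : Spacetime n} (hz : z ∈ Ω) (hFz : heatOp A F z ≤ C - c * F z ^ 2)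
    (ht : -R ^ 2 < z.1) (ht0 : z.1 ≤ 0) (hR : 0 < R) (hx : ‖z.2‖ < R) (hpos : 0 < F z)
    (hmax : IsLocalMax (fun x => parabolicCutoff R (z.1, x) * F (z.1, x)) z.2)
    (htime : 0 ≤ dirDeriv (timeDir n) (fun y => parabolicCutoff R y * F y) z) :
    parabolicCutoff R z * F z ≤
      1 + (R ^ 12 * C + (R ^ 4 + 8 * n * R ^ 4 + 48 * n ^ 2 * R ^ 4)) / c := by
  have hψ : ContDiffOn ℝ ∞ (parabolicCutoff (n := n) R) Ω :=
    (contDiff_parabolicCutoff R).contDiffOn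
  have hdψ := hψ.differentiableAt_of_isOpen hΩ hz
  have hdF := hF.differentiableAt_of_isOpen hΩ hz
  have hlow : ∀ ξ : Fin n → ℝ, 0 ≤ ∑ a, ∑ b, A a b z * (ξ a * ξ b) := fun ξ =>
    le_trans (by positivity) (hA.lower z hz ξ)
  obtain ⟨hgrad, hheat⟩ := heatOp_nonneg_of_isLocalMax hΩ (hψ.mul hF) hz (hA.symm z hz) hlow
    hmax htime
  have hgrad' : ∀ a, parabolicCutoff R z * dirDeriv (spaceDir a) F z +
      F z * dirDeriv (spaceDir a) (parabolicCutoff R) z = 0 := fun a => by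
    rw [← hgrad a]; exact (dirDeriv_mul hdψ hdF _).symm
  have hheat' : 0 ≤ heatOp A (fun y => parabolicCutoff R y * F y) z := hheat
  rw [heatOp_mul hΩ hψ hF hz (hA.symm z hz), heatOp_parabolicCutoff R (hA.symm z hz)] at hheat'
  simp only [dirDeriv_spaceDir_parabolicCutoff] at hheat' hgrad'
  have hψeq : parabolicCutoff R z = (z.1 + R ^ 2) * (ballCutoff R z * ballCutoff R z) := rfl
  have hχeq : ballCutoff R z = R ^ 2 - ‖z.2‖ ^ 2 := by rw [norm_sq_eq_sum]; rfl
  have hχ0 : 0 < ballCutoff R z := by rw [hχeq]; nlinarith [norm_nonneg z.2]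
  have hχ1 : ballCutoff R z ≤ R ^ 2 := by rw [hχeq]; nlinarith [norm_nonneg z.2]
  have hgradF : ∀ a, ballCutoff R z * dirDeriv (spaceDir a) F z = 4 * F z * z.2 a := by
    intro a
    have h := hgrad' a
    have hne : (z.1 + R ^ 2) * ballCutoff R z ≠ 0 := by
      have : 0 < z.1 + R ^ 2 := by linarith
      positivity
    apply mul_left_cancel₀ hne
    rw [hψeq] at h
    linear_combination h
  set X := ∑ a, ∑ b, A a b z * (z.2 a * z.2 b) with hX
  have hcross : ∑ a, ∑ b, A a b z *
      (-4 * (z.1 + R ^ 2) * ballCutoff R z * z.2 a * dirDeriv (spaceDir b) F z) =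
      -16 * (z.1 + R ^ 2) * F z * X := by
    rw [hX]
    simp only [Finset.mul_sum]
    refine Finset.sum_congr rfl fun a _ => Finset.sum_congr rfl fun b _ => ?_
    linear_combination (A a b z * (-4 * (z.1 + R ^ 2) * z.2 a)) * hgradF b
  rw [hcross] at hheat'
  have hX0 : 0 ≤ X := hlow _
  have hX1 : X ≤ n ^ 2 * (2 * (R * R)) := by
    have hxa : ∀ a, |z.2 a| ≤ R := fun a =>
      (by simpa using PiLp.norm_apply_le z.2 a : |z.2 a| ≤ ‖z.2‖).trans hx.le
    exact (le_abs_self _).trans (abs_sum_sum_le (by norm_num) hR.le (hA.upper z hz) hxa hxa)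
  have htr : ∑ a, A a a z ≤ 2 * n := by
    calc ∑ a, A a a z ≤ ∑ _a : Fin n, (2 : ℝ) :=
          Finset.sum_le_sum fun a _ => (le_abs_self _).trans (hA.upper z hz a a)
      _ = 2 * n := by simp [mul_comm]
  exact le_of_riccati hc hC hpos (by linarith) (by linarith) hχ0 hχ1 hX0 hX1 htr hR hψeq hFz
    (by linarith)

/-- Interior bound for subsolutions of a Riccati-type parabolic inequality. -/
lemma exists_bound_of_heatOp_le (n : ℕ) {ρ c C : ℝ} (hρ : 0 < ρ) (hc : 0 < c) (hC : 0 ≤ C) :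
    ∃ K : ℝ, ∀ (A : Fin n → Fin n → Spacetime n → ℝ) (F : Spacetime n → ℝ),
      EllipticOn (parabolicCylinder n ρ) A → ContDiffOn ℝ ∞ F (parabolicCylinder n ρ) →
      (∀ z ∈ parabolicCylinder n ρ, heatOp A F z ≤ C - c * F z ^ 2) →
      ∀ z ∈ parabolicCylinder n (ρ / 2), F z ≤ K := by
  set R := 3 / 4 * ρ with hRdef
  have hR : 0 < R := by positivity
  set B := 1 + (R ^ 12 * C + (R ^ 4 + 8 * n * R ^ 4 + 48 * n ^ 2 * R ^ 4)) / c with hBdef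
  have hB : 0 < B := by positivity
  refine ⟨B / (5 / 16 * ρ ^ 2) ^ 3, fun A F hA hF hheat z₁ hz₁ => ?_⟩
  obtain ⟨⟨hz₁t, hz₁0⟩, hz₁x⟩ := hz₁
  rw [mem_ball_zero_iff] at hz₁x
  set S : Set (Spacetime n) := Icc (-R ^ 2) z₁.1 ×ˢ closedBall 0 R with hSdef
  have hScomp : IsCompact S := isCompact_Icc.prod (isCompact_closedBall _ _)
  have hSsub : S ⊆ parabolicCylinder n ρ := by
    rintro ⟨t, x⟩ ⟨⟨h1, h2⟩, h3⟩
    simp only [mem_closedBall_zero_iff] at h3 h1 h2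
    refine ⟨⟨?_, ?_⟩, ?_⟩
    · change -ρ ^ 2 < t
      nlinarith
    · change t < 0
      linarith
    · simp only [mem_ball_zero_iff]
      linarith
  have hz₁S : z₁ ∈ S := by
    refine ⟨⟨?_, le_rfl⟩, ?_⟩
    · nlinarith
    · rw [mem_closedBall_zero_iff]; linarith
  have hψ : ContDiffOn ℝ ∞ (parabolicCutoff (n := n) R) (parabolicCylinder n ρ) :=
    (contDiff_parabolicCutoff R).contDiffOn
  have hG : ContDiffOn ℝ ∞ (fun y => parabolicCutoff R y * F y) (parabolicCylinder n ρ) :=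
    hψ.mul hF
  obtain ⟨z₀, hz₀S, hmax⟩ := hScomp.exists_isMaxOn ⟨z₁, hz₁S⟩ (hG.continuousOn.mono hSsub)
  have hz₀Ω := hSsub hz₀S
  obtain ⟨⟨hz₀t, hz₀t'⟩, hz₀x⟩ := hz₀S
  rw [mem_closedBall_zero_iff] at hz₀x
  have hψform : ∀ z : Spacetime n, parabolicCutoff R z =
      (z.1 + R ^ 2) * (R ^ 2 - ‖z.2‖ ^ 2) ^ 2 := fun z => by
    rw [norm_sq_eq_sum, parabolicCutoff, ballCutoff]; ring
  have hGle : parabolicCutoff R z₀ * F z₀ ≤ B := by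
    by_cases hψ0 : parabolicCutoff R z₀ = 0
    · rw [hψ0, zero_mul]; exact hB.le
    have ht0 : -R ^ 2 < z₀.1 := by
      refine lt_of_le_of_ne hz₀t fun h => hψ0 ?_
      rw [hψform, ← h]; ring
    have hx0 : ‖z₀.2‖ < R := by
      refine lt_of_le_of_ne hz₀x fun h => hψ0 ?_
      rw [hψform, h]; ring
    by_cases hpos : 0 < F z₀
    · refine localized_le_of_isMax (isOpen_parabolicCylinder ρ) hA hF hc hC hz₀Ω
        (hheat z₀ hz₀Ω) ht0 (by linarith) hR hx0 hpos ?_ ?_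
      · filter_upwards [isOpen_ball.mem_nhds (mem_ball_zero_iff.2 hx0)] with x hx
        exact hmax (show (z₀.1, x) ∈ S from
          ⟨⟨hz₀t, hz₀t'⟩, mem_closedBall_zero_iff.2 (mem_ball_zero_iff.1 hx).le⟩)
      · have hconv : Convex ℝ S := (convex_Icc _ _).prod (convex_closedBall _ _)
        have hseg : segment ℝ z₀ ((-R ^ 2, z₀.2) : Spacetime n) ⊆ S :=
          hconv.segment_subset ⟨⟨hz₀t, hz₀t'⟩, mem_closedBall_zero_iff.2 hz₀x⟩
            ⟨⟨le_rfl, by simpa using hz₀t.trans hz₀t'⟩, mem_closedBall_zero_iff.2 hz₀x⟩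
        have hfd := (hG.differentiableAt_of_isOpen (isOpen_parabolicCylinder ρ) hz₀Ω).hasFDerivAt
        have h := hmax.localize.hasFDerivWithinAt_nonpos hfd.hasFDerivWithinAt
          (sub_mem_posTangentConeAt_of_segment_subset hseg)
        have hdir : ((-R ^ 2, z₀.2) : Spacetime n) - z₀ = (-(z₀.1 + R ^ 2)) • timeDir n := by
          ext <;> simp [timeDir]; ring
        rw [hdir, map_smul, smul_eq_mul] at h
        have hpos' : 0 < z₀.1 + R ^ 2 := by linarith
        change 0 ≤ fderiv ℝ (fun y => parabolicCutoff R y * F y) z₀ (timeDir n)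
        nlinarith
    · have : 0 ≤ parabolicCutoff R z₀ := by
        rw [hψform]
        have : 0 ≤ z₀.1 + R ^ 2 := by linarith
        positivity
      nlinarith
  have hG1 : parabolicCutoff R z₁ * F z₁ ≤ B := (hmax hz₁S).trans hGle
  have hlow : (5 / 16 * ρ ^ 2) ^ 3 ≤ parabolicCutoff R z₁ := by
    rw [hψform]
    have e1 : 5 / 16 * ρ ^ 2 ≤ z₁.1 + R ^ 2 := by nlinarith
    have e2 : 5 / 16 * ρ ^ 2 ≤ R ^ 2 - ‖z₁.2‖ ^ 2 := by nlinarith [norm_nonneg z₁.2]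
    calc (5 / 16 * ρ ^ 2) ^ 3 = 5 / 16 * ρ ^ 2 * (5 / 16 * ρ ^ 2) ^ 2 := by ring
      _ ≤ _ := by gcongr; exact le_trans (by positivity) e1
  have hm : 0 < (5 / 16 * ρ ^ 2) ^ 3 := by positivity
  rw [le_div_iff₀ hm]
  by_cases hF1 : 0 ≤ F z₁
  · nlinarith
  · nlinarith

end MaximumPrinciple

section Jets

variable {n : ℕ} {ι : Type} {Ω : Set (Spacetime n)}

/-- The spatial 1-jet of a vector-valued function on spacetime. -/
def jet (w : ι → Spacetime n → ℝ) : Option (Fin n) × ι → Spacetime n → ℝ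
  | (none, i) => w i
  | (some a, i) => dirDeriv (spaceDir a) (w i)

lemma ContDiffOn.jet {w : ι → Spacetime n → ℝ} (hw : ∀ i, ContDiffOn ℝ ∞ (w i) Ω)
    (hΩ : IsOpen Ω) : ∀ k, ContDiffOn ℝ ∞ (jet w k) Ω
  | (none, i) => hw i
  | (some a, i) => (hw i).dirDeriv hΩ (spaceDir a)

/-- The components of a jet in one slot: the values for `none`, the derivatives in the direction
`a` for `some a`. -/
def jetSlice (n : ℕ) (ι : Type) [Fintype ι] (o : Option (Fin n)) :
    (Option (Fin n) × ι → ℝ) →L[ℝ] (ι → ℝ) :=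
  ContinuousLinearMap.pi fun i => ContinuousLinearMap.proj (o, i)

/-- `w` solves `∂_t w = ∑ A_{ab} ∂_a ∂_b w + H(w, ∂w)` on `Ω`, and `∂_c A_{ab} = D_{cab}(w, ∂w)`. -/
structure SolvesOn (Ω : Set (Spacetime n)) (A : Fin n → Fin n → Spacetime n → ℝ)
    (w : ι → Spacetime n → ℝ) (H : ι → (Option (Fin n) × ι → ℝ) → ℝ)
    (D : Fin n → Fin n → Fin n → (Option (Fin n) × ι → ℝ) → ℝ) : Prop where
  elliptic : EllipticOn Ω A
  smooth : ∀ i, ContDiffOn ℝ ∞ (w i) Ω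
  heat : ∀ z ∈ Ω, ∀ i, heatOp A (w i) z = H i fun k => jet w k z
  coeff : ∀ z ∈ Ω, ∀ c a b, dirDeriv (spaceDir c) (A a b) z = D c a b fun k => jet w k z

lemma SolvesOn.mono {Ω' : Set (Spacetime n)} {A : Fin n → Fin n → Spacetime n → ℝ}
    {w : ι → Spacetime n → ℝ} {H : ι → (Option (Fin n) × ι → ℝ) → ℝ}
    {D : Fin n → Fin n → Fin n → (Option (Fin n) × ι → ℝ) → ℝ}
    (h : SolvesOn Ω A w H D) (hs : Ω' ⊆ Ω) : SolvesOn Ω' A w H D :=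
  ⟨h.elliptic.mono hs, fun i => (h.smooth i).mono hs, fun z hz => h.heat z (hs hz),
    fun z hz => h.coeff z (hs hz)⟩

variable [Fintype ι]

/-- The reaction term of the system solved by the 1-jet. -/
def liftReaction (H : ι → (Option (Fin n) × ι → ℝ) → ℝ)
    (D : Fin n → Fin n → Fin n → (Option (Fin n) × ι → ℝ) → ℝ) :
    Option (Fin n) × ι → (Option (Fin n) × (Option (Fin n) × ι) → ℝ) → ℝ
  | (none, i), J => H i (jetSlice n _ none J)
  | (some c, i), J =>
      ∑ a, ∑ b, D c a b (jetSlice n _ none J) * J (some a, (some b, i)) +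
        fderiv ℝ (H i) (jetSlice n _ none J) (jetSlice n _ (some c) J)

lemma dirDeriv_sum_mul {v : Spacetime n} (hΩ : IsOpen Ω)
    {A B : Fin n → Fin n → Spacetime n → ℝ} (hA : ∀ a b, ContDiffOn ℝ ∞ (A a b) Ω)
    (hB : ∀ a b, ContDiffOn ℝ ∞ (B a b) Ω) {z : Spacetime n} (hz : z ∈ Ω) :
    dirDeriv v (fun y => ∑ a, ∑ b, A a b y * B a b y) z =
      ∑ a, ∑ b, A a b z * dirDeriv v (B a b) z + ∑ a, ∑ b, dirDeriv v (A a b) z * B a b z := by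
  have dA := fun a b => (hA a b).differentiableAt_of_isOpen hΩ hz
  have dB := fun a b => (hB a b).differentiableAt_of_isOpen hΩ hz
  rw [dirDeriv_sum _ (fun a _ => DifferentiableAt.fun_sum fun b _ => (dA a b).fun_mul (dB a b))]
  simp only [← Finset.sum_add_distrib]
  refine Finset.sum_congr rfl fun a _ => ?_
  rw [dirDeriv_sum _ (fun b _ => (dA a b).fun_mul (dB a b))]
  refine Finset.sum_congr rfl fun b _ => ?_
  rw [dirDeriv_mul (dA a b) (dB a b)]
  ring

/-- The 1-jet of a solution solves the lifted system. -/
lemma SolvesOn.jet {A : Fin n → Fin n → Spacetime n → ℝ} {w : ι → Spacetime n → ℝ}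
    {H : ι → (Option (Fin n) × ι → ℝ) → ℝ}
    {D : Fin n → Fin n → Fin n → (Option (Fin n) × ι → ℝ) → ℝ} (hΩ : IsOpen Ω)
    (hH : ∀ i, ContDiff ℝ ∞ (H i)) (h : SolvesOn Ω A w H D) :
    SolvesOn Ω A (jet w) (liftReaction H D) (fun c a b J => D c a b (jetSlice n _ none J)) := by
  refine ⟨h.elliptic, ContDiffOn.jet h.smooth hΩ, ?_, fun z hz c a b => h.coeff z hz c a b⟩
  rintro z hz ⟨_ | c, i⟩
  · exact h.heat z hz i
  have hw := h.smooth i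
  have hbw := fun b => hw.dirDeriv hΩ (spaceDir b)
  have habw := fun a b => (hbw b).dirDeriv hΩ (spaceDir a)
  have hjet := ContDiffOn.jet h.smooth hΩ
  have htime : EqOn (dirDeriv (timeDir n) (w i)) (fun y => ∑ a, ∑ b, A a b y *
      dirDeriv (spaceDir a) (dirDeriv (spaceDir b) (w i)) y + H i fun k => _root_.jet w k y) Ω :=
    fun y hy => by
      have := h.heat y hy i
      simp only [heatOp] at this
      linarith
  have hswap : ∀ a b, dirDeriv (spaceDir c) (dirDeriv (spaceDir a) (dirDeriv (spaceDir b) (w i))) z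
      = dirDeriv (spaceDir a) (dirDeriv (spaceDir b) (dirDeriv (spaceDir c) (w i))) z := by
    intro a b
    rw [dirDeriv_comm (hbw b) hΩ _ _ hz, dirDeriv_congr hΩ (dirDeriv_comm hw hΩ _ _) _ hz]
  have hsum : ContDiffOn ℝ ∞ (fun y => ∑ a, ∑ b, A a b y *
      dirDeriv (spaceDir a) (dirDeriv (spaceDir b) (w i)) y) Ω :=
    ContDiffOn.sum fun a _ => ContDiffOn.sum fun b _ => (h.elliptic.smooth a b).mul (habw a b)
  have hHc : ContDiffOn ℝ ∞ (fun y => H i fun k => _root_.jet w k y) Ω :=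
    ContDiffOn.comp_pi (hH i) hjet
  change heatOp A (dirDeriv (spaceDir c) (w i)) z = _
  rw [heatOp, dirDeriv_comm hw hΩ _ _ hz, dirDeriv_congr hΩ htime _ hz,
    dirDeriv_add (hsum.differentiableAt_of_isOpen hΩ hz) (hHc.differentiableAt_of_isOpen hΩ hz),
    dirDeriv_sum_mul hΩ h.elliptic.smooth habw hz,
    dirDeriv_comp_pi (hH i) (fun k => (hjet k).differentiableAt_of_isOpen hΩ hz)]
  simp only [hswap, h.coeff z hz]
  change _ = ∑ a, ∑ b, D c a b (fun k => _root_.jet w k z) *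
      dirDeriv (spaceDir a) (dirDeriv (spaceDir b) (w i)) z +
    fderiv ℝ (H i) (fun k => _root_.jet w k z) (fun k => dirDeriv (spaceDir c) (_root_.jet w k) z)
  ring

end Jets

section Bernstein

variable {n : ℕ} {κ : Type} [Fintype κ] {Ω : Set (Spacetime n)}
  {A : Fin n → Fin n → Spacetime n → ℝ}

/-- Sum of squares of the components. -/
def sumSq (u : κ → Spacetime n → ℝ) (z : Spacetime n) : ℝ := ∑ k, u k z * u k z

lemma sumSq_nonneg (u : κ → Spacetime n → ℝ) (z : Spacetime n) : 0 ≤ sumSq u z :=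
  Finset.sum_nonneg fun _ _ => mul_self_nonneg _

lemma ContDiffOn.sumSq {u : κ → Spacetime n → ℝ} (hu : ∀ k, ContDiffOn ℝ ∞ (u k) Ω) :
    ContDiffOn ℝ ∞ (sumSq u) Ω :=
  ContDiffOn.sum fun k _ => (hu k).mul (hu k)

lemma sumSq_le {u : κ → Spacetime n → ℝ} {z : Spacetime n} {U : ℝ} (hU : ∀ k, |u k z| ≤ U) :
    sumSq u z ≤ Fintype.card κ * U ^ 2 := by
  calc sumSq u z ≤ ∑ _k : κ, U ^ 2 := Finset.sum_le_sum fun k _ => by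
        rw [← sq, ← sq_abs]
        exact pow_le_pow_left₀ (abs_nonneg _) (hU k) 2
    _ = _ := by simp

lemma abs_le_of_sumSq {u : κ → Spacetime n → ℝ} {z : Spacetime n} {p : ℝ} (hp : 0 ≤ p)
    (h : p ^ 2 = sumSq u z) (k : κ) : |u k z| ≤ p := by
  refine abs_le_of_sq_le_sq ?_ hp
  rw [h, sq]
  exact Finset.single_le_sum (f := fun k => u k z * u k z) (fun _ _ => mul_self_nonneg _)
    (Finset.mem_univ k)

lemma abs_dirDeriv_sumSq_le {u : κ → Spacetime n → ℝ} (hΩ : IsOpen Ω)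
    (hu : ∀ k, ContDiffOn ℝ ∞ (u k) Ω) {z : Spacetime n} (hz : z ∈ Ω) {U V : ℝ}
    (hU : ∀ k, |u k z| ≤ U) (v : Spacetime n) (hV : ∀ k, |dirDeriv v (u k) z| ≤ V) :
    |dirDeriv v (sumSq u) z| ≤ Fintype.card κ * (2 * (U * V)) := by
  have hd := fun k => (hu k).differentiableAt_of_isOpen hΩ hz
  have h1 : dirDeriv v (sumSq u) z = ∑ k, 2 * (u k z * dirDeriv v (u k) z) := by
    rw [show sumSq u = fun z => ∑ k, u k z * u k z from rfl,
      dirDeriv_sum _ fun k _ => (hd k).fun_mul (hd k)]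
    refine Finset.sum_congr rfl fun k _ => ?_
    rw [dirDeriv_mul (hd k) (hd k)]; ring
  rw [h1]
  calc _ ≤ ∑ k, |2 * (u k z * dirDeriv v (u k) z)| := Finset.abs_sum_le_sum_abs _ _
    _ ≤ ∑ _k : κ, 2 * (U * V) := Finset.sum_le_sum fun k _ => by
        rw [abs_mul, abs_mul, abs_two]
        have := mul_le_mul (hU k) (hV k) (abs_nonneg _) ((abs_nonneg _).trans (hU k))
        linarith
    _ = _ := by simp

lemma heatOp_sumSq_le {u : κ → Spacetime n → ℝ} (hΩ : IsOpen Ω) (hA : EllipticOn Ω A)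
    (hu : ∀ k, ContDiffOn ℝ ∞ (u k) Ω) {z : Spacetime n} (hz : z ∈ Ω) {U B : ℝ}
    (hU : ∀ k, |u k z| ≤ U) (hB : ∀ k, |heatOp A (u k) z| ≤ B) :
    heatOp A (sumSq u) z ≤ Fintype.card κ * (2 * (U * B)) -
      ∑ k, ∑ a, dirDeriv (spaceDir a) (u k) z ^ 2 := by
  rw [show sumSq u = fun z => ∑ k, u k z * u k z from rfl,
    heatOp_sum _ hΩ (fun k => (hu k).mul (hu k)) hz]
  have h1 : (Fintype.card κ : ℝ) * (2 * (U * B)) = ∑ _k : κ, 2 * (U * B) := by simp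
  rw [h1, ← Finset.sum_sub_distrib]
  refine Finset.sum_le_sum fun k _ => ?_
  rw [heatOp_mul hΩ (hu k) (hu k) hz (hA.symm z hz)]
  have h2 := hA.lower z hz fun a => dirDeriv (spaceDir a) (u k) z
  have h3 : u k z * heatOp A (u k) z ≤ U * B := (le_abs_self _).trans (by
    rw [abs_mul]
    exact mul_le_mul (hU k) (hB k) (abs_nonneg _) ((abs_nonneg _).trans (hU k)))
  linarith

/-- The spatial gradient as a family of functions. -/
def grad (w : κ → Spacetime n → ℝ) : Fin n × κ → Spacetime n → ℝ :=
  fun k => dirDeriv (spaceDir k.1) (w k.2)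

/-- Bernstein's differential inequality for `(l + |w|²) |∂w|²`. -/
lemma heatOp_bernstein_le {w : κ → Spacetime n → ℝ} (hΩ : IsOpen Ω) (hA : EllipticOn Ω A)
    (hw : ∀ k, ContDiffOn ℝ ∞ (w k) Ω) {z : Spacetime n} (hz : z ∈ Ω) {l m B G p q : ℝ}
    (hl : 0 ≤ l) (hm : 0 ≤ m) (hp : 0 ≤ p) (hq : 0 ≤ q) (hpz : p ^ 2 = sumSq (grad w) z)
    (hqz : q ^ 2 = sumSq (grad (grad w)) z) (hwm : ∀ k, |w k z| ≤ m)
    (hB : ∀ k, |heatOp A (w k) z| ≤ B) (hG : ∀ k, |heatOp A (grad w k) z| ≤ G) :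
    heatOp A (fun y => (l + sumSq w y) * sumSq (grad w) y) z ≤
      (l + sumSq w z) * (2 * n * Fintype.card κ * (p * G) - q ^ 2) +
        p ^ 2 * (2 * Fintype.card κ * (m * B) - p ^ 2) +
        16 * n ^ 3 * Fintype.card κ ^ 2 * (m * p ^ 2 * q) := by
  have hg : ∀ k, ContDiffOn ℝ ∞ (grad w k) Ω := fun k => (hw k.2).dirDeriv hΩ _
  have hgp : ∀ k, |grad w k z| ≤ p := abs_le_of_sumSq hp hpz
  have hgq : ∀ k, |grad (grad w) k z| ≤ q := abs_le_of_sumSq hq hqz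
  have e0 := heatOp_sumSq_le hΩ hA hw hz hwm hB
  have e1 := heatOp_sumSq_le hΩ hA hg hz hgp hG
  have r0 : ∑ k, ∑ a, dirDeriv (spaceDir a) (w k) z ^ 2 = p ^ 2 := by
    rw [hpz, sumSq, Fintype.sum_prod_type_right]
    simp [grad, sq]
  have r1 : ∑ k, ∑ a, dirDeriv (spaceDir a) (grad w k) z ^ 2 = q ^ 2 := by
    rw [hqz, sumSq]
    refine ((Fintype.sum_prod_type_right _).trans ?_).symm
    simp only [sq]
    rfl
  rw [r0] at e0
  rw [r1] at e1
  have d0 : ∀ a, |dirDeriv (spaceDir a) (fun y => l + sumSq w y) z| ≤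
      Fintype.card κ * (2 * (m * p)) := fun a => by
    have : dirDeriv (spaceDir a) (fun y => l + sumSq w y) z =
        dirDeriv (spaceDir a) (sumSq w) z := by
      simp [dirDeriv, fderiv_const_add]
    rw [this]
    exact abs_dirDeriv_sumSq_le hΩ hw hz hwm _ fun k => hgp (a, k)
  have d1 : ∀ a, |dirDeriv (spaceDir a) (sumSq (grad w)) z| ≤
      Fintype.card (Fin n × κ) * (2 * (p * q)) := fun a =>
    abs_dirDeriv_sumSq_le hΩ hg hz hgp _ fun k => hgq (a, k)
  have hcross := abs_sum_sum_le (by norm_num) (by positivity) (hA.upper z hz) d0 d1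
  have hcross' := (abs_le.1 hcross).1
  have hs : ContDiffOn ℝ ∞ (fun y => l + sumSq w y) Ω := contDiffOn_const.add (ContDiffOn.sumSq hw)
  rw [heatOp_mul hΩ hs (ContDiffOn.sumSq hg) hz (hA.symm z hz), heatOp_const_add, ← hpz]
  simp only [Fintype.card_prod, Fintype.card_fin, Nat.cast_mul] at e1 hcross'
  have hS := sumSq_nonneg w z
  have m1 := mul_le_mul_of_nonneg_left e1 (add_nonneg hl hS)
  have m0 := mul_le_mul_of_nonneg_left e0 (sq_nonneg p)
  linarith

end Bernstein

section GradientEstimates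

variable {n : ℕ} {ι : Type} [Fintype ι] {Ω : Set (Spacetime n)}

lemma exists_gradient_bound_of_heatOp_le (n : ℕ) (ι : Type) [Fintype ι] {ρ l c C : ℝ} (hρ : 0 < ρ)
    (hl : 0 < l) (hc : 0 < c) (hC : 0 ≤ C) :
    ∃ K : ℝ, ∀ (A : Fin n → Fin n → Spacetime n → ℝ) (w : ι → Spacetime n → ℝ),
      EllipticOn (parabolicCylinder n ρ) A →
      (∀ i, ContDiffOn ℝ ∞ (w i) (parabolicCylinder n ρ)) →
      (∀ z ∈ parabolicCylinder n ρ,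
        heatOp A (fun y => (l + sumSq w y) * sumSq (grad w) y) z ≤
          C - c * ((l + sumSq w z) * sumSq (grad w) z) ^ 2) →
      ∀ z ∈ parabolicCylinder n (ρ / 2), ∀ k, |grad w k z| ≤ K := by
  obtain ⟨K, hK⟩ := exists_bound_of_heatOp_le n hρ hc hC
  refine ⟨|K| / l + 1, fun A w hA hw hF z hz k => ?_⟩
  have hg : ∀ k, ContDiffOn ℝ ∞ (grad w k) (parabolicCylinder n ρ) := fun k =>
    (hw k.2).dirDeriv (isOpen_parabolicCylinder _) _
  have h1 := hK A _ hA ((contDiffOn_const.add (ContDiffOn.sumSq hw)).mul (ContDiffOn.sumSq hg))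
    hF z hz
  have h2 : grad w k z ^ 2 ≤ sumSq (grad w) z := by
    rw [sq]
    exact Finset.single_le_sum (f := fun k => grad w k z * grad w k z)
      (fun _ _ => mul_self_nonneg _) (Finset.mem_univ k)
  have h3 := sumSq_nonneg w z
  have h4 := sumSq_nonneg (grad w) z
  have h5 : l * sumSq (grad w) z ≤ |K| := by
    have := mul_nonneg h3 h4
    have := le_abs_self K
    nlinarith
  have h6 : sumSq (grad w) z ≤ |K| / l := by
    rw [le_div_iff₀ hl]; linarith
  have h7 : 0 ≤ |K| / l := by positivity
  refine abs_le_of_sq_le_sq ?_ (by positivity)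
  nlinarith

lemma exists_forall_norm_le {σ E : Type} [Finite σ] [NormedAddCommGroup E]
    {Φ : σ → (ι → ℝ) → E} (hΦ : ∀ s, Continuous (Φ s)) (M : ℝ) :
    ∃ μ, 0 ≤ μ ∧ ∀ u, ‖u‖ ≤ M → ∀ s, ‖Φ s u‖ ≤ μ := by
  have := Fintype.ofFinite σ
  obtain ⟨C, hC⟩ := (isCompact_closedBall (0 : ι → ℝ) M).exists_bound_of_continuousOn
    (f := fun u s => Φ s u) (continuous_pi hΦ).continuousOn
  refine ⟨|C|, abs_nonneg _, fun u hu s => ?_⟩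
  exact (norm_le_pi_norm (fun s => Φ s u) s).trans
    ((hC u (by simpa using hu)).trans (le_abs_self C))

/-- The derivative components of a jet. -/
def jetGrad (n : ℕ) (ι : Type) [Fintype ι] : (Option (Fin n) × ι → ℝ) →L[ℝ] (Fin n × ι → ℝ) :=
  ContinuousLinearMap.pi fun k => ContinuousLinearMap.proj (some k.1, k.2)

lemma abs_liftReaction_some_le {H : ι → (Option (Fin n) × ι → ℝ) → ℝ}
    {D : Fin n → Fin n → Fin n → (Option (Fin n) × ι → ℝ) → ℝ} {c : Fin n} {i : ι}
    {J : Option (Fin n) × (Option (Fin n) × ι) → ℝ} {d q : ℝ} (hd : 0 ≤ d)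
    (hD : ∀ a b, |D c a b (jetSlice n _ none J)| ≤ d)
    (hJ : ∀ a b, |J (some a, (some b, i))| ≤ q) :
    |liftReaction H D (some c, i) J| ≤ n ^ 2 * (d * q) +
      |fderiv ℝ (H i) (jetSlice n _ none J) (jetSlice n _ (some c) J)| := by
  refine (abs_add_le _ _).trans (add_le_add_left ?_ _)
  calc _ ≤ ∑ a : Fin n, ∑ b : Fin n, |D c a b (jetSlice n _ none J) * J (some a, (some b, i))| :=
        (Finset.abs_sum_le_sum_abs _ _).trans
          (Finset.sum_le_sum fun a _ => Finset.abs_sum_le_sum_abs _ _)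
    _ ≤ ∑ _a : Fin n, ∑ _b : Fin n, d * q :=
        Finset.sum_le_sum fun a _ => Finset.sum_le_sum fun b _ => by
          rw [abs_mul]
          exact mul_le_mul (hD a b) (hJ a b) (abs_nonneg _) hd
    _ = _ := by simp; ring

section JetBounds

variable {w : ι → Spacetime n → ℝ} {z : Spacetime n} {p q : ℝ}

lemma norm_jetGrad_jet_le (hp : 0 ≤ p) (hpz : ∀ k, |grad w k z| ≤ p) :
    ‖jetGrad n ι fun k => jet w k z‖ ≤ p :=
  (pi_norm_le_iff_of_nonneg hp).2 fun k => hpz k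

lemma norm_jet_le {m : ℝ} (hm : 0 ≤ m) (hp : 0 ≤ p) (hpz : ∀ k, |grad w k z| ≤ p)
    (hw : ∀ i, |w i z| ≤ m) : ‖fun k => jet w k z‖ ≤ m + p := by
  refine (pi_norm_le_iff_of_nonneg (by positivity)).2 ?_
  rintro ⟨_ | a, i⟩
  · exact (hw i).trans (by linarith)
  · exact (hpz (a, i)).trans (by linarith)

variable (c : Fin n)

lemma norm_dirDeriv_le (hp : 0 ≤ p) (hpz : ∀ k, |grad w k z| ≤ p) :
    ‖jetSlice n ι none (jetSlice n _ (some c) fun k => jet (jet w) k z)‖ ≤ p :=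
  (pi_norm_le_iff_of_nonneg hp).2 fun i => hpz (c, i)

lemma norm_jetGrad_dirDeriv_le (hq : 0 ≤ q) (hqz : ∀ k, |grad (grad w) k z| ≤ q) :
    ‖jetGrad n ι (jetSlice n _ (some c) fun k => jet (jet w) k z)‖ ≤ q :=
  (pi_norm_le_iff_of_nonneg hq).2 fun k => hqz (c, k)

lemma norm_jet_dirDeriv_le (hp : 0 ≤ p) (hq : 0 ≤ q) (hpz : ∀ k, |grad w k z| ≤ p)
    (hqz : ∀ k, |grad (grad w) k z| ≤ q) :
    ‖jetSlice n _ (some c) fun k => jet (jet w) k z‖ ≤ p + q := by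
  refine (pi_norm_le_iff_of_nonneg (by positivity)).2 ?_
  rintro ⟨_ | a, i⟩
  · exact (hpz (c, i)).trans (by linarith)
  · exact (hqz (c, (a, i))).trans (by linarith)

end JetBounds

/-- The reaction term `Q(w)(∂w, ∂w)`. -/
def quadraticReaction (Q : ι → (ι → ℝ) → (Fin n × ι → ℝ) →L[ℝ] (Fin n × ι → ℝ) →L[ℝ] ℝ) :
    ι → (Option (Fin n) × ι → ℝ) → ℝ :=
  fun i J => Q i (jetSlice n ι none J) (jetGrad n ι J) (jetGrad n ι J)

/-- The spatial derivatives of coefficients `𝒜(w)`. -/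
def coeffDeriv (𝒜 : Fin n → Fin n → (ι → ℝ) → ℝ) :
    Fin n → Fin n → Fin n → (Option (Fin n) × ι → ℝ) → ℝ :=
  fun c a b J => fderiv ℝ (𝒜 a b) (jetSlice n ι none J) (jetSlice n ι (some c) J)

lemma contDiff_quadraticReaction
    {Q : ι → (ι → ℝ) → (Fin n × ι → ℝ) →L[ℝ] (Fin n × ι → ℝ) →L[ℝ] ℝ}
    (hQ : ∀ i, ContDiff ℝ ∞ (Q i)) (i : ι) : ContDiff ℝ ∞ (quadraticReaction Q i) :=
  (((hQ i).comp (jetSlice n ι none).contDiff).clm_apply (jetGrad n ι).contDiff).clm_apply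
    (jetGrad n ι).contDiff

lemma contDiff_coeffDeriv {𝒜 : Fin n → Fin n → (ι → ℝ) → ℝ}
    (h𝒜 : ∀ a b, ContDiff ℝ ∞ (𝒜 a b)) (c a b : Fin n) : ContDiff ℝ ∞ (coeffDeriv 𝒜 c a b) :=
  ((((h𝒜 a b).fderiv_right (m := ∞) le_rfl).comp (jetSlice n ι none).contDiff)).clm_apply
    (jetSlice n ι (some c)).contDiff

set_option maxSynthPendingDepth 3 in
lemma abs_fderiv_quadraticReaction_le
    {Q : ι → (ι → ℝ) → (Fin n × ι → ℝ) →L[ℝ] (Fin n × ι → ℝ) →L[ℝ] ℝ}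
    (hQ : ∀ i, ContDiff ℝ ∞ (Q i)) {i : ι} {J V : Option (Fin n) × ι → ℝ} {μ p q : ℝ}
    (hμ : 0 ≤ μ) (hp : 0 ≤ p)
    (h0 : ‖Q i (jetSlice n ι none J)‖ ≤ μ) (h1 : ‖fderiv ℝ (Q i) (jetSlice n ι none J)‖ ≤ μ)
    (hJ : ‖jetGrad n ι J‖ ≤ p) (hV : ‖jetGrad n ι V‖ ≤ q) (hV' : ‖jetSlice n ι none V‖ ≤ p) :
    |fderiv ℝ (quadraticReaction Q i) J V| ≤ 2 * μ * (p * q) + μ * p ^ 3 := by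
  have hd := ((hQ i).differentiable (by simp) (jetSlice n ι none J)).hasFDerivAt
  have hc := ((hd.comp J (jetSlice n ι none).hasFDerivAt).clm_apply
    (jetGrad n ι).hasFDerivAt).clm_apply (jetGrad n ι).hasFDerivAt
  have he : fderiv ℝ (quadraticReaction Q i) J V =
      Q i (jetSlice n ι none J) (jetGrad n ι J) (jetGrad n ι V) +
        (Q i (jetSlice n ι none J) (jetGrad n ι V) (jetGrad n ι J) +
        fderiv ℝ (Q i) (jetSlice n ι none J) (jetSlice n ι none V) (jetGrad n ι J)
          (jetGrad n ι J)) := by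
    rw [show quadraticReaction Q i = fun J => Q i (jetSlice n ι none J) (jetGrad n ι J)
      (jetGrad n ι J) from rfl]
    refine (congrArg (fun T => T V) hc.fderiv).trans ?_
    simp
  have hq : 0 ≤ q := (norm_nonneg _).trans hV
  have b2 : ∀ {T : (Fin n × ι → ℝ) →L[ℝ] (Fin n × ι → ℝ) →L[ℝ] ℝ} {t x y : ℝ}
      {u v : Fin n × ι → ℝ}, 0 ≤ t → 0 ≤ x → ‖T‖ ≤ t → ‖u‖ ≤ x → ‖v‖ ≤ y →
      |T u v| ≤ t * x * y := by
    intro T t x y u v ht hx hT hu hv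
    exact (T.le_opNorm₂ u v).trans (by gcongr)
  rw [he]
  have t1 := b2 hμ hp h0 hJ hV
  have t2 := b2 hμ hq h0 hV hJ
  have t3 := b2 (t := μ * p) (by positivity) hp ((ContinuousLinearMap.le_opNorm _ _).trans
    (mul_le_mul h1 hV' (norm_nonneg _) hμ)) hJ hJ
  refine (abs_add_le _ _).trans ?_
  have := abs_add_le (Q i (jetSlice n ι none J) (jetGrad n ι V) (jetGrad n ι J))
    (fderiv ℝ (Q i) (jetSlice n ι none J) (jetSlice n ι none V) (jetGrad n ι J) (jetGrad n ι J))
  linarith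

lemma quadratic_bernstein {l k b E S p q : ℝ} (hk : 0 ≤ k) (hl : l = 1 / (4 * (k + 1) ^ 2))
    (hb : b ≤ 1 / 4) (hE : E ≤ l) (hS0 : 0 ≤ S) (hS : S ≤ l) (hp : 0 ≤ p)
    (hq : 0 ≤ q) :
    (l + S) * (k * (p * (p * q + p ^ 3)) - q ^ 2) + p ^ 2 * (b * p ^ 2 - p ^ 2) +
      E * (p ^ 2 * q) ≤ 0 - 1 / (16 * l ^ 2) * ((l + S) * p ^ 2) ^ 2 := by
  have hl0 : 0 < l := by rw [hl]; positivity
  have hlk : l * (k + 1) ^ 2 = 1 / 4 := by rw [hl]; field_simp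
  have hl1 : l ≤ 1 / 4 := by nlinarith [mul_nonneg hl0.le hk, mul_nonneg hl0.le (sq_nonneg k)]
  have hF : 1 / (16 * l ^ 2) * ((l + S) * p ^ 2) ^ 2 ≤ 1 / 4 * p ^ 4 := by
    have h1 : (l + S) ^ 2 ≤ (2 * l) ^ 2 := pow_le_pow_left₀ (by positivity) (by linarith) 2
    rw [div_mul_eq_mul_div, div_le_iff₀ (by positivity)]
    nlinarith [mul_le_mul_of_nonneg_right h1 (pow_nonneg hp 4)]
  have h1 : k * (p * (p * q)) ≤ q ^ 2 / 2 + k ^ 2 * p ^ 4 / 2 := by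
    nlinarith [sq_nonneg (q - k * p ^ 2)]
  have h2 : (l + S) * (k * (p * (p * q + p ^ 3)) - q ^ 2) ≤
      (l + S) * ((k ^ 2 / 2 + k) * p ^ 4) - l * (q ^ 2 / 2) := by
    have : (l + S) * (k * (p * (p * q + p ^ 3)) - q ^ 2) ≤
      (l + S) * ((k ^ 2 / 2 + k) * p ^ 4 - q ^ 2 / 2) :=
      mul_le_mul_of_nonneg_left (by nlinarith) (by positivity)
    nlinarith [mul_nonneg hS0 (sq_nonneg q)]
  have h3 : (l + S) * ((k ^ 2 / 2 + k) * p ^ 4) ≤ 1 / 4 * p ^ 4 := by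
    have : (l + S) * ((k ^ 2 / 2 + k) * p ^ 4) ≤ (2 * l) * ((k ^ 2 / 2 + k) * p ^ 4) :=
      mul_le_mul_of_nonneg_right (by linarith) (by positivity)
    nlinarith [pow_nonneg hp 4, mul_nonneg hl0.le (pow_nonneg hp 4)]
  have h4 : E * (p ^ 2 * q) ≤ l * (q ^ 2 / 2) + 1 / 8 * p ^ 4 := by
    have e1 : E * (p ^ 2 * q) ≤ l * (p ^ 2 * q) := mul_le_mul_of_nonneg_right hE (by positivity)
    have e2 : l * (p ^ 2 * q) ≤ l * (q ^ 2 / 2 + p ^ 4 / 2) :=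
      mul_le_mul_of_nonneg_left (by nlinarith [sq_nonneg (q - p ^ 2)]) hl0.le
    nlinarith [pow_nonneg hp 4]
  have h5 : p ^ 2 * (b * p ^ 2) ≤ 1 / 4 * p ^ 4 := by nlinarith [pow_nonneg hp 4]
  nlinarith [pow_nonneg hp 4]

set_option maxSynthPendingDepth 3 in
set_option maxHeartbeats 1000000 in
/-- Interior gradient bound for small solutions of systems with quadratic gradient terms. -/
lemma exists_gradient_bound_of_small {𝒜 : Fin n → Fin n → (ι → ℝ) → ℝ}
    (h𝒜 : ∀ a b, ContDiff ℝ ∞ (𝒜 a b))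
    {Q : ι → (ι → ℝ) → (Fin n × ι → ℝ) →L[ℝ] (Fin n × ι → ℝ) →L[ℝ] ℝ}
    (hQ : ∀ i, ContDiff ℝ ∞ (Q i)) :
    ∃ ε, 0 < ε ∧ ∃ C, ∀ (A : Fin n → Fin n → Spacetime n → ℝ) (w : ι → Spacetime n → ℝ),
      SolvesOn (parabolicCylinder n 1) A w (quadraticReaction Q) (coeffDeriv 𝒜) →
      (∀ z ∈ parabolicCylinder n 1, ∀ i, |w i z| ≤ ε) →
      ∀ z ∈ parabolicCylinder n (1 / 2), ∀ k, |grad w k z| ≤ C := by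
  obtain ⟨μ₀, hμ₀, hQ0⟩ := exists_forall_norm_le (fun i => (hQ i).continuous) 1
  obtain ⟨μ₁, hμ₁, hQ1⟩ := exists_forall_norm_le
    (fun i => (hQ i).continuous_fderiv (by simp)) 1
  obtain ⟨μ₂, hμ₂, hA1⟩ := exists_forall_norm_le (Φ := fun k : Fin n × Fin n =>
    fderiv ℝ (𝒜 k.1 k.2)) (fun k => (h𝒜 k.1 k.2).continuous_fderiv (by simp)) 1
  set N : ℝ := (Fintype.card ι : ℝ) with hN
  set ν : ℝ := max μ₀ μ₁ with hν
  have hν0 : 0 ≤ ν := hμ₀.trans (le_max_left _ _)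
  set μ : ℝ := n ^ 2 * μ₂ + 2 * ν with hμ
  have hμ0 : 0 ≤ μ := by positivity
  set k : ℝ := 2 * n * N * μ with hk
  have hk0 : 0 ≤ k := by positivity
  set l : ℝ := 1 / (4 * (k + 1) ^ 2) with hl
  have hl0 : 0 < l := by positivity
  have hl1 : l ≤ 1 := by
    rw [hl, div_le_one (by positivity)]
    nlinarith
  set ε : ℝ := l / (16 * n ^ 3 * N ^ 2 + 8 * N * μ + N + 1) with hε
  have hden : 0 < 16 * (n : ℝ) ^ 3 * N ^ 2 + 8 * N * μ + N + 1 := by positivity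
  have hε0 : 0 < ε := by positivity
  have hεl : ε * (16 * n ^ 3 * N ^ 2) + ε * (8 * N * μ) + ε * N + ε = l := by
    have : ε * (16 * n ^ 3 * N ^ 2 + 8 * N * μ + N + 1) = l := div_mul_cancel₀ _ hden.ne'
    linarith
  have z1 : 0 ≤ ε * (16 * n ^ 3 * N ^ 2) := by positivity
  have z2 : 0 ≤ ε * (8 * N * μ) := by positivity
  have z3 : 0 ≤ ε * N := by positivity
  obtain ⟨K, hK⟩ := exists_gradient_bound_of_heatOp_le n ι one_pos hl0
    (c := 1 / (16 * l ^ 2)) (by positivity) le_rfl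
  refine ⟨ε, hε0, K, fun A w h hw => hK A w h.elliptic h.smooth fun z hz => ?_⟩
  set p := √(sumSq (grad w) z) with hp
  set q := √(sumSq (grad (grad w)) z) with hq
  have hp0 : 0 ≤ p := Real.sqrt_nonneg _
  have hq0 : 0 ≤ q := Real.sqrt_nonneg _
  have hpz : p ^ 2 = sumSq (grad w) z := Real.sq_sqrt (sumSq_nonneg _ _)
  have hqz : q ^ 2 = sumSq (grad (grad w)) z := Real.sq_sqrt (sumSq_nonneg _ _)
  have gp := abs_le_of_sumSq hp0 hpz
  have gq := abs_le_of_sumSq hq0 hqz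
  have hw1 : ‖jetSlice n ι none fun k => jet w k z‖ ≤ 1 :=
    (pi_norm_le_iff_of_nonneg zero_le_one).2 fun i => (hw z hz i).trans (by linarith)
  have hB : ∀ i, |heatOp A (w i) z| ≤ μ * p ^ 2 := fun i => by
    rw [h.heat z hz i]
    have e1 := norm_jetGrad_jet_le hp0 gp
    have e2 : ‖Q i (jetSlice n ι none fun k => jet w k z)‖ ≤ μ :=
      (hQ0 _ hw1 i).trans ((le_max_left μ₀ μ₁).trans (by
        have : 0 ≤ (n : ℝ) ^ 2 * μ₂ := by positivity
        linarith))
    refine ((Q i _).le_opNorm₂ _ _).trans ?_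
    calc _ ≤ μ * p * p := by gcongr
      _ = _ := by ring
  have hG : ∀ k, |heatOp A (grad w k) z| ≤ μ * (p * q + p ^ 3) := by
    rintro ⟨c, i⟩
    have e0 := (h.jet (isOpen_parabolicCylinder _) (contDiff_quadraticReaction hQ)).heat z hz (some c, i)
    change |heatOp A (jet w (some c, i)) z| ≤ _
    rw [e0]
    refine (abs_liftReaction_some_le (d := μ₂ * p) (q := q) (by positivity) (fun a b => ?_)
      (fun a b => gq (a, (b, i)))).trans ?_
    · exact (ContinuousLinearMap.le_opNorm _ _).trans
        (mul_le_mul (hA1 _ hw1 (a, b)) (norm_dirDeriv_le c hp0 gp) (norm_nonneg _) hμ₂)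
    · have := abs_fderiv_quadraticReaction_le hQ (i := i) hν0 hp0
        ((hQ0 _ hw1 i).trans (le_max_left _ _)) ((hQ1 _ hw1 i).trans (le_max_right _ _))
        (norm_jetGrad_jet_le hp0 gp) (norm_jetGrad_dirDeriv_le c hq0 gq)
        (norm_dirDeriv_le c hp0 gp)
      refine (add_le_add_right this _).trans ?_
      have y1 : 0 ≤ (n : ℝ) ^ 2 * μ₂ * p ^ 3 := by positivity
      have y2 : 0 ≤ ν * p ^ 3 := by positivity
      rw [hμ]
      nlinarith
  have hS : sumSq w z ≤ l := by
    refine (sumSq_le (hw z hz)).trans ?_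
    have : ε ^ 2 ≤ ε := by nlinarith
    nlinarith [mul_le_mul_of_nonneg_left this (Nat.cast_nonneg (α := ℝ) (Fintype.card ι))]
  have main := heatOp_bernstein_le (isOpen_parabolicCylinder _) h.elliptic h.smooth hz hl0.le hε0.le
    hp0 hq0 hpz hqz (hw z hz) hB hG
  have alg := quadratic_bernstein (b := 2 * N * ε * μ) (E := 16 * n ^ 3 * N ^ 2 * ε) hk0 hl
    (by nlinarith) (by linarith) (sumSq_nonneg w z) hS hp0 hq0
  rw [← hpz]
  refine main.trans (le_trans (le_of_eq ?_) alg)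
  rw [hk]
  ring

end GradientEstimates

section Iteration

variable {n : ℕ} {ι : Type} [Fintype ι]

/-- A reaction term affine in the jet with coefficients depending on `w` alone. -/
def affineReaction (f : ι → (ι → ℝ) → ℝ)
    (β : ι → (ι → ℝ) → (Option (Fin n) × ι → ℝ) →L[ℝ] ℝ) : ι → (Option (Fin n) × ι → ℝ) → ℝ :=
  fun i J => f i (jetSlice n ι none J) + β i (jetSlice n ι none J) J

lemma contDiff_affineReaction {f : ι → (ι → ℝ) → ℝ}
    {β : ι → (ι → ℝ) → (Option (Fin n) × ι → ℝ) →L[ℝ] ℝ} (hf : ∀ i, ContDiff ℝ ∞ (f i))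
    (hβ : ∀ i, ContDiff ℝ ∞ (β i)) (i : ι) : ContDiff ℝ ∞ (affineReaction f β i) :=
  ((hf i).comp (jetSlice n ι none).contDiff).add
    (((hβ i).comp (jetSlice n ι none).contDiff).clm_apply contDiff_id)

lemma exists_affineReaction_eq_liftReaction {H : ι → (Option (Fin n) × ι → ℝ) → ℝ}
    {D : Fin n → Fin n → Fin n → (Option (Fin n) × ι → ℝ) → ℝ} (hH : ∀ i, ContDiff ℝ ∞ (H i))
    (hD : ∀ c a b, ContDiff ℝ ∞ (D c a b)) :
    ∃ (f : Option (Fin n) × ι → (Option (Fin n) × ι → ℝ) → ℝ)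
      (β : Option (Fin n) × ι → (Option (Fin n) × ι → ℝ) →
        (Option (Fin n) × (Option (Fin n) × ι) → ℝ) →L[ℝ] ℝ),
      (∀ k, ContDiff ℝ ∞ (f k)) ∧ (∀ k, ContDiff ℝ ∞ (β k)) ∧
        liftReaction H D = affineReaction f β := by
  let f : Option (Fin n) × ι → (Option (Fin n) × ι → ℝ) → ℝ := fun k W =>
    match k with
    | (none, i) => H i W
    | (some _, _) => 0
  let β : Option (Fin n) × ι → (Option (Fin n) × ι → ℝ) →
      (Option (Fin n) × (Option (Fin n) × ι) → ℝ) →L[ℝ] ℝ := fun k W =>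
    match k with
    | (none, _) => 0
    | (some c, i) => ∑ a, ∑ b, D c a b W • ContinuousLinearMap.proj (some a, (some b, i)) +
        (fderiv ℝ (H i) W).comp (jetSlice n _ (some c))
  refine ⟨f, β, ?_, ?_, ?_⟩
  · rintro ⟨_ | c, i⟩
    · exact hH i
    · exact contDiff_const
  · rintro ⟨_ | c, i⟩
    · exact contDiff_const
    · exact (ContDiff.sum fun a _ => ContDiff.sum fun b _ =>
        (hD c a b).smul contDiff_const).add
          (((hH i).fderiv_right (m := ∞) le_rfl).clm_comp contDiff_const)
  · funext k J
    obtain ⟨_ | c, i⟩ := k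
    · simp [liftReaction, affineReaction, f, β]
    · simp [liftReaction, affineReaction, f, β]

lemma affine_bernstein {l k b E S p q Λ : ℝ} (hk : 0 ≤ k) (hb : 0 ≤ b) (hl : l = 1 + 2 * E ^ 2)
    (hS0 : 0 ≤ S) (hS : l + S ≤ Λ) (hp : 0 ≤ p) :
    (l + S) * (k * (p * (p + q + p ^ 2)) - q ^ 2) + p ^ 2 * (b * (1 + p) - p ^ 2) +
      E * (p ^ 2 * q) ≤
      ((Λ * (k + k ^ 2) + b) + 2 * (Λ * (k + k ^ 2) + b) * (4 * (Λ * (k + k ^ 2) + b)) ^ 3) -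
        1 / (4 * Λ ^ 2) * ((l + S) * p ^ 2) ^ 2 := by
  have hl0 : 0 < l := by rw [hl]; positivity
  have hΛ : 0 < Λ := by linarith
  set a := Λ * (k + k ^ 2) + b with ha
  have ha0 : 0 ≤ a := by positivity
  have hF : 1 / (4 * Λ ^ 2) * ((l + S) * p ^ 2) ^ 2 ≤ 1 / 4 * p ^ 4 := by
    have h1 : (l + S) ^ 2 ≤ Λ ^ 2 := pow_le_pow_left₀ (by positivity) hS 2
    rw [div_mul_eq_mul_div, div_le_iff₀ (by positivity)]
    nlinarith [mul_le_mul_of_nonneg_right h1 (pow_nonneg hp 4)]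
  have h1 : k * (p * q) ≤ q ^ 2 / 4 + k ^ 2 * p ^ 2 := by nlinarith [sq_nonneg (q / 2 - k * p)]
  have h2 : (l + S) * (k * (p * (p + q + p ^ 2)) - q ^ 2) ≤
      Λ * (k * p ^ 2 + k ^ 2 * p ^ 2 + k * p ^ 3) - l * (3 / 4 * q ^ 2) := by
    have e1 : (l + S) * (k * (p * (p + q + p ^ 2)) - q ^ 2) ≤
        (l + S) * ((k * p ^ 2 + k ^ 2 * p ^ 2 + k * p ^ 3) - 3 / 4 * q ^ 2) :=
      mul_le_mul_of_nonneg_left (by nlinarith) (by positivity)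
    have e2 : (l + S) * (k * p ^ 2 + k ^ 2 * p ^ 2 + k * p ^ 3) ≤
        Λ * (k * p ^ 2 + k ^ 2 * p ^ 2 + k * p ^ 3) :=
      mul_le_mul_of_nonneg_right hS (by positivity)
    nlinarith [mul_nonneg hS0 (sq_nonneg q)]
  have h3 : E * (p ^ 2 * q) ≤ l * (3 / 4 * q ^ 2) + 1 / 4 * p ^ 4 := by
    rw [hl]
    nlinarith [sq_nonneg (E * q - p ^ 2 / 2), sq_nonneg (E * q), sq_nonneg q]
  have h4 : p ^ 2 ≤ 1 + p ^ 3 := by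
    rcases le_total p 1 with h | h <;> nlinarith [pow_nonneg hp 3, mul_nonneg hp hp]
  have h5 : Λ * (k * p ^ 2 + k ^ 2 * p ^ 2 + k * p ^ 3) + b * (p ^ 2 + p ^ 3) ≤
      a * (p ^ 2 + p ^ 3) := by
    have : 0 ≤ Λ * (k ^ 2 * p ^ 3) := by positivity
    rw [ha]
    linarith
  have h6 : 2 * a * p ^ 3 ≤ 2 * a * (4 * a) ^ 3 + 1 / 2 * p ^ 4 := by
    rcases le_total p (4 * a) with h | h
    · have := mul_le_mul_of_nonneg_left (pow_le_pow_left₀ hp h 3) (by positivity : 0 ≤ 2 * a)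
      have := pow_nonneg hp 4
      linarith
    · have := mul_le_mul_of_nonneg_right h (pow_nonneg hp 3)
      have : 0 ≤ 2 * a * (4 * a) ^ 3 := by positivity
      linarith
  have h7 := mul_le_mul_of_nonneg_left h4 ha0
  linarith

set_option maxSynthPendingDepth 3 in
lemma abs_fderiv_affineReaction_le {f : ι → (ι → ℝ) → ℝ}
    {β : ι → (ι → ℝ) → (Option (Fin n) × ι → ℝ) →L[ℝ] ℝ} (hf : ∀ i, ContDiff ℝ ∞ (f i))
    (hβ : ∀ i, ContDiff ℝ ∞ (β i)) {i : ι} {J V : Option (Fin n) × ι → ℝ} {μ p s v : ℝ}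
    (hμ : 0 ≤ μ) (hp : 0 ≤ p) (h0 : ‖fderiv ℝ (f i) (jetSlice n ι none J)‖ ≤ μ)
    (h1 : ‖β i (jetSlice n ι none J)‖ ≤ μ) (h2 : ‖fderiv ℝ (β i) (jetSlice n ι none J)‖ ≤ μ)
    (hJ : ‖J‖ ≤ s) (hV : ‖V‖ ≤ v) (hV' : ‖jetSlice n ι none V‖ ≤ p) :
    |fderiv ℝ (affineReaction f β i) J V| ≤ μ * p + (μ * v + μ * p * s) := by
  have hdf := ((hf i).differentiable (by simp) (jetSlice n ι none J)).hasFDerivAt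
  have hdβ := ((hβ i).differentiable (by simp) (jetSlice n ι none J)).hasFDerivAt
  have hc := (hdf.comp J (jetSlice n ι none).hasFDerivAt).add
    ((hdβ.comp J (jetSlice n ι none).hasFDerivAt).clm_apply (hasFDerivAt_id J))
  have he : fderiv ℝ (affineReaction f β i) J V =
      fderiv ℝ (f i) (jetSlice n ι none J) (jetSlice n ι none V) +
        (β i (jetSlice n ι none J) V +
          fderiv ℝ (β i) (jetSlice n ι none J) (jetSlice n ι none V) J) := by
    rw [show affineReaction f β i = fun J => f i (jetSlice n ι none J) +
      β i (jetSlice n ι none J) J from rfl]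
    refine (congrArg (fun T => T V) hc.fderiv).trans ?_
    simp
  rw [he]
  refine (abs_add_le _ _).trans (add_le_add ?_ ((abs_add_le _ _).trans (add_le_add ?_ ?_)))
  · exact (ContinuousLinearMap.le_opNorm _ _).trans (mul_le_mul h0 hV' (norm_nonneg _) hμ)
  · exact (ContinuousLinearMap.le_opNorm _ _).trans (mul_le_mul h1 hV (norm_nonneg _) hμ)
  · exact (ContinuousLinearMap.le_opNorm _ _).trans (mul_le_mul
      ((ContinuousLinearMap.le_opNorm _ _).trans (mul_le_mul h2 hV' (norm_nonneg _) hμ)) hJ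
      (norm_nonneg _) (by positivity))

set_option maxSynthPendingDepth 3 in
set_option maxHeartbeats 1000000 in
/-- Interior gradient bound for bounded solutions of systems with affine reaction terms. -/
lemma exists_gradient_bound_of_affine {f : ι → (ι → ℝ) → ℝ}
    {β : ι → (ι → ℝ) → (Option (Fin n) × ι → ℝ) →L[ℝ] ℝ}
    {D : Fin n → Fin n → Fin n → (ι → ℝ) → ℝ} (hf : ∀ i, ContDiff ℝ ∞ (f i))
    (hβ : ∀ i, ContDiff ℝ ∞ (β i)) (hD : ∀ c a b, ContDiff ℝ ∞ (D c a b)) {ρ M : ℝ} (hρ : 0 < ρ)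
    (hM : 0 ≤ M) :
    ∃ C, ∀ (A : Fin n → Fin n → Spacetime n → ℝ) (w : ι → Spacetime n → ℝ),
      SolvesOn (parabolicCylinder n ρ) A w (affineReaction f β)
        (fun c a b J => D c a b (jetSlice n ι none J)) →
      (∀ z ∈ parabolicCylinder n ρ, ∀ i, |w i z| ≤ M) →
      ∀ z ∈ parabolicCylinder n (ρ / 2), ∀ k, |grad w k z| ≤ C := by
  obtain ⟨μ₀, hμ₀, hf0⟩ := exists_forall_norm_le (fun i => (hf i).continuous) M
  obtain ⟨μ₁, hμ₁, hf1⟩ := exists_forall_norm_le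
    (fun i => (hf i).continuous_fderiv (by simp)) M
  obtain ⟨μ₂, hμ₂, hβ0⟩ := exists_forall_norm_le (fun i => (hβ i).continuous) M
  obtain ⟨μ₃, hμ₃, hβ1⟩ := exists_forall_norm_le
    (fun i => (hβ i).continuous_fderiv (by simp)) M
  obtain ⟨μ₄, hμ₄, hD0⟩ := exists_forall_norm_le (Φ := fun k : Fin n × Fin n × Fin n =>
    D k.1 k.2.1 k.2.2) (fun k => (hD k.1 k.2.1 k.2.2).continuous) M
  obtain ⟨μ, hμ, l0, l1, l2, l3, l4⟩ : ∃ μ, 0 ≤ μ ∧ μ₀ ≤ μ ∧ μ₁ ≤ μ ∧ μ₂ ≤ μ ∧ μ₃ ≤ μ ∧ μ₄ ≤ μ :=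
    ⟨μ₀ + μ₁ + μ₂ + μ₃ + μ₄, by positivity, by linarith, by linarith, by linarith, by linarith,
      by linarith⟩
  obtain ⟨N, hN⟩ : ∃ N : ℝ, N = Fintype.card ι := ⟨_, rfl⟩
  have hN0 : 0 ≤ N := by rw [hN]; positivity
  obtain ⟨κ, hκ⟩ : ∃ κ : ℝ, κ = ((n : ℝ) ^ 2 + 3 + M) * μ := ⟨_, rfl⟩
  have hκ0 : 0 ≤ κ := by rw [hκ]; positivity
  obtain ⟨k, hk⟩ : ∃ k : ℝ, k = 2 * n * N * κ := ⟨_, rfl⟩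
  have hk0 : 0 ≤ k := by rw [hk]; positivity
  obtain ⟨b, hb⟩ : ∃ b : ℝ, b = 2 * N * M * κ := ⟨_, rfl⟩
  have hb0 : 0 ≤ b := by rw [hb]; positivity
  obtain ⟨E, hE⟩ : ∃ E : ℝ, E = 16 * n ^ 3 * N ^ 2 * M := ⟨_, rfl⟩
  obtain ⟨l, hl⟩ : ∃ l : ℝ, l = 1 + 2 * E ^ 2 := ⟨_, rfl⟩
  have hl0 : 0 < l := by rw [hl]; positivity
  obtain ⟨Λ, hΛ⟩ : ∃ Λ : ℝ, Λ = l + N * M ^ 2 := ⟨_, rfl⟩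
  have hΛ0 : 0 < Λ := by rw [hΛ]; positivity
  obtain ⟨K, hK⟩ := exists_gradient_bound_of_heatOp_le n ι hρ hl0
    (c := 1 / (4 * Λ ^ 2)) (by positivity)
    (C := (Λ * (k + k ^ 2) + b) + 2 * (Λ * (k + k ^ 2) + b) * (4 * (Λ * (k + k ^ 2) + b)) ^ 3)
    (by positivity)
  refine ⟨K, fun A w h hw => hK A w h.elliptic h.smooth fun z hz => ?_⟩
  obtain ⟨p, hp⟩ : ∃ p : ℝ, p = √(sumSq (grad w) z) := ⟨_, rfl⟩
  obtain ⟨q, hq⟩ : ∃ q : ℝ, q = √(sumSq (grad (grad w)) z) := ⟨_, rfl⟩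
  have hp0 : 0 ≤ p := by rw [hp]; exact Real.sqrt_nonneg _
  have hq0 : 0 ≤ q := by rw [hq]; exact Real.sqrt_nonneg _
  have hpz : p ^ 2 = sumSq (grad w) z := by rw [hp]; exact Real.sq_sqrt (sumSq_nonneg _ _)
  have hqz : q ^ 2 = sumSq (grad (grad w)) z := by rw [hq]; exact Real.sq_sqrt (sumSq_nonneg _ _)
  have gp := abs_le_of_sumSq hp0 hpz
  have gq := abs_le_of_sumSq hq0 hqz
  have hwM : ‖jetSlice n ι none fun k => jet w k z‖ ≤ M :=
    (pi_norm_le_iff_of_nonneg hM).2 fun i => hw z hz i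
  have hJ := norm_jet_le hM hp0 gp (hw z hz)
  have hB : ∀ i, |heatOp A (w i) z| ≤ κ * (1 + p) := fun i => by
    rw [h.heat z hz i]
    have e1 : |f i (jetSlice n ι none fun k => jet w k z)| ≤ μ := (hf0 _ hwM i).trans l0
    have e2 : |β i (jetSlice n ι none fun k => jet w k z) fun k => jet w k z| ≤ μ * (M + p) :=
      (ContinuousLinearMap.le_opNorm _ _).trans
        (mul_le_mul ((hβ0 _ hwM i).trans l2) hJ (norm_nonneg _) hμ)
    refine ((abs_add_le _ _).trans (add_le_add e1 e2)).trans ?_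
    have y1 : 0 ≤ (n : ℝ) ^ 2 * μ * (1 + p) := by positivity
    have y2 : 0 ≤ M * μ * p := by positivity
    have y3 : 0 ≤ μ * p := by positivity
    rw [hκ]
    linarith
  have hG : ∀ k, |heatOp A (grad w k) z| ≤ κ * (p + q + p ^ 2) := by
    rintro ⟨c, i⟩
    have e0 := (h.jet (isOpen_parabolicCylinder _) (contDiff_affineReaction hf hβ)).heat z hz
      (some c, i)
    change |heatOp A (jet w (some c, i)) z| ≤ _
    rw [e0]
    refine (abs_liftReaction_some_le (d := μ) (q := q) hμ
      (fun a b => (hD0 _ hwM (c, a, b)).trans l4) (fun a b => gq (a, (b, i)))).trans ?_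
    have := abs_fderiv_affineReaction_le hf hβ (i := i) hμ hp0 ((hf1 _ hwM i).trans l1)
      ((hβ0 _ hwM i).trans l2) ((hβ1 _ hwM i).trans l3) hJ
      (norm_jet_dirDeriv_le c hp0 hq0 gp gq) (norm_dirDeriv_le c hp0 gp)
    refine (add_le_add_right this _).trans ?_
    have y1 : 0 ≤ (n : ℝ) ^ 2 * μ * (p + p ^ 2) := by positivity
    have y2 : 0 ≤ M * μ * (q + p ^ 2) := by positivity
    have y3 : 0 ≤ μ * p := by positivity
    have y4 : 0 ≤ μ * q := by positivity
    have y5 : 0 ≤ μ * p ^ 2 := by positivity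
    rw [hκ]
    linarith
  have hS : l + sumSq w z ≤ Λ := by
    rw [hΛ, hN]
    exact add_le_add_right (sumSq_le (hw z hz)) l
  have main := heatOp_bernstein_le (isOpen_parabolicCylinder _) h.elliptic h.smooth hz hl0.le hM
    hp0 hq0 hpz hqz (hw z hz) hB hG
  have alg := affine_bernstein (q := q) hk0 hb0 hl (sumSq_nonneg w z) hS hp0
  rw [← hpz]
  refine main.trans (le_trans (le_of_eq ?_) alg)
  rw [hk, hb, hE, hN]
  ring

/-- Iterated spatial derivative along a list of coordinate directions. -/
def iterDeriv : List (Fin n) → (Spacetime n → ℝ) → Spacetime n → ℝ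
  | [], F => F
  | a :: l, F => dirDeriv (spaceDir a) (iterDeriv l F)

lemma iterDeriv_concat (l : List (Fin n)) (a : Fin n) (F : Spacetime n → ℝ) :
    iterDeriv (l ++ [a]) F = iterDeriv l (dirDeriv (spaceDir a) F) := by
  induction l with
  | nil => rfl
  | cons b l ih => simp [iterDeriv, ih]

lemma exists_iterDeriv_bound_of_affine (k : ℕ) :
    ∀ (ι : Type) [Fintype ι] (f : ι → (ι → ℝ) → ℝ)
      (β : ι → (ι → ℝ) → (Option (Fin n) × ι → ℝ) →L[ℝ] ℝ)
      (D : Fin n → Fin n → Fin n → (ι → ℝ) → ℝ), (∀ i, ContDiff ℝ ∞ (f i)) →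
      (∀ i, ContDiff ℝ ∞ (β i)) → (∀ c a b, ContDiff ℝ ∞ (D c a b)) → ∀ ρ M : ℝ, 0 < ρ → 0 ≤ M →
      ∃ C, ∀ (A : Fin n → Fin n → Spacetime n → ℝ) (w : ι → Spacetime n → ℝ),
        SolvesOn (parabolicCylinder n ρ) A w (affineReaction f β)
          (fun c a b J => D c a b (jetSlice n ι none J)) →
        (∀ z ∈ parabolicCylinder n ρ, ∀ i, |w i z| ≤ M) →
        ∀ L : List (Fin n), L.length = k → ∀ z ∈ parabolicCylinder n (ρ / 2 ^ k), ∀ i,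
          |iterDeriv L (w i) z| ≤ C := by
  induction k with
  | zero =>
    intro ι _ f β D _ _ _ ρ M _ _
    refine ⟨M, fun A w _ hw L hL z hz i => ?_⟩
    rw [List.length_eq_zero_iff.1 hL]
    exact hw z (by simpa using hz) i
  | succ k ih =>
    intro ι _ f β D hf hβ hD ρ M hρ hM
    obtain ⟨K, hK⟩ := exists_gradient_bound_of_affine hf hβ hD hρ hM
    have hH := contDiff_affineReaction hf hβ
    have hDc : ∀ c a b, ContDiff ℝ ∞ fun J => D c a b (jetSlice n ι none J) := fun c a b =>
      (hD c a b).comp (jetSlice n ι none).contDiff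
    obtain ⟨f', β', hf', hβ', he⟩ := exists_affineReaction_eq_liftReaction hH hDc
    obtain ⟨C, hC⟩ := ih _ f' β' (fun c a b J => D c a b (jetSlice n ι none J)) hf' hβ' hDc
      (ρ / 2) (max M K) (by positivity) (hM.trans (le_max_left _ _))
    refine ⟨C, fun A w h hw L hL z hz i => ?_⟩
    obtain rfl | ⟨L', a, rfl⟩ := L.eq_nil_or_concat
    · simp at hL
    have hsub : parabolicCylinder n (ρ / 2) ⊆ parabolicCylinder n ρ :=
      parabolicCylinder_mono (by positivity) (by linarith)
    have hj := (h.jet (isOpen_parabolicCylinder _) hH).mono hsub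
    rw [he] at hj
    rw [List.concat_eq_append, iterDeriv_concat]
    refine hC A (jet w) hj ?_ L' (by simpa using hL) z ?_ (some a, i)
    · rintro y hy ⟨_ | b, m⟩
      · exact (hw y (hsub hy) m).trans (le_max_left _ _)
      · exact (hK A w h hw y hy (b, m)).trans (le_max_right _ _)
    · rwa [div_div, ← pow_succ']

/-- All interior derivative bounds for small solutions of systems with quadratic gradient terms,
with a smallness threshold independent of the order of the derivative. -/
lemma exists_iterDeriv_bound_of_small {𝒜 : Fin n → Fin n → (ι → ℝ) → ℝ}
    (h𝒜 : ∀ a b, ContDiff ℝ ∞ (𝒜 a b))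
    {Q : ι → (ι → ℝ) → (Fin n × ι → ℝ) →L[ℝ] (Fin n × ι → ℝ) →L[ℝ] ℝ}
    (hQ : ∀ i, ContDiff ℝ ∞ (Q i)) :
    ∃ ε, 0 < ε ∧ ∀ k : ℕ, ∃ C, ∀ (A : Fin n → Fin n → Spacetime n → ℝ)
      (w : ι → Spacetime n → ℝ),
      SolvesOn (parabolicCylinder n 1) A w (quadraticReaction Q) (coeffDeriv 𝒜) →
      (∀ z ∈ parabolicCylinder n 1, ∀ i, |w i z| ≤ ε) →
      ∀ L : List (Fin n), L.length = k + 1 → ∀ z ∈ parabolicCylinder n (1 / 2 ^ (k + 1)), ∀ i,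
        |iterDeriv L (w i) z| ≤ C := by
  obtain ⟨ε, hε, K, hK⟩ := exists_gradient_bound_of_small h𝒜 hQ
  have hH := contDiff_quadraticReaction hQ
  have hDc := contDiff_coeffDeriv h𝒜
  refine ⟨ε, hε, fun k => ?_⟩
  obtain ⟨f', β', hf', hβ', he⟩ := exists_affineReaction_eq_liftReaction hH hDc
  obtain ⟨C, hC⟩ := exists_iterDeriv_bound_of_affine k _ f' β' (coeffDeriv 𝒜) hf' hβ' hDc
    (1 / 2) (max ε K) (by positivity) (hε.le.trans (le_max_left _ _))
  refine ⟨C, fun A w h hw L hL z hz i => ?_⟩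
  obtain rfl | ⟨L', a, rfl⟩ := L.eq_nil_or_concat
  · simp at hL
  have hsub : parabolicCylinder n (1 / 2) ⊆ parabolicCylinder n 1 :=
    parabolicCylinder_mono (by positivity) (by norm_num)
  have hj := (h.jet (isOpen_parabolicCylinder _) hH).mono hsub
  rw [he] at hj
  rw [List.concat_eq_append, iterDeriv_concat]
  refine hC A (jet w) hj ?_ L' (by simpa using hL) z ?_ (some a, i)
  · rintro y hy ⟨_ | b, m⟩
    · exact (hw y (hsub hy) m).trans (le_max_left _ _)
    · exact (hK A w h hw y hy (b, m)).trans (le_max_right _ _)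
  · rwa [div_div, ← pow_succ']

end Iteration

section RicciDeTurck

variable {n : ℕ}

/-- A smooth function which equals `d⁻¹` for `1/2 ≤ d`. -/
def smoothInv (d : ℝ) : ℝ := Real.smoothTransition (4 * d - 1) * d⁻¹

lemma smoothInv_eq {d : ℝ} (h : 1 / 2 ≤ d) : smoothInv d = d⁻¹ := by
  rw [smoothInv, Real.smoothTransition.one_of_one_le (by linarith), one_mul]

lemma contDiff_smoothInv : ContDiff ℝ ∞ smoothInv := by
  rw [contDiff_iff_contDiffAt]
  intro d
  have h1 : ContDiffAt ℝ ∞ (fun d : ℝ => Real.smoothTransition (4 * d - 1)) d :=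
    Real.smoothTransition.contDiffAt.comp d (by fun_prop)
  rcases eq_or_ne d 0 with rfl | hd
  · have : smoothInv =ᶠ[𝓝 0] fun _ => 0 := by
      filter_upwards [gt_mem_nhds (show (0 : ℝ) < 1 / 4 by norm_num)] with d hd
      rw [smoothInv, Real.smoothTransition.zero_of_nonpos (by linarith), zero_mul]
    exact contDiffAt_const.congr_of_eventuallyEq this
  · exact h1.mul (contDiffAt_inv ℝ hd)

/-- The metric `δ + u`. -/
def metricOf (u : Fin n × Fin n → ℝ) : Matrix (Fin n) (Fin n) ℝ :=
  Matrix.of fun i j => (1 : Matrix (Fin n) (Fin n) ℝ) i j + u (i, j)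

/-- A globally smooth extension of the inverse of `δ + u`. -/
def invMetric (a b : Fin n) (u : Fin n × Fin n → ℝ) : ℝ :=
  smoothInv (metricOf u).det * (metricOf u).adjugate a b

lemma contDiff_det {E : Type*} [NormedAddCommGroup E] [NormedSpace ℝ E]
    {M : E → Matrix (Fin n) (Fin n) ℝ} (hM : ∀ i j, ContDiff ℝ ∞ fun u => M u i j) :
    ContDiff ℝ ∞ fun u => (M u).det := by
  simp only [Matrix.det_apply']
  exact ContDiff.sum fun σ _ => contDiff_const.mul (contDiff_prod fun i _ => hM _ _)

lemma contDiff_invMetric (a b : Fin n) : ContDiff ℝ ∞ (invMetric (n := n) a b) := by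
  have h : ∀ i j, ContDiff ℝ ∞ fun u : Fin n × Fin n → ℝ => metricOf u i j := fun i j =>
    contDiff_const.add (contDiff_apply ℝ ℝ (i, j))
  refine (contDiff_smoothInv.comp (contDiff_det h)).mul ?_
  simp only [Matrix.adjugate_apply]
  refine contDiff_det fun i j => ?_
  by_cases hi : i = b
  · subst hi
    simpa only [Matrix.updateRow_self] using contDiff_const
  · simpa only [Matrix.updateRow_ne hi] using h i j

lemma invMetric_eq {u : Fin n × Fin n → ℝ} (hu : 1 / 2 ≤ (metricOf u).det) (a b : Fin n) :
    invMetric a b u = (metricOf u)⁻¹ a b := by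
  rw [invMetric, smoothInv_eq hu, Matrix.inv_def, Ring.inverse_eq_inv']
  rfl

lemma invMetric_symm {u : Fin n × Fin n → ℝ} (hu : ∀ i j, u (i, j) = u (j, i)) (a b : Fin n) :
    invMetric a b u = invMetric b a u := by
  have h : (metricOf u).transpose = metricOf u := by
    ext i j
    simp only [metricOf, Matrix.transpose_apply, Matrix.of_apply, hu j i, Matrix.one_apply,
      eq_comm (a := j)]
  rw [invMetric, invMetric]
  congr 1
  conv_rhs => rw [← h, ← Matrix.adjugate_transpose, Matrix.transpose_apply]

lemma metricOf_zero : metricOf (0 : Fin n × Fin n → ℝ) = 1 := by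
  ext i j
  simp [metricOf]

lemma exists_invMetric_near_one (n : ℕ) {η : ℝ} (hη : 0 < η) :
    ∃ ε, 0 < ε ∧ ∀ u : Fin n × Fin n → ℝ, (∀ k, |u k| ≤ ε) → 1 / 2 ≤ (metricOf u).det ∧
      ∀ a b, |invMetric a b u - (1 : Matrix (Fin n) (Fin n) ℝ) a b| ≤ η := by
  have h : ∀ i j, ContDiff ℝ ∞ fun u : Fin n × Fin n → ℝ => metricOf u i j := fun i j =>
    contDiff_const.add (contDiff_apply ℝ ℝ (i, j))
  have h1 : ∀ᶠ u in 𝓝 (0 : Fin n × Fin n → ℝ), 1 / 2 < (metricOf u).det :=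
    (contDiff_det h).continuous.continuousAt.eventually_const_lt (by
      beta_reduce
      rw [metricOf_zero, Matrix.det_one]
      norm_num)
  have h2 : ∀ a b, ∀ᶠ u in 𝓝 (0 : Fin n × Fin n → ℝ),
      |invMetric a b u - (1 : Matrix (Fin n) (Fin n) ℝ) a b| < η := fun a b => by
    refine (((contDiff_invMetric a b).continuous.sub
      continuous_const).abs).continuousAt.eventually_lt_const ?_
    change |invMetric a b 0 - (1 : Matrix (Fin n) (Fin n) ℝ) a b| < η
    rw [invMetric, metricOf_zero, Matrix.det_one, smoothInv_eq (by norm_num)]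
    simpa using hη
  obtain ⟨ε, hε, hb⟩ := Metric.eventually_nhds_iff.1
    (h1.and (eventually_all.2 fun a => eventually_all.2 fun b => h2 a b))
  refine ⟨ε / 2, by positivity, fun u hu => ?_⟩
  have hn : ‖u‖ ≤ ε / 2 := (pi_norm_le_iff_of_nonneg (by positivity)).2 hu
  obtain ⟨e1, e2⟩ := hb (y := u) (by rw [dist_zero_right]; linarith)
  exact ⟨e1.le, fun a b => (e2 a b).le⟩

lemma quadForm_lower {B : Fin n → Fin n → ℝ} {η : ℝ} (hη : n * η ≤ 1 / 2) (hη0 : 0 ≤ η)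
    (hB : ∀ a b, |B a b - (1 : Matrix (Fin n) (Fin n) ℝ) a b| ≤ η) (ξ : Fin n → ℝ) :
    1 / 2 * ∑ a, ξ a ^ 2 ≤ ∑ a, ∑ b, B a b * (ξ a * ξ b) := by
  have h1 : ∑ a, ∑ b, (1 : Matrix (Fin n) (Fin n) ℝ) a b * (ξ a * ξ b) = ∑ a, ξ a ^ 2 := by
    simp [Matrix.one_apply, sq]
  have h2 : ∑ a, ∑ b, ((1 : Matrix (Fin n) (Fin n) ℝ) a b * (ξ a * ξ b) -
      η * ((ξ a ^ 2 + ξ b ^ 2) / 2)) ≤ ∑ a, ∑ b, B a b * (ξ a * ξ b) := by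
    refine Finset.sum_le_sum fun a _ => Finset.sum_le_sum fun b _ => ?_
    have e1 : |(B a b - (1 : Matrix (Fin n) (Fin n) ℝ) a b) * (ξ a * ξ b)| ≤
        η * ((ξ a ^ 2 + ξ b ^ 2) / 2) := by
      rw [abs_mul]
      refine mul_le_mul (hB a b) ?_ (abs_nonneg _) hη0
      rw [abs_le]
      constructor <;> nlinarith [sq_nonneg (ξ a - ξ b), sq_nonneg (ξ a + ξ b)]
    have := (abs_le.1 e1).1
    linarith
  have h3 : ∑ a, ∑ b, η * ((ξ a ^ 2 + ξ b ^ 2) / 2) = n * η * ∑ a, ξ a ^ 2 := by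
    simp only [← Finset.mul_sum, ← Finset.sum_div, Finset.sum_add_distrib, Finset.sum_const,
      Finset.card_univ, Fintype.card_fin, nsmul_eq_mul]
    ring
  simp only [Finset.sum_sub_distrib] at h2
  rw [h1, h3] at h2
  have h4 : 0 ≤ ∑ a, ξ a ^ 2 := Finset.sum_nonneg fun a _ => sq_nonneg _
  nlinarith

/-- The product of two coordinates as a bilinear form. -/
def coordProd {κ : Type} [Fintype κ] (k k' : κ) : (κ → ℝ) →L[ℝ] (κ → ℝ) →L[ℝ] ℝ :=
  (ContinuousLinearMap.proj (R := ℝ) (φ := fun _ : κ => ℝ) k).smulRight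
    (ContinuousLinearMap.proj (R := ℝ) (φ := fun _ : κ => ℝ) k')

lemma coordProd_apply {κ : Type} [Fintype κ] (k k' : κ) (X Y : κ → ℝ) :
    coordProd k k' X Y = X k * Y k' := by
  simp [coordProd]

/-- The quadratic gradient term of the Ricci–DeTurck equation. -/
def deTurckQuadratic (k : Fin n × Fin n) (u : Fin n × Fin n → ℝ) :
    (Fin n × (Fin n × Fin n) → ℝ) →L[ℝ] (Fin n × (Fin n × Fin n) → ℝ) →L[ℝ] ℝ :=
  ∑ a, ∑ b, ∑ p, ∑ q, (1 / 2 * (invMetric a b u * invMetric p q u)) •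
    (coordProd (k.1, (p, a)) (k.2, (q, b)) + (2 : ℝ) • coordProd (a, (k.2, p)) (q, (k.1, b)) -
      (2 : ℝ) • coordProd (a, (k.2, p)) (b, (k.1, q)) -
      (2 : ℝ) • coordProd (k.2, (p, a)) (b, (k.1, q)) -
      (2 : ℝ) • coordProd (k.1, (p, a)) (b, (k.2, q)))

set_option maxSynthPendingDepth 3 in
lemma contDiff_deTurckQuadratic (k : Fin n × Fin n) :
    ContDiff ℝ ∞ (deTurckQuadratic (n := n) k) :=
  ContDiff.sum fun a _ => ContDiff.sum fun b _ => ContDiff.sum fun p _ => ContDiff.sum fun q _ =>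
    (contDiff_const.mul ((contDiff_invMetric a b).mul (contDiff_invMetric p q))).smul
      contDiff_const

/-- The perturbation `w = g - δ` satisfies the Ricci–DeTurck equation at the spacetime point `z`. -/
def DeTurckAt (w : Fin n × Fin n → Spacetime n → ℝ) (z : Spacetime n) : Prop :=
  ∀ i j, dirDeriv (timeDir n) (w (i, j)) z =
    (∑ a, ∑ b, (metricOf fun k => w k z)⁻¹ a b *
      dirDeriv (spaceDir a) (dirDeriv (spaceDir b) (w (i, j))) z) +
    (1 / 2) * ∑ a, ∑ b, ∑ p, ∑ q,
      (metricOf fun k => w k z)⁻¹ a b * (metricOf fun k => w k z)⁻¹ p q *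
      (grad w (i, (p, a)) z * grad w (j, (q, b)) z +
        2 * grad w (a, (j, p)) z * grad w (q, (i, b)) z -
        2 * grad w (a, (j, p)) z * grad w (b, (i, q)) z -
        2 * grad w (j, (p, a)) z * grad w (b, (i, q)) z -
        2 * grad w (i, (p, a)) z * grad w (b, (j, q)) z)

lemma exists_iterDeriv_bound_of_deTurck (n : ℕ) :
    ∃ ε, 0 < ε ∧ ∀ k : ℕ, ∃ C, ∀ w : Fin n × Fin n → Spacetime n → ℝ,
      (∀ i, ContDiffOn ℝ ∞ (w i) (parabolicCylinder n 1)) →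
      (∀ z ∈ parabolicCylinder n 1, ∀ i j, w (i, j) z = w (j, i) z) →
      (∀ z ∈ parabolicCylinder n 1, DeTurckAt w z) →
      (∀ z ∈ parabolicCylinder n 1, ∀ i, |w i z| ≤ ε) →
      ∀ L : List (Fin n), L.length = k + 1 → ∀ z ∈ parabolicCylinder n (1 / 2 ^ (k + 1)), ∀ i,
        |iterDeriv L (w i) z| ≤ C := by
  obtain ⟨ε₁, hε₁, h1⟩ := exists_iterDeriv_bound_of_small (contDiff_invMetric (n := n))
    (contDiff_deTurckQuadratic (n := n))
  have hη : (0 : ℝ) < 1 / (2 * (n + 1)) := by positivity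
  obtain ⟨ε₂, hε₂, h2⟩ := exists_invMetric_near_one n hη
  refine ⟨min ε₁ ε₂, lt_min hε₁ hε₂, fun k => ?_⟩
  obtain ⟨C, hC⟩ := h1 k
  refine ⟨C, fun w hw hs hd hsm => ?_⟩
  have hnear := fun z hz => h2 (fun k => w k z) fun k => (hsm z hz k).trans (min_le_right _ _)
  refine hC (fun a b z => invMetric a b fun k => w k z) w ⟨⟨?_, ?_, ?_, ?_⟩, hw, ?_, ?_⟩
    fun z hz i => (hsm z hz i).trans (min_le_left _ _)
  · exact fun a b => ContDiffOn.comp_pi (contDiff_invMetric a b) hw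
  · exact fun z hz a b => invMetric_symm (hs z hz) a b
  · refine fun z hz ξ => quadForm_lower ?_ hη.le (hnear z hz).2 ξ
    rw [mul_one_div, div_le_div_iff₀ (by positivity) (by norm_num)]
    linarith
  · intro z hz a b
    have e1 := (hnear z hz).2 a b
    have e2 : |(1 : Matrix (Fin n) (Fin n) ℝ) a b| ≤ 1 := by
      rw [Matrix.one_apply]; split_ifs <;> simp
    have e3 : 1 / (2 * ((n : ℝ) + 1)) ≤ 1 := by
      rw [div_le_one (by positivity)]
      have : (0 : ℝ) ≤ n := Nat.cast_nonneg n
      linarith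
    have := abs_add_le (invMetric a b (fun k => w k z) - (1 : Matrix (Fin n) (Fin n) ℝ) a b)
      ((1 : Matrix (Fin n) (Fin n) ℝ) a b)
    rw [sub_add_cancel] at this
    linarith
  · rintro z hz ⟨i, j⟩
    have := hd z hz i j
    simp only [← invMetric_eq (hnear z hz).1] at this
    rw [heatOp, this, add_sub_cancel_left]
    change _ = deTurckQuadratic (i, j) (fun k => w k z) (fun k => grad w k z) fun k => grad w k z
    simp only [deTurckQuadratic, sum_apply, smul_apply, add_apply, sub_apply, coordProd_apply,
      smul_eq_mul, Finset.mul_sum]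
    refine Finset.sum_congr rfl fun a _ => Finset.sum_congr rfl fun b _ =>
      Finset.sum_congr rfl fun p _ => Finset.sum_congr rfl fun q _ => ?_
    ring
  · intro z hz c a b
    exact dirDeriv_comp_pi (contDiff_invMetric a b)
      (fun k => (hw k).differentiableAt_of_isOpen (isOpen_parabolicCylinder _) hz) _

end RicciDeTurck

section Scaling

variable {n : ℕ}

lemma dirDeriv_spaceDir_eq_pd {F : Spacetime n → ℝ} {t : ℝ} {x : Eucl n}
    (hF : DifferentiableAt ℝ F (t, x)) (a : Fin n) :
    dirDeriv (spaceDir a) F (t, x) = pd a (fun y => F (t, y)) x := by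
  have h := hF.hasFDerivAt.comp x (hasFDerivAt_prodMk_right t x)
  exact (congrArg (fun T => T (EuclideanSpace.single a 1)) h.fderiv).symm

lemma dirDeriv_timeDir_eq_deriv {F : Spacetime n → ℝ} {t : ℝ} {x : Eucl n}
    (hF : DifferentiableAt ℝ F (t, x)) :
    dirDeriv (timeDir n) F (t, x) = deriv (fun s => F (s, x)) t := by
  have h : HasFDerivAt (fun s => F (s, x))
      ((fderiv ℝ F (t, x)).comp (ContinuousLinearMap.inl ℝ ℝ (Eucl n))) t :=
    hF.hasFDerivAt.comp t (hasFDerivAt_prodMk_left t x)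
  exact h.hasDerivAt.deriv.symm

lemma ContDiffOn.iterDeriv {Ω : Set (Spacetime n)} (hΩ : IsOpen Ω) {F : Spacetime n → ℝ}
    (hF : ContDiffOn ℝ ∞ F Ω) : ∀ L : List (Fin n), ContDiffOn ℝ ∞ (iterDeriv L F) Ω
  | [] => hF
  | a :: L => (ContDiffOn.iterDeriv hΩ hF L).dirDeriv hΩ (spaceDir a)

lemma pdIter_eq_iterDeriv {I : Set ℝ} {U : Set (Eucl n)} (hI : IsOpen I) (hU : IsOpen U)
    {F : Spacetime n → ℝ} (hF : ContDiffOn ℝ ∞ F (I ×ˢ U)) {t : ℝ} (ht : t ∈ I) :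
    ∀ L : List (Fin n), ∀ x ∈ U, pdIter L (fun y => F (t, y)) x = iterDeriv L F (t, x)
  | [], _, _ => rfl
  | a :: L, x, hx => by
    have h1 : pdIter L (fun y => F (t, y)) =ᶠ[𝓝 x] fun y => iterDeriv L F (t, y) := by
      filter_upwards [hU.mem_nhds hx] with y hy
      exact pdIter_eq_iterDeriv hI hU hF ht L y hy
    have h2 := (ContDiffOn.iterDeriv (hI.prod hU) hF L).differentiableAt_of_isOpen
      (hI.prod hU) (show (t, x) ∈ I ×ˢ U from ⟨ht, hx⟩)
    rw [pdIter, iterDeriv, dirDeriv_spaceDir_eq_pd h2, pd, h1.fderiv_eq]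
    rfl

/-- The parabolic rescaling sending the origin to `z₀`. -/
def rescale (ρ : ℝ) (z₀ : Spacetime n) (z : Spacetime n) : Spacetime n :=
  (z₀.1 + ρ ^ 2 * z.1, z₀.2 + ρ • z.2)

lemma contDiff_rescale (ρ : ℝ) (z₀ : Spacetime n) : ContDiff ℝ ∞ (rescale ρ z₀) :=
  (contDiff_const.add (contDiff_const.mul contDiff_fst)).prodMk
    (contDiff_const.add (contDiff_snd.const_smul ρ))

lemma dirDeriv_comp_rescale {ρ : ℝ} {z₀ z : Spacetime n} {F : Spacetime n → ℝ}
    (hF : DifferentiableAt ℝ F (rescale ρ z₀ z)) (v : Spacetime n) :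
    dirDeriv v (fun y => F (rescale ρ z₀ y)) z =
      dirDeriv (ρ ^ 2 * v.1, ρ • v.2) F (rescale ρ z₀ z) := by
  have h1 : HasFDerivAt (rescale ρ z₀)
      ((ρ ^ 2 • ContinuousLinearMap.fst ℝ ℝ (Eucl n)).prod
        (ρ • ContinuousLinearMap.snd ℝ ℝ (Eucl n))) z :=
    ((hasFDerivAt_fst.const_mul (ρ ^ 2)).const_add z₀.1).prodMk
      ((hasFDerivAt_snd.const_smul ρ).const_add z₀.2)
  have h := hF.hasFDerivAt.comp z h1
  exact congrArg (fun T => T v) h.fderiv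

lemma dirDeriv_spaceDir_comp_rescale {ρ : ℝ} {z₀ z : Spacetime n} {F : Spacetime n → ℝ}
    (hF : DifferentiableAt ℝ F (rescale ρ z₀ z)) (a : Fin n) :
    dirDeriv (spaceDir a) (fun y => F (rescale ρ z₀ y)) z =
      ρ * dirDeriv (spaceDir a) F (rescale ρ z₀ z) := by
  rw [dirDeriv_comp_rescale hF]
  have : ((ρ ^ 2 * (spaceDir a).1, ρ • (spaceDir a).2) : Spacetime n) = ρ • spaceDir a := by
    simp [spaceDir]
  rw [this, dirDeriv_smul]

lemma dirDeriv_timeDir_comp_rescale {ρ : ℝ} {z₀ z : Spacetime n} {F : Spacetime n → ℝ}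
    (hF : DifferentiableAt ℝ F (rescale ρ z₀ z)) :
    dirDeriv (timeDir n) (fun y => F (rescale ρ z₀ y)) z =
      ρ ^ 2 * dirDeriv (timeDir n) F (rescale ρ z₀ z) := by
  rw [dirDeriv_comp_rescale hF]
  have : ((ρ ^ 2 * (timeDir n).1, ρ • (timeDir n).2) : Spacetime n) = ρ ^ 2 • timeDir n := by
    simp [timeDir]
  rw [this, dirDeriv_smul]

lemma iterDeriv_comp_rescale {ρ : ℝ} {z₀ : Spacetime n} {Ω Ω' : Set (Spacetime n)}
    (hΩ : IsOpen Ω) (hΩ' : IsOpen Ω') (hm : ∀ z ∈ Ω, rescale ρ z₀ z ∈ Ω') {F : Spacetime n → ℝ}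
    (hF : ContDiffOn ℝ ∞ F Ω') :
    ∀ L : List (Fin n), EqOn (iterDeriv L fun z => F (rescale ρ z₀ z))
      (fun z => ρ ^ L.length * iterDeriv L F (rescale ρ z₀ z)) Ω
  | [] => fun z _ => by simp [iterDeriv]
  | a :: L => fun z hz => by
    have hL := ContDiffOn.iterDeriv hΩ' hF L
    have hd := hL.differentiableAt_of_isOpen hΩ' (hm z hz)
    have hd' : DifferentiableAt ℝ (fun z => iterDeriv L F (rescale ρ z₀ z)) z :=
      hd.comp z ((contDiff_rescale ρ z₀).differentiable (by simp) z)
    rw [iterDeriv, dirDeriv_congr hΩ (iterDeriv_comp_rescale hΩ hΩ' hm hF L) _ hz,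
      dirDeriv_mul (differentiableAt_const _) hd', dirDeriv_const,
      dirDeriv_spaceDir_comp_rescale hd]
    simp only [iterDeriv, List.length_cons, Pi.zero_apply]
    ring

lemma iterDeriv_sub_const {L : List (Fin n)} (hL : L ≠ []) (F : Spacetime n → ℝ) (c : ℝ) :
    iterDeriv L (fun z => F z - c) = iterDeriv L F := by
  obtain rfl | ⟨L', a, rfl⟩ := L.eq_nil_or_concat
  · exact absurd rfl hL
  · rw [List.concat_eq_append, iterDeriv_concat, iterDeriv_concat, dirDeriv_sub_const]

end Scaling

section Flow

variable {n : ℕ}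

/-- The rescaled perturbation `g - δ`. -/
def rescaledPerturbation (g : ℝ → Eucl n → Matrix (Fin n) (Fin n) ℝ) (ρ : ℝ) (z₀ : Spacetime n)
    (k : Fin n × Fin n) (z : Spacetime n) : ℝ :=
  g (rescale ρ z₀ z).1 (rescale ρ z₀ z).2 k.1 k.2 - (1 : Matrix (Fin n) (Fin n) ℝ) k.1 k.2

lemma metricOf_rescaledPerturbation (g : ℝ → Eucl n → Matrix (Fin n) (Fin n) ℝ) (ρ : ℝ)
    (z₀ z : Spacetime n) :
    (metricOf fun k => rescaledPerturbation g ρ z₀ k z) =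
      g (rescale ρ z₀ z).1 (rescale ρ z₀ z).2 := by
  ext i j
  simp [metricOf, rescaledPerturbation]

variable {g : ℝ → Eucl n → Matrix (Fin n) (Fin n) ℝ} {I : Set ℝ} {U : Set (Eucl n)}
  {ρ : ℝ} {z₀ : Spacetime n} {Ω : Set (Spacetime n)}

lemma contDiffOn_rescaledPerturbation (hg : IsRicciDeTurckFlow g I U)
    (hm : ∀ z ∈ Ω, rescale ρ z₀ z ∈ I ×ˢ U) (k : Fin n × Fin n) :
    ContDiffOn ℝ ∞ (rescaledPerturbation g ρ z₀ k) Ω :=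
  ((hg.1 k.1 k.2).comp (contDiff_rescale ρ z₀).contDiffOn hm).sub contDiffOn_const

lemma grad_rescaledPerturbation (hg : IsRicciDeTurckFlow g I U) (hI : IsOpen I) (hU : IsOpen U)
    (hm : ∀ z ∈ Ω, rescale ρ z₀ z ∈ I ×ˢ U) {z : Spacetime n} (hz : z ∈ Ω) (a i j : Fin n) :
    grad (rescaledPerturbation g ρ z₀) (a, (i, j)) z =
      ρ * pd a (fun y => g (rescale ρ z₀ z).1 y i j) (rescale ρ z₀ z).2 := by
  have hd := (hg.1 i j).differentiableAt_of_isOpen (hI.prod hU) (hm z hz)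
  have h1 := dirDeriv_spaceDir_comp_rescale hd a
  have h2 := dirDeriv_spaceDir_eq_pd (t := (rescale ρ z₀ z).1) (x := (rescale ρ z₀ z).2) hd a
  rw [← h2, Prod.mk.eta, ← h1, ← dirDeriv_sub_const _ ((1 : Matrix (Fin n) (Fin n) ℝ) i j)]
  rfl

lemma deTurckAt_rescaledPerturbation (hg : IsRicciDeTurckFlow g I U) (hI : IsOpen I)
    (hU : IsOpen U) (hΩ : IsOpen Ω) (hm : ∀ z ∈ Ω, rescale ρ z₀ z ∈ I ×ˢ U) {z : Spacetime n}
    (hz : z ∈ Ω) : DeTurckAt (rescaledPerturbation g ρ z₀) z := by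
  intro i j
  have hF := hg.1 i j
  have hd := hF.differentiableAt_of_isOpen (hI.prod hU) (hm z hz)
  have ht : dirDeriv (timeDir n) (rescaledPerturbation g ρ z₀ (i, j)) z =
      ρ ^ 2 * deriv (fun s => g s (rescale ρ z₀ z).2 i j) (rescale ρ z₀ z).1 := by
    have h2 := dirDeriv_timeDir_eq_deriv (t := (rescale ρ z₀ z).1) (x := (rescale ρ z₀ z).2) hd
    rw [← h2, Prod.mk.eta, ← dirDeriv_timeDir_comp_rescale hd]
    exact congrFun (dirDeriv_sub_const _ ((1 : Matrix (Fin n) (Fin n) ℝ) i j) _) z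
  have hss : ∀ a b, dirDeriv (spaceDir a)
      (dirDeriv (spaceDir b) (rescaledPerturbation g ρ z₀ (i, j))) z =
      ρ ^ 2 * pd a (fun y => pd b (fun x => g (rescale ρ z₀ z).1 x i j) y)
        (rescale ρ z₀ z).2 := by
    intro a b
    have h1 := iterDeriv_comp_rescale hΩ (hI.prod hU) hm hF [a, b] hz
    have h2 := pdIter_eq_iterDeriv hI hU hF (hm z hz).1 [a, b] _ (hm z hz).2
    have h3 := iterDeriv_sub_const (L := [a, b]) (by simp)
      (fun z => g (rescale ρ z₀ z).1 (rescale ρ z₀ z).2 i j)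
      ((1 : Matrix (Fin n) (Fin n) ℝ) i j)
    exact (congrFun h3 z).trans (h1.trans (congrArg (fun c => ρ ^ 2 * c) h2.symm))
  rw [metricOf_rescaledPerturbation, ht, hg.2.2 _ (hm z hz).1 _ (hm z hz).2]
  simp only [hss, grad_rescaledPerturbation hg hI hU hm hz, mul_add, Finset.mul_sum]
  congr 1
  · exact Finset.sum_congr rfl fun a _ => Finset.sum_congr rfl fun b _ => by ring
  · exact Finset.sum_congr rfl fun a _ => Finset.sum_congr rfl fun b _ =>
      Finset.sum_congr rfl fun p _ => Finset.sum_congr rfl fun q _ => by ring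

lemma iterDeriv_rescaledPerturbation (hg : IsRicciDeTurckFlow g I U) (hI : IsOpen I)
    (hU : IsOpen U) (hΩ : IsOpen Ω) (hm : ∀ z ∈ Ω, rescale ρ z₀ z ∈ I ×ˢ U) {z : Spacetime n}
    (hz : z ∈ Ω) {L : List (Fin n)} (hL : L ≠ []) (i j : Fin n) :
    iterDeriv L (rescaledPerturbation g ρ z₀ (i, j)) z =
      ρ ^ L.length * pdIter L (fun y => g (rescale ρ z₀ z).1 y i j) (rescale ρ z₀ z).2 := by
  have h1 := iterDeriv_comp_rescale hΩ (hI.prod hU) hm (hg.1 i j) L hz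
  have h2 := pdIter_eq_iterDeriv hI hU (hg.1 i j) (hm z hz).1 L _ (hm z hz).2
  have h3 := iterDeriv_sub_const hL (fun z => g (rescale ρ z₀ z).1 (rescale ρ z₀ z).2 i j)
    ((1 : Matrix (Fin n) (Fin n) ℝ) i j)
  exact (congrFun h3 z).trans (h1.trans (congrArg (fun c => ρ ^ L.length * c) h2.symm))

lemma abs_sub_le_of_sqrt_matDistSq_le {A B : Matrix (Fin n) (Fin n) ℝ} {ε : ℝ}
    (h : √(matDistSq A B) ≤ ε) (i j : Fin n) : |A i j - B i j| ≤ ε := by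
  refine (Real.abs_le_sqrt ?_).trans h
  exact (Finset.single_le_sum (f := fun j => (A i j - B i j) ^ 2) (fun _ _ => sq_nonneg _)
    (Finset.mem_univ j)).trans (Finset.single_le_sum (f := fun i => ∑ j, (A i j - B i j) ^ 2)
      (fun _ _ => Finset.sum_nonneg fun _ _ => sq_nonneg _) (Finset.mem_univ i))

/-- Pointwise bound for the partial derivatives of order `k + 1`. -/
lemma exists_pdIter_bound (n : ℕ) :
    ∃ ε, 0 < ε ∧ ∀ k : ℕ, ∃ C, ∀ r : ℝ, 0 < r →
      ∀ (x₀ : Eucl n) (T : ℝ), T ∈ Ioc (0 : ℝ) 1 → ∀ g : ℝ → Eucl n → Matrix (Fin n) (Fin n) ℝ,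
        IsRicciDeTurckFlow g (Ioo 0 T) (ball x₀ (4 * r)) →
        (∀ t ∈ Ioo (0 : ℝ) T, ∀ x ∈ ball x₀ (4 * r), √(matDistSq (g t x) 1) ≤ ε) →
        ∀ t ∈ Ioo (0 : ℝ) T, ∀ x ∈ ball x₀ r, ∀ L : List (Fin n), L.length = k + 1 → ∀ i j,
          |(min r 1 * √t) ^ (k + 1) * pdIter L (fun y => g t y i j) x| ≤ C := by
  obtain ⟨ε, hε, h⟩ := exists_iterDeriv_bound_of_deTurck n
  refine ⟨ε, hε, fun k => ?_⟩
  obtain ⟨C, hC⟩ := h k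
  refine ⟨C, fun r hr x₀ T hT g hg hsm t ht x hx L hL i j => ?_⟩
  obtain ⟨ρ, hρ⟩ : ∃ ρ, ρ = min r 1 * √t := ⟨_, rfl⟩
  have hm0 : 0 < min r 1 := lt_min hr one_pos
  have hst : 0 < √t := Real.sqrt_pos.2 ht.1
  have hst1 : √t ≤ 1 := Real.sqrt_le_one.2 (ht.2.le.trans hT.2)
  have hρ0 : 0 < ρ := by rw [hρ]; positivity
  have hρr : ρ ≤ r := by
    rw [hρ]
    exact (mul_le_of_le_one_right hm0.le hst1).trans (min_le_left _ _)
  have hρt : ρ ^ 2 ≤ t := by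
    rw [hρ, mul_pow, Real.sq_sqrt ht.1.le]
    exact mul_le_of_le_one_left ht.1.le (pow_le_one₀ hm0.le (min_le_right _ _))
  obtain ⟨σ, hσ⟩ : ∃ σ : ℝ, σ = 1 / 2 ^ (k + 1) := ⟨_, rfl⟩
  have hσ0 : 0 < σ := by rw [hσ]; positivity
  have hσ1 : σ ≤ 1 := by
    rw [hσ, div_le_one (by positivity)]
    exact one_le_pow₀ one_le_two
  obtain ⟨t₁, ht₁, ht₁'⟩ := exists_between (lt_min ht.2
    (show t < t + ρ ^ 2 * σ ^ 2 by have : 0 < ρ ^ 2 * σ ^ 2 := by positivity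
                                   linarith))
  have hmap : ∀ z ∈ parabolicCylinder n 1,
      rescale ρ (t₁, x) z ∈ Ioo 0 T ×ˢ ball x₀ (4 * r) := by
    rintro ⟨s, y⟩ ⟨hs, hy⟩
    simp only [one_pow, mem_Ioo] at hs
    have hy : ‖y‖ < 1 := by simpa using hy
    have e1 : ρ ^ 2 * s < 0 := mul_neg_of_pos_of_neg (by positivity) hs.2
    have e2 : -(ρ ^ 2) < ρ ^ 2 * s := by nlinarith [pow_pos hρ0 2]
    have e3 := ht₁'.trans_le (min_le_left _ _)
    refine ⟨⟨?_, ?_⟩, ?_⟩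
    · simp only [rescale]; linarith
    · simp only [rescale]; linarith
    · have e4 : ‖ρ • y‖ ≤ ρ := by
        rw [norm_smul, Real.norm_of_nonneg hρ0.le]
        exact mul_le_of_le_one_right hρ0.le hy.le
      have hx' := mem_ball.1 hx
      have e5 := dist_triangle (x + ρ • y) x x₀
      rw [dist_self_add_left] at e5
      simp only [rescale, mem_ball]
      linarith
  have hopen := isOpen_parabolicCylinder (n := n) 1
  have hz : ((t - t₁) / ρ ^ 2, (0 : Eucl n)) ∈ parabolicCylinder n σ := by
    refine ⟨⟨?_, ?_⟩, mem_ball_self hσ0⟩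
    · rw [lt_div_iff₀ (by positivity)]
      have := ht₁'.trans_le (min_le_right _ _)
      linarith
    · exact div_neg_of_neg_of_pos (by linarith) (by positivity)
  have hz1 := parabolicCylinder_mono hσ0.le hσ1 hz
  have hres : rescale ρ (t₁, x) ((t - t₁) / ρ ^ 2, (0 : Eucl n)) = (t, x) := by
    simp only [rescale, smul_zero, add_zero]
    rw [mul_div_cancel₀ _ (by positivity)]
    simp
  have key := hC (rescaledPerturbation g ρ (t₁, x)) (contDiffOn_rescaledPerturbation hg hmap)
    (fun z hz i j => by
      have := (hg.2.1 _ (hmap z hz).1 _ (hmap z hz).2).1.apply i j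
      simp only [rescaledPerturbation, this, Matrix.one_apply, eq_comm (a := i)])
    (fun z hz => deTurckAt_rescaledPerturbation hg isOpen_Ioo isOpen_ball hopen hmap hz)
    (fun z hz k => abs_sub_le_of_sqrt_matDistSq_le (hsm _ (hmap z hz).1 _ (hmap z hz).2) _ _)
    L hL _ (by rw [← hσ]; exact hz) (i, j)
  rw [iterDeriv_rescaledPerturbation hg isOpen_Ioo isOpen_ball hopen hmap hz1
    (by rintro rfl; simp at hL), hres, hL] at key
  rwa [← hρ]

end Flow

/-- interior derivative estimates for the Ricci–DeTurck flow with flat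
background: `|∂^j g(t)|² ≤ c_j(n,r) / t^j` on the inner ball. -/
theorem interior_derivative_estimates (n : ℕ) (hn : 1 ≤ n) :
    ∃ ε₀ : ℝ, 0 < ε₀ ∧
      ∀ j : ℕ, 1 ≤ j → ∀ r : ℝ, 0 < r →
        ∃ c : ℝ, 0 < c ∧
          ∀ (x₀ : Eucl n) (T : ℝ), T ∈ Set.Ioc (0 : ℝ) 1 →
            ∀ g : ℝ → Eucl n → Matrix (Fin n) (Fin n) ℝ,
              IsRicciDeTurckFlow g (Set.Ioo 0 T) (ball x₀ (4 * r)) →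
              (∀ t ∈ Set.Ioo (0 : ℝ) T, ∀ x ∈ ball x₀ (4 * r),
                Real.sqrt (matDistSq (g t x) 1) ≤ ε₀) →
              ∀ t ∈ Set.Ioo (0 : ℝ) T, ∀ x ∈ ball x₀ r,
                djSq j g t x ≤ c / t ^ j := by
  obtain ⟨ε, hε, h⟩ := exists_pdIter_bound n
  refine ⟨ε, hε, fun j hj r hr => ?_⟩
  obtain ⟨k, rfl⟩ : ∃ k, j = k + 1 := ⟨j - 1, by omega⟩
  obtain ⟨C, hC⟩ := h k
  obtain ⟨m, hm⟩ : ∃ m : ℝ, m = min r 1 := ⟨_, rfl⟩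
  have hm0 : 0 < m := by rw [hm]; exact lt_min hr one_pos
  refine ⟨∑ _a : Fin (k + 1) → Fin n, ∑ _i : Fin n, ∑ _j : Fin n, C ^ 2 / (m ^ 2) ^ (k + 1) + 1,
    by positivity, fun x₀ T hT g hg hsm t ht x hx => ?_⟩
  have ht0 := ht.1
  rw [le_div_iff₀ (by positivity), djSq]
  refine le_trans ?_ (le_add_of_nonneg_right zero_le_one)
  simp only [Finset.sum_mul]
  refine Finset.sum_le_sum fun a _ => Finset.sum_le_sum fun i _ => Finset.sum_le_sum fun j _ => ?_
  have key := hC r hr x₀ T hT g hg hsm t ht x hx (List.ofFn a) (List.length_ofFn) i j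
  rw [← hm] at key
  have hsq := sq_le_sq' (abs_le.1 key).1 (abs_le.1 key).2
  rw [mul_pow, ← pow_mul, mul_comm (k + 1) 2, pow_mul, mul_pow, Real.sq_sqrt ht0.le, mul_pow] at hsq
  rw [le_div_iff₀ (by positivity)]
  linarith
end
end

section
/- Pointwise evolution inequality for the squared gradient (flat-background case of inequality (3.3) in the proof of Theorem 4.1 of the paper): There exist ε₀(n) > 0 and c(n) > 0 such that for every open set U ⊆ ℝⁿ, every open time interval I, and every Ricci–DeTurck flow g on U over I with |g(t,x) − δ| ≤ ε₀(n) for all (t,x) ∈ I × U, the following holds at every point (t,x) ∈ I × U: ∂_t(|∂g|²) ≤ ∑_{a,b} g^{ab} ∂_a ∂_b (|∂g|²) − |∂²g|² + c(n) |∂g|⁴. -/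
open MeasureTheory Metric Set Filter Topology

noncomputable section

/-! ### Calculus of partial derivatives -/

section Calculus

variable {n : ℕ}

lemma pd_congr {a : Fin n} {f h : Eucl n → ℝ} {x : Eucl n} {U : Set (Eucl n)}
    (hU : IsOpen U) (hx : x ∈ U) (hfh : ∀ y ∈ U, f y = h y) : pd a f x = pd a h x := by
  unfold pd
  rw [Filter.EventuallyEq.fderiv_eq (Filter.eventuallyEq_of_mem (hU.mem_nhds hx) hfh)]

lemma pd_add {a : Fin n} {f h : Eucl n → ℝ} {x : Eucl n}
    (hf : DifferentiableAt ℝ f x) (hh : DifferentiableAt ℝ h x) :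
    pd a (fun y => f y + h y) x = pd a f x + pd a h x := by
  simp [pd, fderiv_fun_add hf hh]

lemma pd_mul {a : Fin n} {f h : Eucl n → ℝ} {x : Eucl n}
    (hf : DifferentiableAt ℝ f x) (hh : DifferentiableAt ℝ h x) :
    pd a (fun y => f y * h y) x = pd a f x * h x + f x * pd a h x := by
  simp [pd, fderiv_fun_mul hf hh]
  ring

lemma pd_sum {ι : Type*} [Fintype ι] {a : Fin n} {f : ι → Eucl n → ℝ} {x : Eucl n}
    (hf : ∀ i, DifferentiableAt ℝ (f i) x) :
    pd a (fun y => ∑ i, f i y) x = ∑ i, pd a (f i) x := by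
  simp [pd, fderiv_fun_sum fun i _ => hf i]

lemma ContDiffOn.pd {a : Fin n} {f : Eucl n → ℝ} {U : Set (Eucl n)} (hU : IsOpen U)
    (hf : ContDiffOn ℝ (⊤ : ℕ∞) f U) : ContDiffOn ℝ (⊤ : ℕ∞) (pd a f) U :=
  (hf.fderiv_of_isOpen hU (by simp)).clm_apply contDiffOn_const

lemma ContDiffOn.differentiableAt_of_isOpen_s4 {E : Type*} [NormedAddCommGroup E] [NormedSpace ℝ E]
    {f : E → ℝ} {U : Set E} (hU : IsOpen U) (hf : ContDiffOn ℝ (⊤ : ℕ∞) f U) {x : E}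
    (hx : x ∈ U) : DifferentiableAt ℝ f x :=
  (hf.contDiffAt (hU.mem_nhds hx)).differentiableAt (by simp)

/-- Directional derivatives of a smooth function commute. -/
lemma fderiv_fderiv_apply_comm {E : Type*} [NormedAddCommGroup E] [NormedSpace ℝ E]
    {f : E → ℝ} {U : Set E} (hU : IsOpen U) (hf : ContDiffOn ℝ (⊤ : ℕ∞) f U) {x : E}
    (hx : x ∈ U) (v w : E) :
    fderiv ℝ (fun y => fderiv ℝ f y v) x w = fderiv ℝ (fun y => fderiv ℝ f y w) x v := by
  have hd : DifferentiableAt ℝ (fderiv ℝ f) x :=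
    ((hf.fderiv_of_isOpen hU (m := (⊤ : ℕ∞)) (by simp)).contDiffAt
      (hU.mem_nhds hx)).differentiableAt (by simp)
  have hs : IsSymmSndFDerivAt ℝ f x :=
    (hf.contDiffAt (hU.mem_nhds hx)).isSymmSndFDerivAt (by
      rw [minSmoothness_of_isRCLikeNormedField]
      exact WithTop.coe_le_coe.2 le_top)
  rw [fderiv_clm_apply hd (differentiableAt_const v), fderiv_clm_apply hd (differentiableAt_const w)]
  simpa using hs w v

lemma pd_comm {a b : Fin n} {f : Eucl n → ℝ} {U : Set (Eucl n)} (hU : IsOpen U)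
    (hf : ContDiffOn ℝ (⊤ : ℕ∞) f U) {x : Eucl n} (hx : x ∈ U) :
    pd a (pd b f) x = pd b (pd a f) x :=
  fderiv_fderiv_apply_comm hU hf hx _ _

lemma contDiffOn_slice {f : ℝ × Eucl n → ℝ} {I : Set ℝ} {U : Set (Eucl n)}
    (hf : ContDiffOn ℝ (⊤ : ℕ∞) f (I ×ˢ U)) {t : ℝ} (ht : t ∈ I) :
    ContDiffOn ℝ (⊤ : ℕ∞) (fun y => f (t, y)) U :=
  hf.comp (contDiffOn_const.prodMk contDiffOn_id) fun _ hy => ⟨ht, hy⟩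

lemma pd_slice {c : Fin n} {f : ℝ × Eucl n → ℝ} {t : ℝ} {x : Eucl n}
    (hf : DifferentiableAt ℝ f (t, x)) :
    pd c (fun y => f (t, y)) x = fderiv ℝ f (t, x) (0, EuclideanSpace.single c 1) := by
  have h := hf.hasFDerivAt.comp x (hasFDerivAt_prodMk_right (𝕜 := ℝ) t x)
  have h' : fderiv ℝ (fun y => f (t, y)) x = _ := h.fderiv
  simp [pd, h']

lemma hasDerivAt_slice {f : ℝ × Eucl n → ℝ} {t : ℝ} {x : Eucl n}
    (hf : DifferentiableAt ℝ f (t, x)) :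
    HasDerivAt (fun s => f (s, x)) (fderiv ℝ f (t, x) (1, 0)) t := by
  have h := hf.hasFDerivAt.comp t (hasFDerivAt_prodMk_left (𝕜 := ℝ) t x)
  have hslice := h.hasDerivAt
  simp only [ContinuousLinearMap.comp_apply, ContinuousLinearMap.inl_apply] at hslice
  exact hslice

/-- The time derivative commutes with the spatial partial derivatives. -/
lemma hasDerivAt_pd {c : Fin n} {f : ℝ × Eucl n → ℝ} {I : Set ℝ} {U : Set (Eucl n)}
    (hI : IsOpen I) (hU : IsOpen U) (hf : ContDiffOn ℝ (⊤ : ℕ∞) f (I ×ˢ U))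
    {t : ℝ} (ht : t ∈ I) {x : Eucl n} (hx : x ∈ U) :
    HasDerivAt (fun s => pd c (fun y => f (s, y)) x)
      (pd c (fun y => deriv (fun s => f (s, y)) t) x) t := by
  have hIU := hI.prod hU
  have hd : ∀ s ∈ I, ∀ y ∈ U, DifferentiableAt ℝ f (s, y) := fun s hs y hy =>
    hf.differentiableAt_of_isOpen_s4 hIU ⟨hs, hy⟩
  have hfd : ∀ v, ContDiffOn ℝ (⊤ : ℕ∞) (fun p => fderiv ℝ f p v) (I ×ˢ U) := fun v =>
    (hf.fderiv_of_isOpen hIU (by simp)).clm_apply contDiffOn_const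
  have hfd' : ∀ v, DifferentiableAt ℝ (fun p => fderiv ℝ f p v) (t, x) := fun v =>
    (hfd v).differentiableAt_of_isOpen_s4 hIU ⟨ht, hx⟩
  rw [pd_congr hU hx fun y hy => (hasDerivAt_slice (hd t ht y hy)).deriv,
    pd_slice (hfd' _), fderiv_fderiv_apply_comm hIU hf ⟨ht, hx⟩]
  exact (hasDerivAt_slice (hfd' _)).congr_of_eventuallyEq
    (Filter.eventuallyEq_of_mem (hI.mem_nhds ht) fun s hs => pd_slice (hd s hs x hx))

end Calculus

/-! ### Matrices close to the identity -/

section Matrices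

variable {n : ℕ}

/-- Testing a matrix within `1/10` of the identity against `v`, in terms of `w = M v`. -/
lemma sum_sq_mulVec_estimates {M : Matrix (Fin n) (Fin n) ℝ} (hM : matDistSq M 1 ≤ (1 / 10) ^ 2)
    (v : Fin n → ℝ) :
    (7 / 10) * ∑ i, ((M.mulVec v) i) ^ 2 ≤ ∑ i, (M.mulVec v) i * v i ∧
      ∑ i, (v i) ^ 2 ≤ 4 * ∑ i, ((M.mulVec v) i) ^ 2 := by
  obtain ⟨e, he⟩ : ∃ e : Fin n → ℝ, ∀ i, e i = ∑ j, (M i j - (1 : Matrix _ _ ℝ) i j) * v j :=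
    ⟨_, fun _ => rfl⟩
  have hw : ∀ i, (M.mulVec v) i = v i + e i := fun i => by
    simp [he, Matrix.mulVec, dotProduct, sub_mul, Finset.sum_sub_distrib, Matrix.one_apply]
  have he2 : ∑ i, e i ^ 2 ≤ (1 / 10) ^ 2 * ∑ i, v i ^ 2 := by
    calc ∑ i, e i ^ 2
        ≤ ∑ i, (∑ j, (M i j - (1 : Matrix _ _ ℝ) i j) ^ 2) * ∑ j, v j ^ 2 := by
          refine Finset.sum_le_sum fun i _ => ?_
          rw [he]
          exact Finset.sum_mul_sq_le_sq_mul_sq _ _ _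
      _ = matDistSq M 1 * ∑ j, v j ^ 2 := by rw [matDistSq, Finset.sum_mul]
      _ ≤ _ := by gcongr
  have hV : 0 ≤ ∑ i, v i ^ 2 := Finset.sum_nonneg fun i _ => sq_nonneg _
  have hlow : (9 / 20) * ∑ i, v i ^ 2 - 5 * ∑ i, e i ^ 2 ≤ ∑ i, (v i * e i + v i ^ 2 / 2) := by
    rw [Finset.mul_sum, Finset.mul_sum, ← Finset.sum_sub_distrib]
    exact Finset.sum_le_sum fun i _ => by nlinarith [sq_nonneg (v i + 10 * e i)]
  have hup : ∑ i, (v i * e i) ≤ (1 / 20) * ∑ i, v i ^ 2 + 5 * ∑ i, e i ^ 2 := by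
    rw [Finset.mul_sum, Finset.mul_sum, ← Finset.sum_add_distrib]
    exact Finset.sum_le_sum fun i _ => by nlinarith [sq_nonneg (v i - 10 * e i)]
  have h1 : ∑ i, (v i + e i) ^ 2 = ∑ i, v i ^ 2 + 2 * ∑ i, v i * e i + ∑ i, e i ^ 2 := by
    rw [Finset.mul_sum, ← Finset.sum_add_distrib, ← Finset.sum_add_distrib]
    exact Finset.sum_congr rfl fun i _ => by ring
  have h2 : ∑ i, (v i + e i) * v i = ∑ i, v i ^ 2 + ∑ i, v i * e i := by
    rw [← Finset.sum_add_distrib]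
    exact Finset.sum_congr rfl fun i _ => by ring
  have h3 : ∑ i, (v i * e i + v i ^ 2 / 2) = ∑ i, v i * e i + (∑ i, v i ^ 2) / 2 := by
    rw [Finset.sum_add_distrib, Finset.sum_div]
  have hE : 0 ≤ ∑ i, e i ^ 2 := Finset.sum_nonneg fun i _ => sq_nonneg _
  simp only [hw, h1, h2]
  rw [h3] at hlow
  constructor <;> nlinarith

lemma inv_quadratic_form_ge {M : Matrix (Fin n) (Fin n) ℝ} (hdet : IsUnit M.det)
    (hM : matDistSq M 1 ≤ (1 / 10) ^ 2) (w : Fin n → ℝ) :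
    (7 / 10) * ∑ i, w i ^ 2 ≤ ∑ a, ∑ b, M⁻¹ a b * (w a * w b) := by
  have h := (sum_sq_mulVec_estimates hM (M⁻¹.mulVec w)).1
  rw [Matrix.mulVec_mulVec, Matrix.mul_nonsing_inv _ hdet, Matrix.one_mulVec] at h
  refine h.trans (le_of_eq (Finset.sum_congr rfl fun a _ => ?_))
  rw [Matrix.mulVec, dotProduct, Finset.mul_sum]
  exact Finset.sum_congr rfl fun b _ => by ring

lemma abs_inv_apply_le {M : Matrix (Fin n) (Fin n) ℝ} (hdet : IsUnit M.det)
    (hM : matDistSq M 1 ≤ (1 / 10) ^ 2) (a b : Fin n) : |M⁻¹ a b| ≤ 2 := by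
  have h := (sum_sq_mulVec_estimates hM (M⁻¹.mulVec (Pi.single b 1))).2
  rw [Matrix.mulVec_mulVec, Matrix.mul_nonsing_inv _ hdet, Matrix.one_mulVec] at h
  have h1 : ∑ i, (Pi.single b (1 : ℝ) : Fin n → ℝ) i ^ 2 = 1 := by
    simp [Pi.single_apply]
  have h2 := Finset.single_le_sum (f := fun i => (M⁻¹.mulVec (Pi.single b 1)) i ^ 2)
    (fun i _ => sq_nonneg _) (Finset.mem_univ a)
  simp only [Matrix.mulVec_single_one, Matrix.col_apply] at h h2
  rw [h1] at h
  exact abs_le_of_sq_le_sq (by linarith) (by norm_num)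

lemma differentiableAt_inv_apply {E : Type*} [NormedAddCommGroup E] [NormedSpace ℝ E]
    {M : E → Matrix (Fin n) (Fin n) ℝ} {x : E}
    (hM : ∀ i j, DifferentiableAt ℝ (fun y => M y i j) x) (hdet : IsUnit (M x).det)
    (a b : Fin n) : DifferentiableAt ℝ (fun y => (M y)⁻¹ a b) x := by
  have hdetd : ∀ N : E → Matrix (Fin n) (Fin n) ℝ,
      (∀ i j, DifferentiableAt ℝ (fun y => N y i j) x) →
      DifferentiableAt ℝ (fun y => (N y).det) x := fun N hN => by
    simp only [Matrix.det_apply]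
    refine DifferentiableAt.fun_sum fun σ _ => DifferentiableAt.const_smul ?_ _
    exact (HasFDerivAt.finsetProd fun i _ => (hN (σ i) i).hasFDerivAt).differentiableAt
  simp only [Matrix.inv_def, Ring.inverse_eq_inv', Matrix.smul_apply, smul_eq_mul,
    Matrix.adjugate_apply]
  refine ((hdetd M hM).inv hdet.ne_zero).mul (hdetd _ fun i j => ?_)
  by_cases hi : i = b
  · subst hi; simp
  · simpa [Matrix.updateRow_ne hi] using hM i j

end Matrices

/-! ### Bounds on a function and its first derivatives at a point -/

section PointwiseBounds

variable {n : ℕ}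

/-- `f` is differentiable at `x`, with value bounded by `A` and partial derivatives bounded by
`B` there. -/
structure BoundedAt (f : Eucl n → ℝ) (x : Eucl n) (A B : ℝ) : Prop where
  differentiableAt : DifferentiableAt ℝ f x
  abs_le : |f x| ≤ A
  abs_pd_le : ∀ c, |pd c f x| ≤ B

namespace BoundedAt

variable {f h : Eucl n → ℝ} {x : Eucl n} {A B A₂ B₂ : ℝ}

lemma add (hf : BoundedAt f x A B) (hh : BoundedAt h x A₂ B₂) :
    BoundedAt (fun y => f y + h y) x (A + A₂) (B + B₂) where
  differentiableAt := hf.differentiableAt.add hh.differentiableAt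
  abs_le := (abs_add_le _ _).trans (add_le_add hf.abs_le hh.abs_le)
  abs_pd_le c := by
    rw [pd_add hf.differentiableAt hh.differentiableAt]
    exact (abs_add_le _ _).trans (add_le_add (hf.abs_pd_le c) (hh.abs_pd_le c))

lemma mul (hf : BoundedAt f x A B) (hh : BoundedAt h x A₂ B₂) :
    BoundedAt (fun y => f y * h y) x (A * A₂) (B * A₂ + A * B₂) where
  differentiableAt := hf.differentiableAt.mul hh.differentiableAt
  abs_le := by
    rw [abs_mul]
    exact mul_le_mul hf.abs_le hh.abs_le (abs_nonneg _) ((abs_nonneg _).trans hf.abs_le)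
  abs_pd_le c := by
    rw [pd_mul hf.differentiableAt hh.differentiableAt]
    refine (abs_add_le _ _).trans ?_
    rw [abs_mul, abs_mul]
    exact add_le_add
      (mul_le_mul (hf.abs_pd_le c) hh.abs_le (abs_nonneg _)
        ((abs_nonneg _).trans (hf.abs_pd_le c)))
      (mul_le_mul hf.abs_le (hh.abs_pd_le c) (abs_nonneg _) ((abs_nonneg _).trans hf.abs_le))

lemma const (r : ℝ) : BoundedAt (fun _ => r) x |r| 0 where
  differentiableAt := differentiableAt_const r
  abs_le := le_rfl
  abs_pd_le c := by simp [pd]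

lemma const_mul (r : ℝ) (hf : BoundedAt f x A B) :
    BoundedAt (fun y => r * f y) x (|r| * A) (|r| * B) := by
  simpa using (const r).mul hf

lemma sub (hf : BoundedAt f x A B) (hh : BoundedAt h x A₂ B₂) :
    BoundedAt (fun y => f y - h y) x (A + A₂) (B + B₂) := by
  simpa [sub_eq_add_neg] using hf.add (hh.const_mul (-1))

lemma sum {f : Fin n → Eucl n → ℝ} (hf : ∀ i, BoundedAt (f i) x A B) :
    BoundedAt (fun y => ∑ i, f i y) x (n * A) (n * B) where
  differentiableAt := DifferentiableAt.fun_sum fun i _ => (hf i).differentiableAt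
  abs_le := by
    refine (Finset.abs_sum_le_sum_abs _ _).trans ?_
    simpa using Finset.sum_le_card_nsmul Finset.univ _ A fun i _ => (hf i).abs_le
  abs_pd_le c := by
    rw [pd_sum fun i => (hf i).differentiableAt]
    refine (Finset.abs_sum_le_sum_abs _ _).trans ?_
    simpa using Finset.sum_le_card_nsmul Finset.univ _ B fun i _ => (hf i).abs_pd_le c

end BoundedAt

lemma abs_sum_le_of_abs_le {f : Fin n → ℝ} {A : ℝ} (hf : ∀ i, |f i| ≤ A) :
    |∑ i, f i| ≤ n * A := by
  refine (Finset.abs_sum_le_sum_abs _ _).trans ?_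
  simpa using Finset.sum_le_card_nsmul Finset.univ _ A fun i _ => hf i

/-- The inverse of a matrix field near the identity is controlled to first order. -/
lemma boundedAt_inv_apply {M : Eucl n → Matrix (Fin n) (Fin n) ℝ} {U : Set (Eucl n)}
    (hU : IsOpen U) {x : Eucl n} (hx : x ∈ U)
    (hM : ∀ i j, DifferentiableAt ℝ (fun y => M y i j) x)
    (hdet : ∀ y ∈ U, IsUnit (M y).det) (hdist : matDistSq (M x) 1 ≤ (1 / 10) ^ 2) {D : ℝ}
    (hD : ∀ c i j, |pd c (fun y => M y i j) x| ≤ D) (a b : Fin n) :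
    BoundedAt (fun y => (M y)⁻¹ a b) x 2 (4 * n ^ 2 * D) where
  differentiableAt := differentiableAt_inv_apply hM (hdet x hx) a b
  abs_le := abs_inv_apply_le (hdet x hx) hdist a b
  abs_pd_le c := by
    have hinv := differentiableAt_inv_apply hM (hdet x hx)
    obtain ⟨dM, hdM⟩ : ∃ N : Matrix (Fin n) (Fin n) ℝ,
        N = Matrix.of fun i j => pd c (fun y => M y i j) x := ⟨_, rfl⟩
    obtain ⟨dA, hdA⟩ : ∃ N : Matrix (Fin n) (Fin n) ℝ,
        N = Matrix.of fun i j => pd c (fun y => (M y)⁻¹ i j) x := ⟨_, rfl⟩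
    have hprod : dM * (M x)⁻¹ + M x * dA = 0 := by
      ext i j
      have h1 : pd c (fun y => ∑ p, M y i p * (M y)⁻¹ p j) x = 0 := by
        rw [pd_congr (h := fun _ => (1 : Matrix (Fin n) (Fin n) ℝ) i j) hU hx fun y hy => by
          rw [← Matrix.mul_apply, Matrix.mul_nonsing_inv _ (hdet y hy)]]
        simp [pd]
      rw [pd_sum fun p => (hM i p).fun_mul (hinv p j)] at h1
      simp only [pd_mul (hM _ _) (hinv _ _), Finset.sum_add_distrib] at h1
      simpa [Matrix.mul_apply, hdM, hdA] using h1
    have hsol : dA = -((M x)⁻¹ * dM * (M x)⁻¹) := by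
      have h2 : (M x)⁻¹ * (M x * dA) = dA := by
        rw [← Matrix.mul_assoc, Matrix.nonsing_inv_mul _ (hdet x hx), Matrix.one_mul]
      rw [← h2, eq_neg_of_add_eq_zero_right hprod, Matrix.mul_neg, Matrix.mul_assoc]
    have hAbd := abs_inv_apply_le (hdet x hx) hdist
    have h3 : pd c (fun y => (M y)⁻¹ a b) x
        = -∑ p, (∑ q, (M x)⁻¹ a q * pd c (fun y => M y q p) x) * (M x)⁻¹ p b := by
      have := congrFun (congrFun hsol a) b
      simpa [hdA, hdM, Matrix.mul_apply] using this
    rw [h3, abs_neg]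
    have h4 : ∀ p, |∑ q, (M x)⁻¹ a q * pd c (fun y => M y q p) x| ≤ n * (2 * D) := fun p =>
      abs_sum_le_of_abs_le fun q => by
        rw [abs_mul]
        exact mul_le_mul (hAbd a q) (hD c q p) (abs_nonneg _) (by norm_num)
    refine (abs_sum_le_of_abs_le (A := n * (2 * D) * 2) fun p => ?_).trans (le_of_eq (by ring))
    rw [abs_mul]
    exact mul_le_mul (h4 p) (hAbd p b) (abs_nonneg _) ((abs_nonneg _).trans (h4 p))

end PointwiseBounds

/-! ### The Ricci–DeTurck operator -/

section Operator

variable {n : ℕ}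

/-- The quadratic gradient term of the flat-background Ricci–DeTurck operator. -/
def ricciDeTurckQuadratic (k : Eucl n → Matrix (Fin n) (Fin n) ℝ) (i j : Fin n)
    (x : Eucl n) : ℝ :=
  ∑ a, ∑ b, ∑ p, ∑ q, (k x)⁻¹ a b * (k x)⁻¹ p q *
    ( pd i (fun y => k y p a) x * pd j (fun y => k y q b) x
      + 2 * pd a (fun y => k y j p) x * pd q (fun y => k y i b) x
      - 2 * pd a (fun y => k y j p) x * pd b (fun y => k y i q) x
      - 2 * pd j (fun y => k y p a) x * pd b (fun y => k y i q) x
      - 2 * pd i (fun y => k y p a) x * pd b (fun y => k y j q) x )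

lemma boundedAt_ricciDeTurckQuadratic {k : Eucl n → Matrix (Fin n) (Fin n) ℝ} {x : Eucl n}
    {A B D H : ℝ} (hinv : ∀ a b, BoundedAt (fun y => (k y)⁻¹ a b) x A B)
    (hgrad : ∀ c i j, BoundedAt (pd c fun y => k y i j) x D H) (i j : Fin n) :
    BoundedAt (ricciDeTurckQuadratic k i j) x (9 * n ^ 4 * A ^ 2 * D ^ 2)
      (18 * n ^ 4 * (A * B * D ^ 2 + A ^ 2 * (D * H))) := by
  have hE : ∀ a b p q, BoundedAt (fun x => pd i (fun y => k y p a) x * pd j (fun y => k y q b) x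
      + 2 * pd a (fun y => k y j p) x * pd q (fun y => k y i b) x
      - 2 * pd a (fun y => k y j p) x * pd b (fun y => k y i q) x
      - 2 * pd j (fun y => k y p a) x * pd b (fun y => k y i q) x
      - 2 * pd i (fun y => k y p a) x * pd b (fun y => k y j q) x) x
      (9 * D ^ 2) (18 * (D * H)) := fun a b p q => by
    have h2 := fun c d p q r s => ((hgrad c p q).const_mul 2).mul (hgrad d r s)
    convert (((((hgrad i p a).mul (hgrad j q b)).add (h2 a q j p i b)).sub
      (h2 a b j p i q)).sub (h2 j b p a i q)).sub (h2 i b p a j q) using 1 <;>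
      norm_num <;> ring
  have h := BoundedAt.sum fun a => BoundedAt.sum fun b => BoundedAt.sum fun p =>
    BoundedAt.sum fun q => ((hinv a b).mul (hinv p q)).mul (hE a b p q)
  convert h using 1
  · rfl
  · ring
  · ring

/-- Differentiating the Ricci–DeTurck operator yields the second-order operator applied to the
derivative, up to terms controlled by the gradient and the Hessian. -/
lemma abs_pd_ricciDeTurck_sub_le {k : Eucl n → Matrix (Fin n) (Fin n) ℝ} {U : Set (Eucl n)}
    (hU : IsOpen U) {x : Eucl n} (hx : x ∈ U)
    (hk : ∀ i j, ContDiffOn ℝ (⊤ : ℕ∞) (fun y => k y i j) U)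
    (hdet : ∀ y ∈ U, IsUnit (k y).det) (hdist : matDistSq (k x) 1 ≤ (1 / 10) ^ 2) {D H : ℝ}
    (hD : ∀ c i j, |pd c (fun y => k y i j) x| ≤ D)
    (hH : ∀ a c i j, |pd a (pd c fun y => k y i j) x| ≤ H) (c i j : Fin n) :
    |pd c (fun y => (∑ a, ∑ b, (k y)⁻¹ a b * pd a (pd b fun z => k z i j) y)
          + (1 / 2) * ricciDeTurckQuadratic k i j y) x
        - ∑ a, ∑ b, (k x)⁻¹ a b * pd a (pd b (pd c fun y => k y i j)) x|
      ≤ (40 * n ^ 4 + 72 * n ^ 6) * (D * H + D ^ 3) := by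
  have hd1 : ∀ c i j, ContDiffOn ℝ (⊤ : ℕ∞) (pd c fun y => k y i j) U := fun c i j =>
    (hk i j).pd hU
  have hd2 : ∀ a c i j, DifferentiableAt ℝ (pd a (pd c fun y => k y i j)) x := fun a c i j =>
    ((hd1 c i j).pd hU).differentiableAt_of_isOpen_s4 hU hx
  have hinv := boundedAt_inv_apply hU hx
    (fun i j => (hk i j).differentiableAt_of_isOpen_s4 hU hx) hdet hdist hD
  have hQ := (boundedAt_ricciDeTurckQuadratic hinv (fun c i j =>
    ⟨(hd1 c i j).differentiableAt_of_isOpen_s4 hU hx, hD c i j, fun a => hH a c i j⟩) i j).const_mul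
      (1 / 2)
  have hterm : ∀ a b, DifferentiableAt ℝ
      (fun y => (k y)⁻¹ a b * pd a (pd b fun z => k z i j) y) x := fun a b =>
    (hinv a b).differentiableAt.mul (hd2 a b i j)
  have hcomm : ∀ a b, pd c (pd a (pd b fun z => k z i j)) x
      = pd a (pd b (pd c fun z => k z i j)) x := fun a b => by
    rw [pd_comm hU (hd1 b i j) hx]
    exact pd_congr hU hx fun y hy => pd_comm hU (hk i j) hy
  rw [pd_add (DifferentiableAt.fun_sum fun a _ => DifferentiableAt.fun_sum fun b _ => hterm a b)
    hQ.differentiableAt, pd_sum fun a => DifferentiableAt.fun_sum fun b _ => hterm a b]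
  simp only [pd_sum fun b => hterm _ b, pd_mul (hinv _ _).differentiableAt (hd2 _ _ i j), hcomm,
    Finset.sum_add_distrib]
  rw [add_right_comm, add_sub_cancel_right]
  have hD0 : 0 ≤ D := (abs_nonneg _).trans (hD c i j)
  have hH0 : 0 ≤ H := (abs_nonneg _).trans (hH c c i j)
  have hlin : |∑ a, ∑ b, pd c (fun y => (k y)⁻¹ a b) x * pd a (pd b fun z => k z i j) x|
      ≤ n * (n * (4 * n ^ 2 * D * H)) :=
    abs_sum_le_of_abs_le fun a => abs_sum_le_of_abs_le fun b => by
      rw [abs_mul]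
      exact mul_le_mul ((hinv a b).abs_pd_le c) (hH a b i j) (abs_nonneg _) (by positivity)
  refine (abs_add_le _ _).trans ((add_le_add hlin (hQ.abs_pd_le c)).trans ?_)
  rw [abs_of_pos (by norm_num)]
  have h1 : (0 : ℝ) ≤ n ^ 6 * (D * H) := by positivity
  have h2 : (0 : ℝ) ≤ n ^ 4 * D ^ 3 := by positivity
  nlinarith

end Operator

/-! ### The evolution inequality -/

section Evolution

variable {n : ℕ}

lemma pd_pd_sum_sq {ι : Type*} [Fintype ι] {u : ι → Eucl n → ℝ} {U : Set (Eucl n)}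
    (hU : IsOpen U) {x : Eucl n} (hx : x ∈ U) (hu : ∀ k, ContDiffOn ℝ (⊤ : ℕ∞) (u k) U)
    (a b : Fin n) :
    pd a (pd b fun y => ∑ k, u k y ^ 2) x
      = ∑ k, 2 * (pd a (u k) x * pd b (u k) x + u k x * pd a (pd b (u k)) x) := by
  have hd : ∀ k, ∀ y ∈ U, DifferentiableAt ℝ (u k) y := fun k y hy =>
    (hu k).differentiableAt_of_isOpen_s4 hU hy
  have hd2 : ∀ k, DifferentiableAt ℝ (pd b (u k)) x := fun k =>
    ((hu k).pd hU).differentiableAt_of_isOpen_s4 hU hx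
  have hb : ∀ y ∈ U, pd b (fun y => ∑ k, u k y ^ 2) y
      = ∑ k, (pd b (u k) y * u k y + u k y * pd b (u k) y) := fun y hy => by
    simp only [pow_two]
    rw [pd_sum fun k => (hd k y hy).fun_mul (hd k y hy)]
    simp only [pd_mul (hd _ y hy) (hd _ y hy)]
  have hl := fun k => (hd2 k).fun_mul (hd k x hx)
  have hr := fun k => (hd k x hx).fun_mul (hd2 k)
  rw [pd_congr hU hx hb, pd_sum fun k => (hl k).fun_add (hr k)]
  refine Finset.sum_congr rfl fun k _ => ?_
  rw [pd_add (hl k) (hr k), pd_mul (hd2 k) (hd k x hx), pd_mul (hd k x hx) (hd2 k)]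
  ring

/-- The algebraic core of the evolution inequality: coercivity of the leading coefficients absorbs
the part of the error which is linear in the Hessian `X`. -/
lemma sum_mul_le_of_coercive {ι : Type*} [Fintype ι] {A : Fin n → Fin n → ℝ}
    (hA : ∀ w : Fin n → ℝ, (7 / 10) * ∑ a, w a ^ 2 ≤ ∑ a, ∑ b, A a b * (w a * w b))
    {G R V : ι → ℝ} {X : Fin n → ι → ℝ} {T : Fin n → Fin n → ι → ℝ} {D H C : ℝ}
    (hH : ∑ a, ∑ k, X a k ^ 2 = H ^ 2) (hG : ∀ k, |G k| ≤ D)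
    (hV : ∀ k, V k = ∑ a, ∑ b, A a b * T a b k + R k)
    (hR : ∀ k, |R k| ≤ C * (D * H + D ^ 3)) :
    ∑ k, 2 * G k * V k
      ≤ (∑ a, ∑ b, A a b * ∑ k, 2 * (X a k * X b k + G k * T a b k)) - H ^ 2
        + ((2 * Fintype.card ι * C) ^ 2 + 2 * Fintype.card ι * C) * D ^ 4 := by
  have hsplit : ∑ a, ∑ b, A a b * ∑ k, 2 * (X a k * X b k + G k * T a b k)
      = ∑ k, (2 * ∑ a, ∑ b, A a b * (X a k * X b k)
        + 2 * G k * ∑ a, ∑ b, A a b * T a b k) := by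
    simp only [Finset.mul_sum, ← Finset.sum_add_distrib]
    rw [Finset.sum_congr rfl fun a _ => Finset.sum_comm, Finset.sum_comm]
    refine Finset.sum_congr rfl fun k _ => Finset.sum_congr rfl fun a _ =>
      Finset.sum_congr rfl fun b _ => by ring
  have hX : (7 / 5) * H ^ 2 ≤ ∑ k, 2 * ∑ a, ∑ b, A a b * (X a k * X b k) := by
    rw [← hH, Finset.sum_comm, Finset.mul_sum]
    exact Finset.sum_le_sum fun k _ => by linarith [hA fun a => X a k]
  have hGR : ∑ k, 2 * G k * R k
      ≤ Fintype.card ι * (2 * D * (C * (D * H + D ^ 3))) := by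
    refine (Finset.sum_le_card_nsmul Finset.univ _ (2 * D * (C * (D * H + D ^ 3)))
      fun k _ => ?_).trans (by simp)
    have h1 : G k * R k ≤ D * (C * (D * H + D ^ 3)) :=
      (le_abs_self _).trans ((abs_mul _ _).trans_le
        (mul_le_mul (hG k) (hR k) (abs_nonneg _) ((abs_nonneg _).trans (hG k))))
    linarith
  have hlhs : ∑ k, 2 * G k * V k
      = ∑ k, 2 * G k * ∑ a, ∑ b, A a b * T a b k + ∑ k, 2 * G k * R k := by
    rw [← Finset.sum_add_distrib]
    exact Finset.sum_congr rfl fun k _ => by rw [hV]; ring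
  rw [hlhs, hsplit, Finset.sum_add_distrib]
  nlinarith [sq_nonneg (2 * H - 5 * (Fintype.card ι * C) * D ^ 2),
    sq_nonneg (Fintype.card ι * C * D ^ 2)]

lemma gradSq_eq_sum (g : ℝ → Eucl n → Matrix (Fin n) (Fin n) ℝ) (t : ℝ) (x : Eucl n) :
    gradSq g t x
      = ∑ k : Fin n × Fin n × Fin n, (pd k.1 (fun y => g t y k.2.1 k.2.2) x) ^ 2 := by
  simp [gradSq, Fintype.sum_prod_type]

lemma hessSq_eq_sum (g : ℝ → Eucl n → Matrix (Fin n) (Fin n) ℝ) (t : ℝ) (x : Eucl n) :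
    hessSq g t x
      = ∑ a, ∑ k : Fin n × Fin n × Fin n,
        (pd a (pd k.1 fun y => g t y k.2.1 k.2.2) x) ^ 2 := by
  simp [hessSq, Fintype.sum_prod_type]

end Evolution

/-- pointwise evolution inequality for `|∂g|²` along a Ricci–DeTurck
flow with flat background:
`∂_t |∂g|² ≤ ∑ g^{ab} ∂_a ∂_b |∂g|² − |∂²g|² + c(n) |∂g|⁴`. -/
theorem gradSq_evolution_inequality (n : ℕ) (hn : 1 ≤ n) :
    ∃ ε₀ : ℝ, 0 < ε₀ ∧ ∃ c : ℝ, 0 < c ∧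
      ∀ (U : Set (Eucl n)), IsOpen U →
      ∀ (I : Set ℝ), IsOpen I → I.OrdConnected →
      ∀ g : ℝ → Eucl n → Matrix (Fin n) (Fin n) ℝ,
        IsRicciDeTurckFlow g I U →
        (∀ t ∈ I, ∀ x ∈ U, Real.sqrt (matDistSq (g t x) 1) ≤ ε₀) →
        ∀ t ∈ I, ∀ x ∈ U,
          deriv (fun s => gradSq g s x) t ≤
            (∑ a, ∑ b, (g t x)⁻¹ a b *
                pd a (fun y => pd b (fun z => gradSq g t z) y) x)
              - hessSq g t x + c * (gradSq g t x) ^ 2 := by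

  obtain ⟨K, hK⟩ : ∃ K : ℝ, K = 2 * Fintype.card (Fin n × Fin n × Fin n)
    * (40 * n ^ 4 + 72 * n ^ 6) := ⟨_, rfl⟩
  have hK0 : 0 ≤ K := by rw [hK]; positivity
  refine ⟨1 / 10, by norm_num, K ^ 2 + K + 1, by positivity, ?_⟩
  intro U hU I hI _ g hg hclose t ht x hx
  obtain ⟨hsmooth, hpos, heq⟩ := hg
  have hdist : matDistSq (g t x) 1 ≤ (1 / 10) ^ 2 :=
    (Real.sqrt_le_left (by norm_num)).1 (hclose t ht x hx)
  have hdet : ∀ y ∈ U, IsUnit (g t y).det := fun y hy => (hpos t ht y hy).2.det_pos.ne'.isUnit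
  have hslice : ∀ i j, ContDiffOn ℝ (⊤ : ℕ∞) (fun y => g t y i j) U := fun i j =>
    contDiffOn_slice (hsmooth i j) ht
  have hG0 : 0 ≤ gradSq g t x := by rw [gradSq_eq_sum]; positivity
  have hH0 : 0 ≤ hessSq g t x := by rw [hessSq_eq_sum]; positivity
  have hD : ∀ c i j, |pd c (fun y => g t y i j) x| ≤ √(gradSq g t x) := fun c i j => by
    refine Real.abs_le_sqrt ?_
    rw [gradSq_eq_sum]
    exact Finset.single_le_sum
      (f := fun k : Fin n × Fin n × Fin n => (pd k.1 (fun y => g t y k.2.1 k.2.2) x) ^ 2)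
      (fun _ _ => sq_nonneg _) (Finset.mem_univ (c, i, j))
  have hH : ∀ a c i j, |pd a (pd c fun y => g t y i j) x| ≤ √(hessSq g t x) := fun a c i j => by
    refine Real.abs_le_sqrt ?_
    rw [hessSq_eq_sum]
    refine le_trans ?_ (Finset.single_le_sum (f := fun a => ∑ k : Fin n × Fin n × Fin n,
      (pd a (pd k.1 fun y => g t y k.2.1 k.2.2) x) ^ 2)
      (fun _ _ => Finset.sum_nonneg fun _ _ => sq_nonneg _) (Finset.mem_univ a))
    exact Finset.single_le_sum
      (f := fun k : Fin n × Fin n × Fin n => (pd a (pd k.1 fun y => g t y k.2.1 k.2.2) x) ^ 2)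
      (fun _ _ => sq_nonneg _) (Finset.mem_univ (c, i, j))
  have hderiv : deriv (fun s => gradSq g s x) t
      = ∑ k : Fin n × Fin n × Fin n, 2 * pd k.1 (fun y => g t y k.2.1 k.2.2) x
        * pd k.1 (fun y => deriv (fun s => g s y k.2.1 k.2.2) t) x := by
    simp only [gradSq_eq_sum]
    refine (HasDerivAt.fun_sum fun k _ => ?_).deriv
    simpa using (hasDerivAt_pd (c := k.1) hI hU (hsmooth k.2.1 k.2.2) ht hx).fun_pow 2
  have herr := abs_pd_ricciDeTurck_sub_le hU hx hslice hdet hdist hD hH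
  have hlap : ∀ a b, pd a (fun y => pd b (fun z => gradSq g t z) y) x
      = ∑ k : Fin n × Fin n × Fin n,
        2 * (pd a (pd k.1 fun y => g t y k.2.1 k.2.2) x
            * pd b (pd k.1 fun y => g t y k.2.1 k.2.2) x
          + pd k.1 (fun y => g t y k.2.1 k.2.2) x
            * pd a (pd b (pd k.1 fun y => g t y k.2.1 k.2.2)) x) := fun a b => by
    simp only [gradSq_eq_sum]
    exact pd_pd_sum_sq hU hx (fun k : Fin n × Fin n × Fin n => (hslice k.2.1 k.2.2).pd hU) a b
  have hmain := sum_mul_le_of_coercive (inv_quadratic_form_ge (hdet x hx) hdist)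
    (G := fun k : Fin n × Fin n × Fin n => pd k.1 (fun y => g t y k.2.1 k.2.2) x)
    (T := fun a b k => pd a (pd b (pd k.1 fun y => g t y k.2.1 k.2.2)) x)
    (V := fun k => pd k.1 (fun y => deriv (fun s => g s y k.2.1 k.2.2) t) x)
    (by rw [Real.sq_sqrt hH0, hessSq_eq_sum]) (fun k => hD _ _ _)
    (fun k => (add_sub_cancel _ _).symm) (fun k => by
      rw [pd_congr hU hx fun y hy => heq t ht y hy k.2.1 k.2.2]
      exact herr k.1 k.2.1 k.2.2)
  rw [← hderiv, ← hK, Real.sq_sqrt hH0, show √(gradSq g t x) ^ 4 = gradSq g t x ^ 2 by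
    rw [show 4 = 2 * 2 from rfl, pow_mul, Real.sq_sqrt hG0]] at hmain
  simp only [hlap]
  nlinarith [sq_nonneg (gradSq g t x)]
end
end

section
/- Pointwise evolution inequality for the squared distance to the background metric (flat-background case of inequality (3.4) in the proof of Theorem 4.1 of the paper): There exists ε₀(n) > 0 such that for every open set U ⊆ ℝⁿ, every open time interval I, and every Ricci–DeTurck flow g on U over I with |g(t,x) − δ| ≤ ε₀(n) for all (t,x) ∈ I × U, the following holds at every point (t,x) ∈ I × U: ∂_t(|g − δ|²) ≤ ∑_{a,b} g^{ab} ∂_a ∂_b (|g − δ|²) − |∂g|². -/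
open MeasureTheory Metric Set Filter Topology

noncomputable section

theorem abs_sum_fin_le {n : ℕ} {f : Fin n → ℝ} {C : ℝ} (h : ∀ i, |f i| ≤ C) :
    |∑ i, f i| ≤ n * C := by
  calc |∑ i, f i| ≤ ∑ i, |f i| := Finset.abs_sum_le_sum_abs _ _
    _ ≤ ∑ _i : Fin n, C := Finset.sum_le_sum fun i _ => h i
    _ = n * C := by simp

/-- If `g` is entrywise `ε`-close to the identity, then its inverse is entrywise
`2nε`-close to the identity. -/
theorem abs_inv_sub_one_le {n : ℕ} {g : Matrix (Fin n) (Fin n) ℝ} (hg : g.PosDef) {ε : ℝ}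
    (hε : n * ε ≤ 1 / 2) (h : ∀ i j, |g i j - (1 : Matrix (Fin n) (Fin n) ℝ) i j| ≤ ε)
    (a b : Fin n) : |g⁻¹ a b - (1 : Matrix (Fin n) (Fin n) ℝ) a b| ≤ 2 * n * ε := by
  have hinv : g⁻¹ * g = 1 := Matrix.nonsing_inv_mul g (hg.det_pos.ne'.isUnit)
  have key : g⁻¹ - 1 = -(g⁻¹ * (g - 1)) := by rw [mul_sub, hinv, mul_one]; abel
  obtain ⟨⟨a₀, b₀⟩, -, hmax⟩ := Finset.exists_max_image Finset.univ
    (fun p : Fin n × Fin n => |(g⁻¹ - 1) p.1 p.2|) ⟨(a, b), Finset.mem_univ _⟩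
  obtain ⟨M, hM⟩ : ∃ M, M = |(g⁻¹ - 1) a₀ b₀| := ⟨_, rfl⟩
  have hle : ∀ i j, |(g⁻¹ - 1) i j| ≤ M := fun i j => by
    rw [hM]; exact hmax (i, j) (Finset.mem_univ _)
  have hone : ∀ i j, |(1 : Matrix (Fin n) (Fin n) ℝ) i j| ≤ 1 := fun i j => by
    rw [Matrix.one_apply]; split_ifs <;> simp
  have hA : ∀ i j, |g⁻¹ i j| ≤ M + 1 := fun i j => by
    have h1 := hle i j
    have h2 := hone i j
    have h3 := abs_add_le ((g⁻¹ - 1) i j) ((1 : Matrix (Fin n) (Fin n) ℝ) i j)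
    rw [Matrix.sub_apply, sub_add_cancel] at h3
    rw [Matrix.sub_apply] at h1
    linarith
  have hM0 : 0 ≤ M := hM ▸ abs_nonneg _
  have hbound : M ≤ n * ((M + 1) * ε) := by
    nth_rw 1 [hM]
    rw [key, Matrix.neg_apply, abs_neg, Matrix.mul_apply]
    refine abs_sum_fin_le fun k => ?_
    rw [abs_mul]
    exact mul_le_mul (hA _ _) (h _ _) (abs_nonneg _) (by linarith)
  have := hle a b
  rw [Matrix.sub_apply] at this
  nlinarith

/-- The derivative of `∑ (u i j - c i j) ^ 2` in a coordinate direction. -/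
theorem pd_sum_sq_sub {n : ℕ} {u : Fin n → Fin n → Eucl n → ℝ} (c : Fin n → Fin n → ℝ)
    (b : Fin n) {y : Eucl n} (h : ∀ i j, DifferentiableAt ℝ (u i j) y) :
    pd b (fun z => ∑ i, ∑ j, (u i j z - c i j) ^ 2) y =
      ∑ i, ∑ j, 2 * (u i j y - c i j) * pd b (u i j) y := by
  have H : HasFDerivAt (fun z => ∑ i, ∑ j, (u i j z - c i j) ^ 2)
      (∑ i, ∑ j, (2 * (u i j y - c i j)) • fderiv ℝ (u i j) y) y := by
    refine HasFDerivAt.fun_sum fun i _ => HasFDerivAt.fun_sum fun j _ => ?_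
    simpa using ((h i j).hasFDerivAt.sub_const (c i j)).pow 2
  simp [pd, H.fderiv]

theorem pd_sum_mul {n : ℕ} {u v : Fin n → Fin n → Eucl n → ℝ} (c : Fin n → Fin n → ℝ)
    (a : Fin n) {y : Eucl n} (hu : ∀ i j, DifferentiableAt ℝ (u i j) y)
    (hv : ∀ i j, DifferentiableAt ℝ (v i j) y) :
    pd a (fun z => ∑ i, ∑ j, 2 * (u i j z - c i j) * v i j z) y =
      ∑ i, ∑ j, (2 * (u i j y - c i j) * pd a (v i j) y + 2 * (pd a (u i j) y * v i j y)) := by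
  have H : HasFDerivAt (fun z => ∑ i, ∑ j, 2 * (u i j z - c i j) * v i j z)
      (∑ i, ∑ j, ((2 * (u i j y - c i j)) • fderiv ℝ (v i j) y +
        v i j y • ((2 : ℝ) • fderiv ℝ (u i j) y))) y := by
    refine HasFDerivAt.fun_sum fun i _ => HasFDerivAt.fun_sum fun j _ => ?_
    exact (((hu i j).hasFDerivAt.sub_const (c i j)).const_mul 2).mul (hv i j).hasFDerivAt
  simp only [pd, H.fderiv, sum_apply, add_apply, smul_apply, smul_eq_mul]
  exact Finset.sum_congr rfl fun i _ => Finset.sum_congr rfl fun j _ => by ring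

/-- Second derivatives of `∑ (u i j - c i j) ^ 2`. -/
theorem pd_pd_sum_sq_sub {n : ℕ} {u : Fin n → Fin n → Eucl n → ℝ} (c : Fin n → Fin n → ℝ)
    (a b : Fin n) {x : Eucl n} (h : ∀ i j, ContDiffAt ℝ 2 (u i j) x) :
    pd a (fun y => pd b (fun z => ∑ i, ∑ j, (u i j z - c i j) ^ 2) y) x =
      ∑ i, ∑ j, (2 * (u i j x - c i j) * pd a (pd b (u i j)) x +
        2 * (pd a (u i j) x * pd b (u i j) x)) := by
  have hev : (fun y => pd b (fun z => ∑ i, ∑ j, (u i j z - c i j) ^ 2) y) =ᶠ[𝓝 x]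
      fun y => ∑ i, ∑ j, 2 * (u i j y - c i j) * pd b (u i j) y := by
    have : ∀ᶠ y in 𝓝 x, ∀ i j, ContDiffAt ℝ 2 (u i j) y :=
      eventually_all.2 fun i => eventually_all.2 fun j => (h i j).eventually (by simp)
    filter_upwards [this] with y hy
    exact pd_sum_sq_sub c b fun i j => (hy i j).differentiableAt (by simp)
  have hpd : ∀ i j, DifferentiableAt ℝ (pd b (u i j)) x := fun i j => by
    have h1 : DifferentiableAt ℝ (fderiv ℝ (u i j)) x :=
      ((h i j).fderiv_right (m := 1) (by norm_num)).differentiableAt (by simp)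
    exact h1.clm_apply (differentiableAt_const _)
  rw [pd, hev.fderiv_eq]
  exact pd_sum_mul c a (fun i j => (h i j).differentiableAt (by simp)) hpd

theorem abs_mul_le_of_sq_le {x y S : ℝ} (hx : x ^ 2 ≤ S) (hy : y ^ 2 ≤ S) : |x * y| ≤ S := by
  rw [abs_le]
  constructor <;> nlinarith [sq_nonneg (x - y), sq_nonneg (x + y)]

/-- For an inverse metric `A` and a deviation `h` close to `1` and `0` respectively, the
quadratic gradient terms of the flow are absorbed by the good gradient term. -/
theorem sum_mul_quadratic_le {n : ℕ} (hn : 1 ≤ n) {A h : Matrix (Fin n) (Fin n) ℝ}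
    (D : Fin n → Fin n → Fin n → ℝ) {ε : ℝ} (hε0 : 0 ≤ ε) (hε : 40 * n ^ 6 * ε ≤ 1)
    (hh : ∀ i j, |h i j| ≤ ε)
    (hA : ∀ a b, |A a b - (1 : Matrix (Fin n) (Fin n) ℝ) a b| ≤ 2 * n * ε) :
    ∑ i, ∑ j, h i j * ∑ a, ∑ b, ∑ p, ∑ q, A a b * A p q *
        (D i p a * D j q b + 2 * D a j p * D q i b - 2 * D a j p * D b i q
          - 2 * D j p a * D b i q - 2 * D i p a * D b j q) ≤
      2 * (∑ a, ∑ b, A a b * ∑ i, ∑ j, D a i j * D b i j) - ∑ a, ∑ i, ∑ j, D a i j ^ 2 := by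
  have hn' : (1 : ℝ) ≤ n := by exact_mod_cast hn
  set S := ∑ a, ∑ i, ∑ j, D a i j ^ 2 with hS
  have hS0 : 0 ≤ S := by positivity
  have hD : ∀ a i j, D a i j ^ 2 ≤ S := fun a i j => by
    calc D a i j ^ 2 ≤ ∑ j, D a i j ^ 2 :=
          Finset.single_le_sum (f := fun j => D a i j ^ 2) (fun _ _ => by positivity)
            (Finset.mem_univ j)
      _ ≤ ∑ i, ∑ j, D a i j ^ 2 :=
          Finset.single_le_sum (f := fun i => ∑ j, D a i j ^ 2) (fun _ _ => by positivity)
            (Finset.mem_univ i)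
      _ ≤ S :=
          Finset.single_le_sum (f := fun a => ∑ i, ∑ j, D a i j ^ 2)
            (fun _ _ => by positivity) (Finset.mem_univ a)
  have hDD : ∀ a i j b k l, |D a i j * D b k l| ≤ S := fun a i j b k l =>
    abs_mul_le_of_sq_le (hD a i j) (hD b k l)
  have hsmall : 2 * n * ε ≤ 1 := by
    have : (n : ℝ) ≤ n ^ 6 := le_self_pow₀ hn' (by norm_num)
    nlinarith
  have hA2 : ∀ a b, |A a b| ≤ 2 := fun a b => by
    have h1 := abs_add_le (A a b - (1 : Matrix (Fin n) (Fin n) ℝ) a b)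
      ((1 : Matrix (Fin n) (Fin n) ℝ) a b)
    have h2 : |(1 : Matrix (Fin n) (Fin n) ℝ) a b| ≤ 1 := by
      rw [Matrix.one_apply]; split_ifs <;> simp
    rw [sub_add_cancel] at h1
    linarith [hA a b]
  have hQ : |∑ i, ∑ j, h i j * ∑ a, ∑ b, ∑ p, ∑ q, A a b * A p q *
        (D i p a * D j q b + 2 * D a j p * D q i b - 2 * D a j p * D b i q
          - 2 * D j p a * D b i q - 2 * D i p a * D b j q)| ≤
      n * (n * (ε * (n * (n * (n * (n * (2 * 2 * (9 * S)))))))) := by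
    refine abs_sum_fin_le fun i => abs_sum_fin_le fun j => ?_
    rw [abs_mul]
    refine mul_le_mul (hh i j) ?_ (abs_nonneg _) hε0
    refine abs_sum_fin_le fun a => abs_sum_fin_le fun b => abs_sum_fin_le fun p =>
      abs_sum_fin_le fun q => ?_
    rw [abs_mul, abs_mul]
    refine mul_le_mul (mul_le_mul (hA2 _ _) (hA2 _ _) (abs_nonneg _) (by norm_num)) ?_
      (abs_nonneg _) (by norm_num)
    have h1 := abs_le.1 (hDD i p a j q b)
    have h2 := abs_le.1 (hDD a j p q i b)
    have h3 := abs_le.1 (hDD a j p b i q)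
    have h4 := abs_le.1 (hDD j p a b i q)
    have h5 := abs_le.1 (hDD i p a b j q)
    rw [abs_le]
    constructor <;> linarith
  have hE : |∑ a, ∑ b, (A a b - (1 : Matrix (Fin n) (Fin n) ℝ) a b) *
      ∑ i, ∑ j, D a i j * D b i j| ≤ n * (n * (2 * n * ε * (n * (n * S)))) := by
    refine abs_sum_fin_le fun a => abs_sum_fin_le fun b => ?_
    rw [abs_mul]
    exact mul_le_mul (hA a b) (abs_sum_fin_le fun i => abs_sum_fin_le fun j => hDD _ _ _ _ _ _)
      (abs_nonneg _) (by positivity)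
  have hsplit : ∑ a, ∑ b, (A a b - (1 : Matrix (Fin n) (Fin n) ℝ) a b) *
      ∑ i, ∑ j, D a i j * D b i j = (∑ a, ∑ b, A a b * ∑ i, ∑ j, D a i j * D b i j) - S := by
    simp [sub_mul, Finset.sum_sub_distrib, Matrix.one_apply, hS, pow_two]
  rw [hsplit] at hE
  have hpow : (n : ℝ) ^ 5 ≤ n ^ 6 := pow_le_pow_right₀ hn' (by norm_num)
  have hεS : 0 ≤ ε * S := mul_nonneg hε0 hS0
  have h1 := mul_le_mul_of_nonneg_right hpow hεS
  have h2 := mul_le_mul_of_nonneg_right hε hS0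
  have h3 := (abs_le.1 hQ).2
  have h4 := (abs_le.1 hE).1
  ring_nf at h1 h2 h3 h4 ⊢
  linarith

theorem abs_sub_le_sqrt_matDistSq {n : ℕ} (A B : Matrix (Fin n) (Fin n) ℝ) (i j : Fin n) :
    |A i j - B i j| ≤ Real.sqrt (matDistSq A B) := by
  refine Real.abs_le_sqrt ?_
  calc (A i j - B i j) ^ 2 ≤ ∑ j, (A i j - B i j) ^ 2 :=
        Finset.single_le_sum (f := fun j => (A i j - B i j) ^ 2) (fun _ _ => by positivity)
          (Finset.mem_univ j)
    _ ≤ matDistSq A B :=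
        Finset.single_le_sum (f := fun i => ∑ j, (A i j - B i j) ^ 2)
          (fun _ _ => by positivity) (Finset.mem_univ i)

/-- pointwise evolution inequality for `|g − δ|²` along a Ricci–DeTurck
flow with flat background:
`∂_t |g − δ|² ≤ ∑ g^{ab} ∂_a ∂_b |g − δ|² − |∂g|²`. -/
theorem distSq_evolution_inequality (n : ℕ) (hn : 1 ≤ n) :
    ∃ ε₀ : ℝ, 0 < ε₀ ∧
      ∀ (U : Set (Eucl n)), IsOpen U →
      ∀ (I : Set ℝ), IsOpen I → I.OrdConnected →
      ∀ g : ℝ → Eucl n → Matrix (Fin n) (Fin n) ℝ,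
        IsRicciDeTurckFlow g I U →
        (∀ t ∈ I, ∀ x ∈ U, Real.sqrt (matDistSq (g t x) 1) ≤ ε₀) →
        ∀ t ∈ I, ∀ x ∈ U,
          deriv (fun s => matDistSq (g s x) 1) t ≤
            (∑ a, ∑ b, (g t x)⁻¹ a b *
                pd a (fun y => pd b (fun z => matDistSq (g t z) 1) y) x)
              - gradSq g t x := by
  have hn' : (1 : ℝ) ≤ n := by exact_mod_cast hn
  have hn0 : (0 : ℝ) < n := by linarith
  refine ⟨1 / (40 * n ^ 6), by positivity, ?_⟩
  set ε : ℝ := 1 / (40 * n ^ 6) with hεdef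
  have hε0 : 0 ≤ ε := by positivity
  have hε : 40 * n ^ 6 * ε ≤ 1 := by rw [hεdef]; field_simp; rfl
  intro U hU I hI _ g ⟨hsm, hpos, heq⟩ hclose t ht x hx
  have hat : ∀ i j, ContDiffAt ℝ (⊤ : ℕ∞) (fun p : ℝ × Eucl n => g p.1 p.2 i j) (t, x) :=
    fun i j => (hsm i j).contDiffAt ((hI.prod hU).mem_nhds ⟨ht, hx⟩)
  have htime : ∀ i j, DifferentiableAt ℝ (fun s => g s x i j) t := fun i j =>
    DifferentiableAt.comp t (f := fun s : ℝ => (s, x)) ((hat i j).differentiableAt (by simp))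
      (by fun_prop)
  have hspace : ∀ i j, ContDiffAt ℝ 2 (fun y => g t y i j) x := fun i j =>
    ContDiffAt.comp x (f := fun y : Eucl n => (t, y))
      ((hat i j).of_le (by norm_cast)) (by fun_prop)
  have hh : ∀ i j, |g t x i j - (1 : Matrix (Fin n) (Fin n) ℝ) i j| ≤ ε := fun i j =>
    (abs_sub_le_sqrt_matDistSq _ _ i j).trans (hclose t ht x hx)
  have hnε : n * ε ≤ 1 / 2 := by
    have : (n : ℝ) ≤ n ^ 6 := le_self_pow₀ hn' (by norm_num)
    nlinarith
  have hA := abs_inv_sub_one_le (hpos t ht x hx).2 hnε hh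
  have hL : deriv (fun s => matDistSq (g s x) 1) t = ∑ i, ∑ j,
      2 * (g t x i j - (1 : Matrix (Fin n) (Fin n) ℝ) i j) * deriv (fun s => g s x i j) t := by
    refine HasDerivAt.deriv ?_
    unfold matDistSq
    refine HasDerivAt.fun_sum fun i _ => HasDerivAt.fun_sum fun j _ => ?_
    simpa using ((htime i j).hasDerivAt.sub_const ((1 : Matrix (Fin n) (Fin n) ℝ) i j)).fun_pow 2
  have hR : ∀ a b, pd a (fun y => pd b (fun z => matDistSq (g t z) 1) y) x =
      ∑ i, ∑ j, (2 * (g t x i j - (1 : Matrix (Fin n) (Fin n) ℝ) i j) *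
        pd a (fun y => pd b (fun z => g t z i j) y) x +
        2 * (pd a (fun y => g t y i j) x * pd b (fun y => g t y i j) x)) := fun a b =>
    pd_pd_sum_sq_sub (u := fun i j y => g t y i j)
      (fun i j => (1 : Matrix (Fin n) (Fin n) ℝ) i j) a b hspace
  have key := sum_mul_quadratic_le hn (h := g t x - 1)
    (fun a i j => pd a (fun y => g t y i j) x) hε0 hε hh hA
  have hswap : ∑ a, ∑ b, (g t x)⁻¹ a b * ∑ i, ∑ j,
        2 * (g t x i j - (1 : Matrix (Fin n) (Fin n) ℝ) i j) *
          pd a (fun y => pd b (fun z => g t z i j) y) x =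
      ∑ i, ∑ j, 2 * (g t x i j - (1 : Matrix (Fin n) (Fin n) ℝ) i j) * ∑ a, ∑ b,
        (g t x)⁻¹ a b * pd a (fun y => pd b (fun z => g t z i j) y) x := by
    simp only [Finset.mul_sum]
    calc _ = ∑ a, ∑ i, ∑ b, ∑ j, (g t x)⁻¹ a b *
          (2 * (g t x i j - (1 : Matrix (Fin n) (Fin n) ℝ) i j) *
          pd a (fun y => pd b (fun z => g t z i j) y) x) :=
          Finset.sum_congr rfl fun a _ => Finset.sum_comm
      _ = ∑ i, ∑ a, ∑ j, ∑ b, (g t x)⁻¹ a b *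
          (2 * (g t x i j - (1 : Matrix (Fin n) (Fin n) ℝ) i j) *
          pd a (fun y => pd b (fun z => g t z i j) y) x) := by
          rw [Finset.sum_comm]
          exact Finset.sum_congr rfl fun i _ => Finset.sum_congr rfl fun a _ => Finset.sum_comm
      _ = _ := by
          refine Finset.sum_congr rfl fun i _ => ?_
          rw [Finset.sum_comm]
          exact Finset.sum_congr rfl fun j _ => Finset.sum_congr rfl fun a _ =>
            Finset.sum_congr rfl fun b _ => by ring
  have hRsum : ∑ a, ∑ b, (g t x)⁻¹ a b *
        pd a (fun y => pd b (fun z => matDistSq (g t z) 1) y) x =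
      (∑ i, ∑ j, 2 * (g t x i j - (1 : Matrix (Fin n) (Fin n) ℝ) i j) * ∑ a, ∑ b,
        (g t x)⁻¹ a b * pd a (fun y => pd b (fun z => g t z i j) y) x) +
      2 * ∑ a, ∑ b, (g t x)⁻¹ a b *
        ∑ i, ∑ j, pd a (fun y => g t y i j) x * pd b (fun y => g t y i j) x := by
    rw [← hswap]
    simp only [hR, Finset.sum_add_distrib, mul_add, ← Finset.mul_sum, mul_left_comm _ (2 : ℝ)]
  rw [hL, hRsum]
  simp only [heq t ht x hx, mul_add, Finset.sum_add_distrib]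
  have hQ : ∀ i j (Q : ℝ), 2 * (g t x i j - (1 : Matrix (Fin n) (Fin n) ℝ) i j) * (1 / 2 * Q) =
      (g t x - 1) i j * Q := fun i j Q => by rw [Matrix.sub_apply]; ring
  simp only [hQ]
  unfold gradSq
  linarith
end
end
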